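/- Let a homeomorphism φ : Ω → Ω̃ between two domains Ω, Ω̃ ⊆ ℝⁿ (n ≥ 2) belong to the weighted Sobolev space L¹_q(Ω,|x|^α;Ω̃) with n−1 < q < ∞ and −n/q < α < n/(q̃(n−1)), where q̃ = q/(q−n+1). Assume φ possesses the Luzin N-property and has finite distortion. Then the inverse mapping φ⁻¹ : Ω̃ → Ω belongs to the Sobolev space W¹_{1,loc}(Ω̃;Ω), and φ⁻¹ generates a bounded composition operator (φ⁻¹)* : L¹_{q̃}(Ω,|x|^{α(1−n)}) → L¹_1(Ω̃); moreover the weight function |x|^{q̃α(1−n)} satisfies the A_{q̃} condition. -/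

import Mathlib

open MeasureTheory Set Metric Filter ENNReal

noncomputable section

/-- Euclidean space `ℝⁿ`. -/
abbrev En (n : ℕ) : Type := EuclideanSpace ℝ (Fin n)

/-- A domain: an open connected set. -/
def IsDomainSet {n : ℕ} (Ω : Set (En n)) : Prop := IsOpen Ω ∧ IsConnected Ω

/-- A weight: a nonnegative locally integrable function. -/
def IsWeight (n : ℕ) (w : En n → ℝ) : Prop :=
  (∀ x, 0 ≤ w x) ∧ LocallyIntegrable w volume

/-- The Muckenhoupt `A_p` condition for the function `u` (to be applied to `u = w^p`):
`sup_B (|B|⁻¹ ∫_B u)^{1/p} (|B|⁻¹ ∫_B u^{-1/(p-1)})^{1/p'} < ∞`. -/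
def IsMuckenhoupt (n : ℕ) (p : ℝ) (u : En n → ℝ) : Prop :=
  ∃ C : ℝ≥0∞, C ≠ ⊤ ∧ ∀ (x : En n) (r : ℝ), 0 < r →
    ((volume (ball x r))⁻¹ * ∫⁻ y in ball x r, ENNReal.ofReal (u y)) ^ (1 / p) *
      ((volume (ball x r))⁻¹ *
        ∫⁻ y in ball x r, ENNReal.ofReal (u y ^ (-(1 / (p - 1))))) ^ (1 - 1 / p) ≤ C

/-- `g` is a weak gradient of `f` on `Ω` (both locally integrable on `Ω`). -/
def IsWeakGradOn {n : ℕ} (Ω : Set (En n)) (f : En n → ℝ) (g : En n → En n) : Prop :=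
  LocallyIntegrableOn f Ω volume ∧ LocallyIntegrableOn g Ω volume ∧
    ∀ ψ : En n → ℝ, ContDiff ℝ (⊤ : ℕ∞) ψ → HasCompactSupport ψ → tsupport ψ ⊆ Ω →
      ∀ i : Fin n,
        ∫ x in Ω, f x * fderiv ℝ ψ x (EuclideanSpace.single i 1) = -∫ x in Ω, g x i * ψ x

/-- The weighted Sobolev seminorm `‖f | L¹_p(Ω,w)‖`, computed from a weak gradient `g` of `f`. -/
def gradNormLp {n : ℕ} (Ω : Set (En n)) (w : En n → ℝ) (p : ℝ) (g : En n → En n) : ℝ≥0∞ :=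
  (∫⁻ x in Ω, ENNReal.ofReal (‖g x‖ * w x) ^ p) ^ (1 / p)

/-- Operator (Euclidean) norm of an `n × n` matrix. -/
def opNorm {n : ℕ} (M : Matrix (Fin n) (Fin n) ℝ) : ℝ :=
  ‖Matrix.toEuclideanCLM (𝕜 := ℝ) M‖

/-- `Dφ` is the matrix of weak partial derivatives of the mapping `φ` on `Ω`
(row `i` is the weak gradient of the `i`-th coordinate function of `φ`). -/
def IsWeakJacobiOn {n : ℕ} (Ω : Set (En n)) (φ : En n → En n)
    (Dφ : En n → Matrix (Fin n) (Fin n) ℝ) : Prop :=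
  ∀ i : Fin n, IsWeakGradOn Ω (fun x => φ x i)
    (fun x => (EuclideanSpace.equiv (Fin n) ℝ).symm (Dφ x i))

/-- `φ ∈ L¹_q(Ω,w;Ω')`: weakly differentiable with Jacobi matrix `Dφ` and
`∫_Ω |Dφ|^q w^q dx < ∞`. -/
def MapInL1q {n : ℕ} (Ω : Set (En n)) (w : En n → ℝ) (q : ℝ) (φ : En n → En n)
    (Dφ : En n → Matrix (Fin n) (Fin n) ℝ) : Prop :=
  IsWeakJacobiOn Ω φ Dφ ∧ (∫⁻ x in Ω, ENNReal.ofReal (opNorm (Dφ x) * w x) ^ q) ≠ ⊤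

/-- Finite distortion: `Dφ(x) = 0` a.e. on the zero set of the Jacobian. -/
def HasFiniteDistortionOn {n : ℕ} (Ω : Set (En n))
    (Dφ : En n → Matrix (Fin n) (Fin n) ℝ) : Prop :=
  ∀ᵐ x ∂(volume.restrict Ω), (Dφ x).det = 0 → Dφ x = 0

/-- Luzin N-property: images of null subsets of `Ω` are null. -/
def LuzinN {n : ℕ} (Ω : Set (En n)) (φ : En n → En n) : Prop :=
  ∀ E, E ⊆ Ω → volume E = 0 → volume (φ '' E) = 0

/-- `φ` is a homeomorphism of `Ω` onto `Ω'` with inverse `ψ`. -/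
def IsHomeoOn {n : ℕ} (Ω Ω' : Set (En n)) (φ ψ : En n → En n) : Prop :=
  ContinuousOn φ Ω ∧ ContinuousOn ψ Ω' ∧ MapsTo φ Ω Ω' ∧ MapsTo ψ Ω' Ω ∧
    (∀ x ∈ Ω, ψ (φ x) = x) ∧ (∀ y ∈ Ω', φ (ψ y) = y)

/-- The homeomorphism `φ : Ω → Ω'` generates a composition operator
`φ* : L¹_p(Ω',w') → L¹_q(Ω,w)` bounded by the constant `K`. -/
def CompOpBound {n : ℕ} (Ω Ω' : Set (En n)) (φ : En n → En n) (p : ℝ) (w' : En n → ℝ)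
    (q : ℝ) (w : En n → ℝ) (K : ℝ≥0∞) : Prop :=
  ∀ f gf, ContinuousOn f Ω' → IsWeakGradOn Ω' f gf → gradNormLp Ω' w' p gf ≠ ⊤ →
    ∃ g, IsWeakGradOn Ω (f ∘ φ) g ∧ gradNormLp Ω w q g ≤ K * gradNormLp Ω' w' p gf

/-- The homeomorphism `φ : Ω → Ω'` generates a bounded composition operator
`φ* : L¹_p(Ω',w') → L¹_q(Ω,w)`. -/
def BddCompOp {n : ℕ} (Ω Ω' : Set (En n)) (φ : En n → En n) (p : ℝ) (w' : En n → ℝ)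
    (q : ℝ) (w : En n → ℝ) : Prop :=
  ∃ K : ℝ≥0∞, K ≠ ⊤ ∧ CompOpBound Ω Ω' φ p w' q w K

open Topology Convolution ContDiff

section Mollification

variable {E F : Type*} [NormedAddCommGroup E] [NormedSpace ℝ E] [FiniteDimensional ℝ E]
  [MeasurableSpace E] [BorelSpace E] [NormedAddCommGroup F]

/-- Jensen's inequality for powers of nonnegative functions. -/
theorem lintegral_rpow_le_of_isProbabilityMeasure {α : Type*} [MeasurableSpace α] (μ : Measure α)
    [IsProbabilityMeasure μ] {p : ℝ} (hp : 1 ≤ p) {f : α → ℝ≥0∞} (hf : AEMeasurable f μ) :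
    (∫⁻ x, f x ∂μ) ^ p ≤ ∫⁻ x, f x ^ p ∂μ := by
  have h := eLpNorm'_le_eLpNorm'_of_exponent_le (f := f) one_pos hp μ hf.aestronglyMeasurable
  simp only [eLpNorm', enorm_eq_self, ENNReal.rpow_one, div_one] at h
  calc _ ≤ ((∫⁻ x, f x ^ p ∂μ) ^ (1 / p)) ^ p := by gcongr
    _ = _ := by
      rw [← ENNReal.rpow_mul, one_div, inv_mul_cancel₀ (by positivity), ENNReal.rpow_one]

/-- Translations are continuous in `L^p`. -/
theorem exists_forall_lintegral_sub_translate_le (μ : Measure E) [μ.IsAddHaarMeasure] {p : ℝ}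
    (hp : 1 ≤ p) {g : E → F} (hg : MemLp g (ENNReal.ofReal p) μ) {ε : ℝ≥0∞} (hε : ε ≠ 0) :
    ∃ δ > 0, ∀ z : E, ‖z‖ < δ → ∫⁻ x, ‖g (x - z) - g x‖ₑ ^ p ∂μ ≤ ε := by
  have hp0 : 0 < p := one_pos.trans_le hp
  have : Fact (1 ≤ ENNReal.ofReal p) := ⟨by simpa using hp⟩
  let τ : E → C(E, E) := fun z => ⟨fun x => x - z, by fun_prop⟩
  have hτ : Continuous τ := by
    refine ContinuousMap.continuous_of_continuous_uncurry _ ?_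
    change Continuous fun q : E × E => q.2 - q.1
    fun_prop
  have hmp : ∀ z, MeasurePreserving (τ z) μ μ := fun z => measurePreserving_sub_right μ z
  have key := Filter.Tendsto.compMeasurePreservingLp (l := 𝓝 (0 : E))
    (tendsto_const_nhds (x := hg.toLp g)) (hτ.tendsto 0) hmp (hmp 0) ENNReal.ofReal_ne_top
  rw [EMetric.tendsto_nhds] at key
  have hε' : 0 < ε ^ (1 / p) := ENNReal.rpow_pos_of_nonneg (pos_iff_ne_zero.2 hε) (by positivity)
  obtain ⟨δ, hδ, h⟩ := Metric.eventually_nhds_iff.1 (key _ hε')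
  refine ⟨δ, hδ, fun z hz => ?_⟩
  have h1 := h (y := z) (by simpa using hz)
  rw [Lp.toLp_compMeasurePreserving, Lp.toLp_compMeasurePreserving, Lp.edist_toLp_toLp,
    eLpNorm_eq_lintegral_rpow_enorm_toReal (by simpa using hp0) ENNReal.ofReal_ne_top,
    ENNReal.toReal_ofReal hp0.le] at h1
  have h2 := (ENNReal.rpow_le_rpow_iff (by positivity)).1 h1.le
  simpa [τ] using h2

variable [NormedSpace ℝ F]

/-- Mollifications at small scales approximate `g` in `L^p`. -/
theorem exists_forall_lintegral_mollify_sub_le [CompleteSpace F]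
    (μ : Measure E) [μ.IsAddHaarMeasure] {p : ℝ}
    (hp : 1 ≤ p) {g : E → F} (hg : MemLp g (ENNReal.ofReal p) μ) {ε : ℝ≥0∞} (hε : ε ≠ 0) :
    ∃ δ > 0, ∀ b : ContDiffBump (0 : E), b.rOut < δ →
      ∫⁻ x, ‖(∫ z, b.normed μ z • g (x - z) ∂μ) - g x‖ₑ ^ p ∂μ ≤ ε := by
  have hp0 : 0 < p := one_pos.trans_le hp
  obtain ⟨δ, hδ, h⟩ := exists_forall_lintegral_sub_translate_le μ hp hg hε
  refine ⟨δ, hδ, fun b hb => ?_⟩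
  have hp1 : 1 ≤ ENNReal.ofReal p := by simpa using hp
  let m : Measure E := μ.withDensity fun z => ENNReal.ofReal (b.normed μ z)
  have hbm : Measurable fun z => ENNReal.ofReal (b.normed μ z) :=
    (b.continuous_normed.measurable).ennreal_ofReal
  have hm1 : ∫⁻ z, ENNReal.ofReal (b.normed μ z) ∂μ = 1 := by
    rw [← ofReal_integral_eq_lintegral_ofReal b.integrable_normed
      (Eventually.of_forall fun x => b.nonneg_normed x), b.integral_normed]
    simp
  have : IsProbabilityMeasure m := ⟨by simp [m, hm1]⟩
  have hgm := hg.1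
  have hgx : ∀ x, AEStronglyMeasurable (fun z => g (x - z)) μ := fun x =>
    hgm.comp_quasiMeasurePreserving (quasiMeasurePreserving_sub_left μ x)
  have hgp : AEStronglyMeasurable (fun q : E × E => g (q.1 - q.2)) (μ.prod μ) :=
    hgm.comp_quasiMeasurePreserving (quasiMeasurePreserving_sub_of_right_invariant μ μ)
  have hloc : LocallyIntegrable g μ := hg.locallyIntegrable hp1
  have hint : ∀ x, Integrable (fun z => b.normed μ z • g (x - z)) μ := fun x =>
    (HasCompactSupport.convolutionExists_left (ContinuousLinearMap.lsmul ℝ ℝ)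
      b.hasCompactSupport_normed b.continuous_normed hloc x)
  have hac : m ≪ μ := withDensity_absolutelyContinuous _ _
  have hme : ∀ x, AEMeasurable (fun z => ‖g (x - z) - g x‖ₑ) μ := fun x =>
    ((hgx x).sub aestronglyMeasurable_const).enorm
  have hpt : ∀ x, ‖(∫ z, b.normed μ z • g (x - z) ∂μ) - g x‖ₑ ^ p
      ≤ ∫⁻ z, ‖g (x - z) - g x‖ₑ ^ p ∂m := by
    intro x
    have e1 : (∫ z, b.normed μ z • g (x - z) ∂μ) - g x
        = ∫ z, b.normed μ z • (g (x - z) - g x) ∂μ := by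
      simp_rw [smul_sub]
      rw [integral_sub (hint x) (b.integrable_normed.smul_const _), integral_smul_const,
        b.integral_normed, one_smul]
    rw [e1]
    calc _ ≤ (∫⁻ z, ‖g (x - z) - g x‖ₑ ∂m) ^ p := by
          gcongr
          refine (enorm_integral_le_lintegral_enorm _).trans ?_
          rw [lintegral_withDensity_eq_lintegral_mul₀ hbm.aemeasurable (hme x)]
          refine lintegral_mono fun z => ?_
          rw [enorm_smul, Pi.mul_apply, Real.enorm_of_nonneg (b.nonneg_normed z)]
      _ ≤ _ := lintegral_rpow_le_of_isProbabilityMeasure m hp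
          ((hme x).mono_ac hac)
  calc _ ≤ ∫⁻ x, ∫⁻ z, ‖g (x - z) - g x‖ₑ ^ p ∂m ∂μ := lintegral_mono hpt
    _ = ∫⁻ z, ∫⁻ x, ‖g (x - z) - g x‖ₑ ^ p ∂μ ∂m := by
        rw [lintegral_lintegral_swap]
        refine AEMeasurable.pow_const (AEMeasurable.mono_ac
          (ν := μ.prod μ) ?_ (Measure.AbsolutelyContinuous.rfl.prod hac)) p
        exact (hgp.sub (hgm.comp_quasiMeasurePreserving Measure.quasiMeasurePreserving_fst)).enorm
    _ ≤ ∫⁻ z, ε ∂m := by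
        refine lintegral_mono_ae ?_
        have : ∀ᵐ z ∂m, ENNReal.ofReal (b.normed μ z) ≠ 0 := by
          refine (ae_withDensity_iff hbm).2 (Eventually.of_forall fun z hz => hz)
        filter_upwards [this] with z hz
        refine h z ?_
        have : z ∈ Function.support (b.normed μ) := by
          intro h0
          exact hz (by simp [h0])
        rw [b.support_normed_eq] at this
        exact (by simpa using this : ‖z‖ < b.rOut).trans hb
    _ = ε := by simp

end Mollification

section SmoothApproximation

variable {n : ℕ}

theorem gradient_apply (v : En n → ℝ) (x : En n) (i : Fin n) :
    gradient v x i = fderiv ℝ v x (EuclideanSpace.single i 1) := by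
  rw [← inner_gradient_left, EuclideanSpace.inner_single_right]
  simp

/-- Near a compact subset of `U`, a mollification of a weakly differentiable function has the
mollified weak gradient as gradient. -/
theorem gradient_convolution_eq {U : Set (En n)} {f : En n → ℝ} {g : En n → En n}
    (hg : IsWeakGradOn U f g) {K : Set (En n)} (hU : IsOpen U) (hK : IsCompact K) (hKU : K ⊆ U)
    (b : ContDiffBump (0 : En n)) {x : En n} (hx : closedBall x b.rOut ⊆ K) :
    gradient (fun y => ∫ z, b.normed volume z • K.indicator f (y - z)) x
      = ∫ z, b.normed volume z • K.indicator g (x - z) := by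
  have hfK : Integrable (K.indicator f) :=
    (integrable_indicator_iff hK.measurableSet).2 (hg.1.integrableOn_compact_subset hKU hK)
  have hgK : Integrable (K.indicator g) :=
    (integrable_indicator_iff hK.measurableSet).2 (hg.2.1.integrableOn_compact_subset hKU hK)
  have hb1 : ContDiff ℝ 1 (b.normed volume : En n → ℝ) := b.contDiff_normed
  have hd := HasCompactSupport.hasFDerivAt_convolution_left (ContinuousLinearMap.lsmul ℝ ℝ)
    b.hasCompactSupport_normed hb1 hfK.locallyIntegrable x
  have hint : Integrable (fun z => b.normed volume z • K.indicator g (x - z)) volume :=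
    HasCompactSupport.convolutionExists_left (ContinuousLinearMap.lsmul ℝ ℝ)
      b.hasCompactSupport_normed b.continuous_normed hgK.locallyIntegrable x
  have hint2 := HasCompactSupport.convolutionExists_left
      ((ContinuousLinearMap.lsmul ℝ ℝ : ℝ →L[ℝ] ℝ →L[ℝ] ℝ).precompL (En n))
      (b.hasCompactSupport_normed.fderiv ℝ) (hb1.continuous_fderiv one_ne_zero)
      hfK.locallyIntegrable x
  ext i
  rw [gradient_apply]
  change (fderiv ℝ (b.normed volume ⋆[ContinuousLinearMap.lsmul ℝ ℝ, volume] K.indicator f) x)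
    (EuclideanSpace.single i 1) = _
  rw [hd.fderiv, convolution, ContinuousLinearMap.integral_apply hint2]
  have e1 : (∫ z, b.normed volume z • K.indicator g (x - z)) i
      = ∫ z, (b.normed volume z • K.indicator g (x - z)) i :=
    ((EuclideanSpace.proj i : En n →L[ℝ] ℝ).integral_comp_comm hint).symm
  rw [e1, ← integral_sub_left_eq_self _ volume x,
    ← integral_sub_left_eq_self (fun z => (b.normed volume z • K.indicator g (x - z)) i) volume x]
  set η : En n → ℝ := fun w => b.normed volume (x - w) with hη
  have hηs : ContDiff ℝ (⊤ : ℕ∞) η := b.contDiff_normed.comp (contDiff_const.sub contDiff_id)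
  have hηt : tsupport η ⊆ closedBall x b.rOut := by
    refine closure_minimal (fun w hw => ?_) isClosed_closedBall
    have : x - w ∈ Function.support (b.normed volume : En n → ℝ) := hw
    rw [b.support_normed_eq] at this
    have h2 : ‖x - w‖ < b.rOut := by simpa using this
    rw [mem_closedBall, dist_comm, dist_eq_norm]; exact h2.le
  have hηc : HasCompactSupport η :=
    (isCompact_closedBall x b.rOut).of_isClosed_subset (isClosed_tsupport _) hηt
  have hηd : ∀ w, fderiv ℝ η w (EuclideanSpace.single i 1)
      = - fderiv ℝ (b.normed volume : En n → ℝ) (x - w) (EuclideanSpace.single i 1) := by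
    intro w
    have h1 : HasFDerivAt (b.normed volume : En n → ℝ) _ (x - w) :=
      (hb1.differentiable one_ne_zero (x - w)).hasFDerivAt
    have h2 : HasFDerivAt (fun w : En n => x - w) (-ContinuousLinearMap.id ℝ (En n)) w := by
      simpa using (hasFDerivAt_id w).const_sub x
    rw [hη]
    erw [(h1.comp w h2).fderiv]
    simp
  have hz : ∀ w ∉ K, η w = 0 ∧ fderiv ℝ η w = 0 := by
    intro w hw
    have : w ∉ tsupport η := fun h => hw (hx (hηt h))
    exact ⟨image_eq_zero_of_notMem_tsupport this, fderiv_of_notMem_tsupport ℝ this⟩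
  have key := hg.2.2 η hηs hηc (hηt.trans (hx.trans hKU)) i
  rw [← integral_indicator hU.measurableSet, ← integral_indicator hU.measurableSet,
    ← integral_neg] at key
  rw [← neg_inj, ← integral_neg, ← integral_neg]
  refine Eq.trans ?_ (key.trans ?_)
  · refine integral_congr_ae (Eventually.of_forall fun w => ?_)
    by_cases hw : w ∈ K
    · simp [indicator_of_mem (hKU hw), indicator_of_mem hw, hηd, mul_comm]
    · by_cases hw' : w ∈ U
      · simp [indicator_of_notMem hw, indicator_of_mem hw', (hz w hw).2]
      · simp [indicator_of_notMem hw, indicator_of_notMem hw']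
  · refine integral_congr_ae (Eventually.of_forall fun w => ?_)
    by_cases hw : w ∈ K
    · simp [indicator_of_mem (hKU hw), indicator_of_mem hw, hη, mul_comm]
    · by_cases hw' : w ∈ U
      · have := (hz w hw).1
        simp [indicator_of_notMem hw, indicator_of_mem hw', this]
      · simp [indicator_of_notMem hw, indicator_of_notMem hw']

/-- Continuous weakly differentiable functions are approximated near compact sets by smooth
functions, uniformly and with gradients converging in `L^p`. -/
theorem exists_contDiff_approx {U : Set (En n)} (hU : IsOpen U) {f : En n → ℝ} {g : En n → En n}
    (hf : ContinuousOn f U) (hg : IsWeakGradOn U f g) {p : ℝ} (hp : 1 ≤ p)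
    (hgp : ∀ K ⊆ U, IsCompact K → ∫⁻ x in K, ‖g x‖ₑ ^ p ≠ ⊤) {K : Set (En n)}
    (hK : IsCompact K) (hKU : K ⊆ U) {ε : ℝ} (hε : 0 < ε) :
    ∃ v : En n → ℝ, ContDiff ℝ ∞ v ∧ (∀ x ∈ K, |v x - f x| ≤ ε) ∧
      ∫⁻ x in K, ‖gradient v x - g x‖ₑ ^ p ≤ ENNReal.ofReal ε := by
  have hp0 : 0 < p := one_pos.trans_le hp
  obtain ⟨δ₀, hδ₀, hδU⟩ := hK.exists_cthickening_subset_open hU hKU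
  set K₁ := cthickening δ₀ K
  have hK₁ : IsCompact K₁ := hK.cthickening
  have hgK : Integrable (K₁.indicator g) :=
    (integrable_indicator_iff hK₁.measurableSet).2 (hg.2.1.integrableOn_compact_subset hδU hK₁)
  have hfK : Integrable (K₁.indicator f) :=
    (integrable_indicator_iff hK₁.measurableSet).2 (hg.1.integrableOn_compact_subset hδU hK₁)
  have hgL : MemLp (K₁.indicator g) (ENNReal.ofReal p) volume := by
    refine ⟨hgK.1, ?_⟩
    rw [eLpNorm_lt_top_iff_lintegral_rpow_enorm_lt_top (by simpa using hp0) ENNReal.ofReal_ne_top,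
      ENNReal.toReal_ofReal hp0.le]
    refine lt_of_le_of_lt (le_of_eq ?_) (hgp K₁ hδU hK₁).lt_top
    rw [← lintegral_indicator hK₁.measurableSet]
    refine lintegral_congr fun x => ?_
    by_cases hx : x ∈ K₁
    · simp [indicator_of_mem hx]
    · simp [indicator_of_notMem hx, hp0]
  obtain ⟨δ₁, hδ₁, h₁⟩ := exists_forall_lintegral_mollify_sub_le volume hp hgL
    (ε := ENNReal.ofReal ε) (by simpa using hε)
  have huc := hK₁.uniformContinuousOn_of_continuous (hf.mono hδU)
  obtain ⟨δ₂, hδ₂, h₂⟩ := Metric.uniformContinuousOn_iff_le.1 huc ε hε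
  obtain ⟨r, hr0, hr⟩ := exists_between (lt_min hδ₀ (lt_min hδ₁ hδ₂))
  simp only [lt_min_iff] at hr
  let b : ContDiffBump (0 : En n) := ⟨r / 2, r, by positivity, by linarith⟩
  have hball : ∀ x ∈ K, closedBall x b.rOut ⊆ K₁ := fun x hx =>
    (closedBall_subset_closedBall hr.1.le).trans (closedBall_subset_cthickening hx δ₀)
  refine ⟨fun y => ∫ z, b.normed volume z • K₁.indicator f (y - z), ?_, fun x hx => ?_, ?_⟩
  · exact HasCompactSupport.contDiff_convolution_left (ContinuousLinearMap.lsmul ℝ ℝ)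
      b.hasCompactSupport_normed b.contDiff_normed hfK.locallyIntegrable
  · have := ContDiffBump.dist_normed_convolution_le (φ := b) (μ := volume) (x₀ := x)
      (g := K₁.indicator f) (ε := ε) hfK.1 (fun y hy => ?_)
    · have hxK : x ∈ K₁ := self_subset_cthickening K hx
      rw [indicator_of_mem hxK, Real.dist_eq] at this
      exact this
    · have hy' : y ∈ K₁ := hball x hx (ball_subset_closedBall hy)
      have hxK : x ∈ K₁ := self_subset_cthickening K hx
      rw [indicator_of_mem hxK, indicator_of_mem hy']
      exact h₂ y hy' x hxK ((mem_ball.1 hy).le.trans hr.2.2.le)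
  · refine le_trans ?_ (h₁ b hr.2.1)
    refine le_trans (le_of_eq ?_) (setLIntegral_le_lintegral K _)
    refine setLIntegral_congr_fun hK.measurableSet fun x hx => ?_
    rw [gradient_convolution_eq hg hU hK₁ hδU b (hball x hx),
      indicator_of_mem (self_subset_cthickening K hx)]

end SmoothApproximation

section Morrey

variable {E : Type*} [NormedAddCommGroup E] [NormedSpace ℝ E]

/-- The increment of a `C¹` function along a segment is controlled by the integral of the norm of
its derivative. -/
theorem enorm_sub_le_lintegral_fderiv {g : E → ℝ} (hg : ContDiff ℝ 1 g) (x v : E) {a b : ℝ}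
    (hab : a ≤ b) :
    ‖g (x + b • v) - g (x + a • v)‖ₑ
      ≤ ∫⁻ s in Ioc a b, ‖fderiv ℝ g (x + s • v)‖ₑ * ‖v‖ₑ := by
  have hd : ∀ s : ℝ, HasDerivAt (fun s : ℝ => g (x + s • v)) (fderiv ℝ g (x + s • v) v) s := by
    intro s
    have h1 : HasDerivAt (fun s : ℝ => x + s • v) v s := by
      simpa using ((hasDerivAt_id s).smul_const v).const_add x
    exact ((hg.differentiable one_ne_zero _).hasFDerivAt).comp_hasDerivAt s h1
  have hc : Continuous fun s : ℝ => fderiv ℝ g (x + s • v) v :=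
    ((hg.continuous_fderiv one_ne_zero).comp (by fun_prop)).clm_apply continuous_const
  have := intervalIntegral.integral_eq_sub_of_hasDerivAt (fun s _ => hd s)
    (hc.intervalIntegrable a b)
  rw [← this, intervalIntegral.integral_of_le hab]
  refine (enorm_integral_le_lintegral_enorm _).trans (lintegral_mono fun s => ?_)
  exact ContinuousLinearMap.le_opENorm _ _

variable [FiniteDimensional ℝ E] [MeasurableSpace E] [BorelSpace E] (μ : Measure E)
  [μ.IsAddHaarMeasure]

open Module

theorem lintegral_comp_smul_add (F : E → ℝ≥0∞) {s : ℝ} (hs : s ≠ 0) (c : E) :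
    ∫⁻ y, F (s • y + c) ∂μ = ENNReal.ofReal |(s ^ finrank ℝ E)⁻¹| * ∫⁻ y, F y ∂μ := by
  have h1 : ∫⁻ y, F (s • y + c) ∂μ = ∫⁻ y, F (y + c) ∂(Measure.map (s • ·) μ) :=
    ((measurableEmbedding_const_smul₀ hs).lintegral_map fun y => F (y + c)).symm
  rw [h1, Measure.map_addHaar_smul μ hs, lintegral_smul_measure, lintegral_add_right_eq_self]
  rfl

/-- Contraction towards a point of a convex set. -/
theorem setLIntegral_comp_homothety_le {B : Set E} (hB : Convex ℝ B) (hBm : MeasurableSet B)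
    (F : E → ℝ≥0∞) {x : E} (hx : x ∈ B) {s : ℝ} (hs : 0 < s) (hs1 : s ≤ 1) :
    ∫⁻ y in B, F (x + s • (y - x)) ∂μ
      ≤ ENNReal.ofReal ((s ^ finrank ℝ E)⁻¹) * ∫⁻ y in B, F y ∂μ := by
  rw [← lintegral_indicator hBm, ← lintegral_indicator hBm]
  have := lintegral_comp_smul_add μ (B.indicator F) hs.ne' (x - s • x)
  rw [abs_of_nonneg (by positivity)] at this
  rw [← this]
  refine lintegral_mono fun y => ?_
  by_cases hy : y ∈ B
  · have e : s • y + (x - s • x) = x + s • (y - x) := by rw [smul_sub]; abel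
    have hm : x + s • (y - x) ∈ B := hB.add_smul_sub_mem hx hy ⟨hs.le, hs1⟩
    rw [indicator_of_mem hy, e, indicator_of_mem hm]
  · simp [indicator_of_notMem hy]

/-- Morrey's inequality on balls, for `C¹` functions. -/
theorem exists_morrey_const {q : ℝ} (hm : 1 ≤ finrank ℝ E) (hq : (finrank ℝ E : ℝ) < q) :
    ∃ C : ℝ≥0∞, C ≠ ⊤ ∧ ∀ g : E → ℝ, ContDiff ℝ 1 g → ∀ (c : E) (r : ℝ), 0 < r →
      ∀ x ∈ closedBall c r, ∀ y ∈ closedBall c r,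
        ‖g x - g y‖ₑ ^ q ≤ C * ENNReal.ofReal r ^ (q - finrank ℝ E) *
          ∫⁻ z in closedBall c r, ‖fderiv ℝ g z‖ₑ ^ q ∂μ := by
  set m : ℕ := finrank ℝ E with hmdef
  have hm1 : (1 : ℝ) ≤ m := by exact_mod_cast hm
  have hq1 : 1 ≤ q := hm1.trans hq.le
  have hq0 : 0 < q := by linarith
  set S : ℝ≥0∞ := ∫⁻ s in Ioc (0 : ℝ) 1, ENNReal.ofReal (s ^ (-(m / q) : ℝ)) with hS
  have hStop : S ≠ ⊤ := by
    have h1 : IntervalIntegrable (fun s : ℝ => s ^ (-(m / q) : ℝ)) volume 0 1 := by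
      refine intervalIntegral.intervalIntegrable_rpow' ?_
      rw [neg_lt_neg_iff, div_lt_one hq0]; exact hq
    rw [intervalIntegrable_iff_integrableOn_Ioc_of_le zero_le_one] at h1
    exact h1.lintegral_lt_top.ne
  set V := μ (closedBall (0 : E) 1) with hV
  have hV0 : V ≠ 0 := (measure_closedBall_pos μ 0 one_pos).ne'
  have hVt : V ≠ ⊤ := measure_closedBall_lt_top.ne
  refine ⟨(4 * S) ^ q * V⁻¹, mul_ne_top (rpow_ne_top_of_nonneg hq0.le
    (mul_ne_top (by simp) hStop)) (inv_ne_top.2 hV0), fun g hg c r hr => ?_⟩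
  set B := closedBall c r with hB
  have hBm : MeasurableSet B := measurableSet_closedBall
  have hBconv : Convex ℝ B := convex_closedBall c r
  have hμB : μ B = ENNReal.ofReal r ^ m * V := by
    rw [hB, Measure.addHaar_closedBall' μ c hr.le, ENNReal.ofReal_pow hr.le]
  have hr0 : ENNReal.ofReal r ≠ 0 := by simpa using hr
  have hB0 : μ B ≠ 0 := (measure_closedBall_pos μ c hr).ne'
  have hBt : μ B ≠ ⊤ := measure_closedBall_lt_top.ne
  set P : Measure E := (μ B)⁻¹ • μ.restrict B with hP
  have : IsProbabilityMeasure P :=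
    ⟨by simp [hP, ENNReal.inv_mul_cancel hB0 hBt]⟩
  set D : E → ℝ≥0∞ := fun z => ‖fderiv ℝ g z‖ₑ with hD
  have hDc : Continuous D := (hg.continuous_fderiv one_ne_zero).enorm
  set I := ∫⁻ z in B, D z ^ q ∂μ with hI
  have key : ∀ x ∈ B, ∫⁻ z, ‖g x - g z‖ₑ ∂P
      ≤ 2 * ENNReal.ofReal r * (S * ((μ B)⁻¹ * I) ^ (1 / q)) := by
    intro x hx
    have hmeas : Measurable fun p : E × ℝ => D (x + p.2 • (p.1 - x)) :=
      (hDc.comp (by fun_prop)).measurable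
    calc ∫⁻ z, ‖g x - g z‖ₑ ∂P
        ≤ ∫⁻ z, (∫⁻ s in Ioc (0 : ℝ) 1, D (x + s • (z - x))) * (2 * ENNReal.ofReal r) ∂P := by
          refine lintegral_mono_ae ?_
          have hae : ∀ᵐ z ∂P, z ∈ B := Measure.ae_smul_measure (ae_restrict_mem hBm) _
          filter_upwards [hae] with z hz
          have h1 := enorm_sub_le_lintegral_fderiv hg x (z - x) zero_le_one
          simp only [one_smul, add_sub_cancel, zero_smul, add_zero] at h1
          rw [← enorm_neg, neg_sub]
          refine h1.trans ?_
          rw [lintegral_mul_const _ (by fun_prop)]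
          gcongr
          have h2 : dist z x ≤ 2 * r := by
            have := dist_triangle_right z x c
            have hz' := mem_closedBall.1 hz
            have hx' := mem_closedBall.1 hx
            linarith
          rw [← edist_eq_enorm_sub, edist_dist]
          calc ENNReal.ofReal (dist z x) ≤ ENNReal.ofReal (2 * r) := ENNReal.ofReal_le_ofReal h2
            _ = _ := by rw [ENNReal.ofReal_mul (by norm_num)]; simp
      _ = 2 * ENNReal.ofReal r * ∫⁻ s in Ioc (0 : ℝ) 1, ∫⁻ z, D (x + s • (z - x)) ∂P := by
          rw [lintegral_mul_const _ hmeas.lintegral_prod_right', mul_comm,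
            lintegral_lintegral_swap hmeas.aemeasurable]
      _ ≤ 2 * ENNReal.ofReal r * ∫⁻ s in Ioc (0 : ℝ) 1,
            ENNReal.ofReal (s ^ (-(m / q) : ℝ)) * ((μ B)⁻¹ * I) ^ (1 / q) := by
          gcongr 2 * ENNReal.ofReal r * ?_
          refine setLIntegral_mono' measurableSet_Ioc fun s hs => ?_
          have h1 := lintegral_rpow_le_of_isProbabilityMeasure P hq1
            (f := fun z => D (x + s • (z - x))) (hDc.comp (by fun_prop)).measurable.aemeasurable
          have h2 : ∫⁻ z, D (x + s • (z - x)) ^ q ∂P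
              ≤ (μ B)⁻¹ * (ENNReal.ofReal ((s ^ m)⁻¹) * I) := by
            rw [hP, lintegral_smul_measure]
            exact mul_le_mul_right (setLIntegral_comp_homothety_le μ hBconv hBm
              (fun z => D z ^ q) hx hs.1 hs.2) _
          calc _ = ((∫⁻ z, D (x + s • (z - x)) ∂P) ^ q) ^ (1 / q) := by
                rw [← ENNReal.rpow_mul, mul_one_div_cancel hq0.ne', ENNReal.rpow_one]
            _ ≤ ((μ B)⁻¹ * (ENNReal.ofReal ((s ^ m)⁻¹) * I)) ^ (1 / q) := by
                gcongr; exact h1.trans h2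
            _ = _ := by
                rw [mul_left_comm, ENNReal.mul_rpow_of_nonneg _ _ (by positivity),
                  ENNReal.ofReal_rpow_of_nonneg (by have := hs.1.le; positivity) (by positivity)]
                congr 2
                rw [← Real.rpow_natCast, ← Real.rpow_neg hs.1.le, ← Real.rpow_mul hs.1.le]
                congr 1; ring
      _ = _ := by
          rw [lintegral_mul_const]
          exact (by fun_prop : Measurable fun s : ℝ => s ^ (-(m / q) : ℝ)).ennreal_ofReal
  intro x hx y hy
  have hxy : ‖g x - g y‖ₑ ≤ 4 * ENNReal.ofReal r * (S * ((μ B)⁻¹ * I) ^ (1 / q)) := by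
    have hgm : Measurable fun z => ‖g x - g z‖ₑ :=
      (continuous_const.sub hg.continuous).enorm.measurable
    calc ‖g x - g y‖ₑ = ∫⁻ _, ‖g x - g y‖ₑ ∂P := by simp
      _ ≤ ∫⁻ z, (‖g x - g z‖ₑ + ‖g y - g z‖ₑ) ∂P := by
          refine lintegral_mono fun z => ?_
          rw [← edist_eq_enorm_sub, ← edist_eq_enorm_sub, ← edist_eq_enorm_sub]
          exact edist_triangle_right _ _ _
      _ = ∫⁻ z, ‖g x - g z‖ₑ ∂P + ∫⁻ z, ‖g y - g z‖ₑ ∂P := lintegral_add_left hgm _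
      _ ≤ _ := add_le_add (key x hx) (key y hy)
      _ = _ := by ring
  calc ‖g x - g y‖ₑ ^ q ≤ (4 * ENNReal.ofReal r * (S * ((μ B)⁻¹ * I) ^ (1 / q))) ^ q := by gcongr
    _ = (4 * S) ^ q * (ENNReal.ofReal r ^ q * (μ B)⁻¹) * I := by
        rw [show 4 * ENNReal.ofReal r * (S * ((μ B)⁻¹ * I) ^ (1 / q))
          = (4 * S) * ENNReal.ofReal r * ((μ B)⁻¹ * I) ^ (1 / q) by ring,
          ENNReal.mul_rpow_of_nonneg _ _ hq0.le, ENNReal.mul_rpow_of_nonneg _ _ hq0.le,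
          ← ENNReal.rpow_mul, one_div_mul_cancel hq0.ne', ENNReal.rpow_one]
        ring
    _ = _ := by
        rw [hμB, ENNReal.mul_inv (Or.inr hVt) (Or.inr hV0), ENNReal.rpow_sub _ _ hr0 ofReal_ne_top,
          ENNReal.rpow_natCast, ENNReal.div_eq_inv_mul]
        ring

end Morrey

section Slices

variable {m : ℕ}

/-- The linear chart of `ℝ^{m+1}` which singles out the `j`-th coordinate. -/
def slice (j : Fin (m + 1)) : (ℝ × (Fin m → ℝ)) ≃L[ℝ] En (m + 1) :=
  LinearEquiv.toContinuousLinearEquiv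
    { toFun := fun p => WithLp.toLp 2 (j.insertNth p.1 p.2)
      map_add' := fun p p' => by
        ext i
        refine Fin.succAboveCases j ?_ (fun k => ?_) i <;> simp
      map_smul' := fun c p => by
        ext i
        refine Fin.succAboveCases j ?_ (fun k => ?_) i <;> simp
      invFun := fun x => (x j, fun k => x (j.succAbove k))
      left_inv := fun p => by ext <;> simp
      right_inv := fun x => by
        ext i
        refine Fin.succAboveCases j ?_ (fun k => ?_) i <;> simp }

theorem slice_apply_same (j : Fin (m + 1)) (p : ℝ × (Fin m → ℝ)) : slice j p j = p.1 := by
  simp [slice]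

theorem slice_apply_succAbove (j : Fin (m + 1)) (p : ℝ × (Fin m → ℝ)) (k : Fin m) :
    slice j p (j.succAbove k) = p.2 k := by
  simp [slice]

theorem measurePreserving_slice (j : Fin (m + 1)) :
    MeasurePreserving (slice j) (volume : Measure (ℝ × (Fin m → ℝ))) volume :=
  (PiLp.volume_preserving_toLp (Fin (m + 1))).comp
    (volume_preserving_piFinSuccAbove (fun _ : Fin (m + 1) => ℝ) j).symm

theorem measurableEmbedding_slice (j : Fin (m + 1)) : MeasurableEmbedding (slice j) :=
  (slice j).toHomeomorph.measurableEmbedding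

theorem enorm_fderiv_eq_enorm_gradient {n : ℕ} (v : En n → ℝ) (x : En n) :
    ‖fderiv ℝ v x‖ₑ = ‖gradient v x‖ₑ := by
  rw [gradient]
  simp [enorm]

/-- Morrey's inequality on almost every slice, for a Sobolev function. -/
theorem exists_slice_morrey_const (hm : 1 ≤ m) {q : ℝ} (hq : (m : ℝ) < q) :
    ∃ C : ℝ≥0∞, C ≠ ⊤ ∧ ∀ (j : Fin (m + 1)) {U : Set (En (m + 1))} (_ : IsOpen U)
      {f : En (m + 1) → ℝ} {g : En (m + 1) → En (m + 1)} (_ : ContinuousOn f U)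
      (_ : IsWeakGradOn U f g) (_ : Measurable g)
      (_ : ∀ K ⊆ U, IsCompact K → ∫⁻ x in K, ‖g x‖ₑ ^ q ≠ ⊤)
      (p : ℝ × (Fin m → ℝ)) (r : ℝ), 0 < r → slice j '' closedBall p r ⊆ U →
      ∀ᵐ t : ℝ, t ∈ closedBall p.1 r → ∀ z ∈ closedBall p.2 r, ∀ z' ∈ closedBall p.2 r,
        ‖f (slice j (t, z)) - f (slice j (t, z'))‖ₑ ^ q ≤ C * ENNReal.ofReal r ^ (q - m) *
          ∫⁻ y in closedBall p.2 r, ‖g (slice j (t, y))‖ₑ ^ q := by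
  have hm1 : (1 : ℝ) ≤ m := by exact_mod_cast hm
  have hq1 : 1 ≤ q := hm1.trans hq.le
  have hq0 : 0 < q := by linarith
  have hfr : Module.finrank ℝ (Fin m → ℝ) = m := Module.finrank_fin_fun ℝ
  obtain ⟨C, hC, hmor⟩ := exists_morrey_const (E := Fin m → ℝ) volume (q := q)
    (by rw [hfr]; exact hm) (by rw [hfr]; exact hq)
  rw [hfr] at hmor
  let A : Fin (m + 1) → (Fin m → ℝ) →L[ℝ] En (m + 1) := fun j =>
    (slice j : (ℝ × (Fin m → ℝ)) →L[ℝ] En (m + 1)).comp (ContinuousLinearMap.inr ℝ ℝ (Fin m → ℝ))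
  set M : ℝ≥0∞ := ∑ j, ‖A j‖ₑ with hM
  have hMt : M ≠ ⊤ := by simp [hM]
  refine ⟨C * (M ^ q * 2 ^ (q - 1)), mul_ne_top hC (mul_ne_top
    (rpow_ne_top_of_nonneg hq0.le hMt) (rpow_ne_top_of_nonneg (by linarith) (by simp))), ?_⟩
  intro j U hU f g hf hg hgm hgq p r hr hpU
  set K := slice j '' closedBall p r with hK
  have hKc : IsCompact K := (isCompact_closedBall p r).image (slice j).continuous
  have hex : ∀ k : ℕ, ∃ v : En (m + 1) → ℝ, ContDiff ℝ ∞ v ∧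
      (∀ x ∈ K, |v x - f x| ≤ (1 / 2) ^ k) ∧
      ∫⁻ x in K, ‖gradient v x - g x‖ₑ ^ q ≤ ENNReal.ofReal ((1 / 2) ^ k) := fun k =>
    exists_contDiff_approx hU hf hg hq1 hgq hKc hpU (by positivity)
  choose v hv hvf hvg using hex
  have hgrad : ∀ k, Measurable (gradient (v k)) := fun k => by
    unfold gradient
    exact ((LinearIsometryEquiv.continuous _).comp
      ((hv k).continuous_fderiv (by simp))).measurable
  set Δ : ℕ → ℝ × (Fin m → ℝ) → ℝ≥0∞ := fun k s =>
    ‖gradient (v k) (slice j s) - g (slice j s)‖ₑ ^ q with hΔ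
  have hΔm : ∀ k, Measurable (Δ k) := fun k =>
    ((((hgrad k).sub hgm).comp (slice j).continuous.measurable).enorm).pow_const q
  set B := closedBall p.2 r with hB
  set T := closedBall p.1 r with hT
  have hBT : closedBall p r = T ×ˢ B := (closedBall_prod_same p.1 p.2 r).symm
  have hsum : ∀ k, ∫⁻ t in T, ∫⁻ z in B, Δ k (t, z) ≤ ENNReal.ofReal ((1 / 2) ^ k) := by
    intro k
    refine le_trans (le_of_eq ?_) (hvg k)
    rw [hK, hBT, ← (measurePreserving_slice j).setLIntegral_comp_emb (measurableEmbedding_slice j),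
      Measure.volume_eq_prod, ← Measure.prod_restrict, lintegral_prod _ (hΔm k).aemeasurable]
  have hae : ∀ᵐ t ∂(volume.restrict T), ∑' k, ∫⁻ z in B, Δ k (t, z) < ⊤ := by
    have hmk : ∀ k, Measurable fun t => ∫⁻ z in B, Δ k (t, z) := fun k =>
      (hΔm k).lintegral_prod_right'
    refine ae_lt_top (Measurable.tsum hmk) ?_
    rw [lintegral_tsum fun k => (hmk k).aemeasurable]
    refine ne_top_of_le_ne_top ?_ (ENNReal.tsum_le_tsum hsum)
    rw [← ENNReal.ofReal_tsum_of_nonneg (fun k => by positivity) (summable_geometric_two)]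
    exact ofReal_ne_top
  rw [ae_restrict_iff' measurableSet_closedBall] at hae
  filter_upwards [hae] with t ht htT z hz z' hz'
  have hlim := ENNReal.tendsto_atTop_zero_of_tsum_ne_top (ht htT).ne
  set I := ∫⁻ y in B, ‖g (slice j (t, y))‖ₑ ^ q with hI
  have hK' : ∀ y ∈ B, slice j (t, y) ∈ K := fun y hy => mem_image_of_mem _ (by
    rw [hBT]; exact ⟨htT, hy⟩)
  have hconv : ∀ y ∈ B, Tendsto (fun k => v k (slice j (t, y))) atTop
      (𝓝 (f (slice j (t, y)))) := by
    intro y hy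
    rw [tendsto_iff_norm_sub_tendsto_zero]
    exact squeeze_zero (fun k => norm_nonneg _) (fun k => hvf k _ (hK' y hy))
      (tendsto_pow_atTop_nhds_zero_of_lt_one (by norm_num) (by norm_num))
  have hleft : Tendsto (fun k => ‖v k (slice j (t, z)) - v k (slice j (t, z'))‖ₑ ^ q) atTop
      (𝓝 (‖f (slice j (t, z)) - f (slice j (t, z'))‖ₑ ^ q)) :=
    ((hconv z hz).sub (hconv z' hz')).enorm.ennrpow_const q
  set c := C * ENNReal.ofReal r ^ (q - m) with hc
  have hct : c ≠ ⊤ := mul_ne_top hC (rpow_ne_top_of_nonneg (by linarith) ofReal_ne_top)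
  have hright : Tendsto (fun k => c * (M ^ q * (2 ^ (q - 1) *
      ((∫⁻ z in B, Δ k (t, z)) + I)))) atTop (𝓝 (c * (M ^ q * (2 ^ (q - 1) * (0 + I))))) := by
    have h2 : (2 : ℝ≥0∞) ^ (q - 1) ≠ ⊤ := rpow_ne_top_of_nonneg (by linarith) (by simp)
    have hM2 : M ^ q ≠ ⊤ := rpow_ne_top_of_nonneg hq0.le hMt
    exact ENNReal.Tendsto.const_mul (ENNReal.Tendsto.const_mul (ENNReal.Tendsto.const_mul
      (hlim.add tendsto_const_nhds) (Or.inr h2)) (Or.inr hM2)) (Or.inr hct)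
  refine (le_of_tendsto_of_tendsto' hleft hright fun k => ?_).trans (le_of_eq (by ring))
  have hg1 : ContDiff ℝ 1 fun y => v k (slice j (t, y)) := by
    refine ((hv k).of_le (by simp)).comp ((slice j).contDiff.comp ?_)
    exact contDiff_const.prodMk contDiff_id
  refine (hmor _ hg1 p.2 r hr z hz z' hz').trans ?_
  rw [hc]
  gcongr C * ENNReal.ofReal r ^ (q - m) * ?_
  have hfd : ∀ y, ‖fderiv ℝ (fun y => v k (slice j (t, y))) y‖ₑ ^ q
      ≤ M ^ q * (2 ^ (q - 1) * (Δ k (t, y) + ‖g (slice j (t, y))‖ₑ ^ q)) := by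
    intro y
    have h1 : HasFDerivAt (fun y => slice j (t, y)) (A j) y := by
      have : HasFDerivAt (fun y : Fin m → ℝ => (t, y)) (ContinuousLinearMap.inr ℝ ℝ (Fin m → ℝ)) y :=
        hasFDerivAt_prodMk_right t y
      exact (slice j).hasFDerivAt.comp y this
    have h2 := (((hv k).differentiable (by simp)) (slice j (t, y))).hasFDerivAt.comp y h1
    have h3 : fderiv ℝ (fun y => v k (slice j (t, y))) y
      = (fderiv ℝ (v k) (slice j (t, y))).comp (A j) := h2.fderiv
    rw [h3]
    calc _ ≤ (M * ‖gradient (v k) (slice j (t, y))‖ₑ) ^ q := by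
          gcongr
          refine (ContinuousLinearMap.opENorm_comp_le _ _).trans ?_
          rw [enorm_fderiv_eq_enorm_gradient, mul_comm]
          gcongr
          exact Finset.single_le_sum (f := fun j => ‖A j‖ₑ) (fun _ _ => zero_le) (Finset.mem_univ j)
      _ ≤ _ := by
          rw [ENNReal.mul_rpow_of_nonneg _ _ hq0.le]
          gcongr
          refine le_trans ?_ (ENNReal.rpow_add_le_mul_rpow_add_rpow _ _ hq1)
          gcongr
          refine le_trans (le_of_eq ?_) (enorm_add_le _ _)
          rw [sub_add_cancel]
  refine (lintegral_mono hfd).trans (le_of_eq ?_)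
  have hm1 : Measurable fun y => Δ k (t, y) := (hΔm k).comp measurable_prodMk_left
  have hm2 : Measurable fun y => ‖g (slice j (t, y))‖ₑ ^ q :=
    ((hgm.comp (slice j).continuous.measurable).comp measurable_prodMk_left).enorm.pow_const q
  rw [lintegral_const_mul _ (by fun_prop), lintegral_const_mul _ (by fun_prop),
    lintegral_add_left hm1]

end Slices

section GraphMap

/-- An estimate `μ (Φ '' E) ≤ C ∫_E H` can be checked on the pieces of a countable cover. -/
theorem measure_image_le_of_countable_cover {X Y ι : Type*} [MeasurableSpace X]
    [MeasurableSpace Y] [Countable ι] [Nonempty ι] (μ : Measure X) (ν : Measure Y) (Φ : X → Y)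
    (H : X → ℝ≥0∞) (C : ℝ≥0∞) {V : Set X} {A : ι → Set X} (hA : ∀ i, MeasurableSet (A i))
    (hVA : V ⊆ ⋃ i, A i)
    (h : ∀ i, ∀ E ⊆ V ∩ A i, MeasurableSet E → ν (Φ '' E) ≤ C * ∫⁻ x in E, H x ∂μ)
    {E : Set X} (hE : E ⊆ V) (hEm : MeasurableSet E) :
    ν (Φ '' E) ≤ C * ∫⁻ x in E, H x ∂μ := by
  obtain ⟨e, he⟩ := exists_surjective_nat ι
  set B : ℕ → Set X := disjointed (A ∘ e) with hB
  have hBm : ∀ k, MeasurableSet (B k) := fun k => MeasurableSet.disjointed (fun i => hA (e i)) k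
  have hBU : ⋃ k, B k = ⋃ i, A i := by
    rw [hB, iUnion_disjointed]
    exact he.iUnion_comp A
  have hEB : E = ⋃ k, E ∩ B k := by
    rw [← inter_iUnion, hBU, inter_eq_left.2 (hE.trans hVA)]
  have hdis : Pairwise (Function.onFun Disjoint fun k => E ∩ B k) := fun i j hij =>
    (disjoint_disjointed (A ∘ e) hij).mono inter_subset_right inter_subset_right
  calc ν (Φ '' E) = ν (⋃ k, Φ '' (E ∩ B k)) := by rw [← image_iUnion, ← hEB]
    _ ≤ ∑' k, ν (Φ '' (E ∩ B k)) := measure_iUnion_le _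
    _ ≤ ∑' k, C * ∫⁻ x in E ∩ B k, H x ∂μ := by
        refine ENNReal.tsum_le_tsum fun k => h (e k) _ ?_ (hEm.inter (hBm k))
        exact inter_subset_inter hE (disjointed_subset (A ∘ e) k)
    _ = C * ∫⁻ x in E, H x ∂μ := by
        rw [ENNReal.tsum_mul_left, ← lintegral_iUnion (fun k => hEm.inter (hBm k)) hdis, ← hEB]

theorem rpow_div_le_add {a l : ℝ≥0∞} {m q : ℝ} (hm : 0 < m) (hq : m < q) (hl0 : l ≠ 0)
    (hlt : l ≠ ⊤) : a ^ (m / q) ≤ l ^ m + l ^ (m - q) * a := by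
  have hq0 : 0 < q := hm.trans hq
  rcases le_or_gt a (l ^ q) with h | h
  · refine le_trans ?_ le_self_add
    calc a ^ (m / q) ≤ (l ^ q) ^ (m / q) := by gcongr
      _ = l ^ m := by rw [← ENNReal.rpow_mul]; congr 1; field_simp
  · refine le_trans ?_ le_add_self
    rcases eq_or_ne a ⊤ with rfl | ha
    · rw [ENNReal.mul_top]
      · exact le_top
      · exact (ENNReal.rpow_pos (pos_iff_ne_zero.2 hl0) hlt).ne'
    · have ha0 : a ≠ 0 := (zero_le.trans_lt h).ne'
      calc a ^ (m / q) = a ^ ((m - q) / q) * a := by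
            conv_rhs => rw [← ENNReal.rpow_one a, ← ENNReal.rpow_mul, one_mul,
              ← ENNReal.rpow_add _ _ ha0 ha]
            congr 1; field_simp; ring
        _ ≤ (l ^ q) ^ ((m - q) / q) * a := by
            gcongr ?_ * a
            have hneg : (m - q) / q ≤ 0 := div_nonpos_of_nonpos_of_nonneg (by linarith) hq0.le
            rw [← neg_neg ((m - q) / q), ENNReal.rpow_neg a, ENNReal.rpow_neg (l ^ q)]
            exact ENNReal.inv_le_inv.2 (ENNReal.rpow_le_rpow h.le (neg_nonneg.2 hneg))
        _ = _ := by
            rw [← ENNReal.rpow_mul]; congr 2; field_simp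

variable {m : ℕ}

/-- The oscillation bound on slices satisfied by Sobolev maps. -/
def SliceBound (q : ℝ) (C : ℝ≥0∞) (V : Set (ℝ × (Fin m → ℝ)))
    (F : ℝ × (Fin m → ℝ) → Fin m → ℝ) (G : ℝ × (Fin m → ℝ) → ℝ≥0∞) : Prop :=
  ∀ (p : ℝ × (Fin m → ℝ)) (r : ℝ), 0 < r → closedBall p r ⊆ V →
    ∀ᵐ t : ℝ, t ∈ closedBall p.1 r → ∀ z ∈ closedBall p.2 r, ∀ z' ∈ closedBall p.2 r,
      ‖F (t, z) - F (t, z')‖ₑ ^ q ≤ C * ENNReal.ofReal r ^ (q - m) *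
        ∫⁻ y in closedBall p.2 r, G (t, y) ^ q

variable {q : ℝ} {C : ℝ≥0∞} {V : Set (ℝ × (Fin m → ℝ))} {F : ℝ × (Fin m → ℝ) → Fin m → ℝ}
  {G : ℝ × (Fin m → ℝ) → ℝ≥0∞}

theorem volume_image_graph_closedBall_le (hm : 1 ≤ m) (hq : (m : ℝ) < q) (hF : ContinuousOn F V)
    (hG : Measurable G) (h : SliceBound q C V F G) {L : ℝ≥0∞} (hL0 : L ≠ 0) (hLt : L ≠ ⊤)
    {p : ℝ × (Fin m → ℝ)} {r : ℝ} (hr : 0 < r) (hpV : closedBall p r ⊆ V) :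
    volume ((fun x => (x.1, F x)) '' closedBall p r)
      ≤ L ^ (m : ℝ) * volume (closedBall p r)
        + C * L ^ (m - q) * ∫⁻ x in closedBall p r, G x ^ q := by
  have hm0 : (0 : ℝ) < m := by exact_mod_cast hm
  have hq0 : 0 < q := hm0.trans hq
  set B := closedBall p.2 r with hB
  set T := closedBall p.1 r with hT
  have hBT : closedBall p r = T ×ˢ B := (closedBall_prod_same p.1 p.2 r).symm
  have hcont : ContinuousOn (fun x => (x.1, F x)) (closedBall p r) :=
    continuousOn_fst.prodMk (hF.mono hpV)
  have hcomp := (isCompact_closedBall p r).image_of_continuousOn hcont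
  have hr0 : ENNReal.ofReal r ≠ 0 := by simpa using hr
  have hrt : ENNReal.ofReal r ≠ ⊤ := ofReal_ne_top
  have hmI : Measurable fun t => ∫⁻ y in B, G (t, y) ^ q := (hG.pow_const q).lintegral_prod_right'
  rw [Measure.volume_eq_prod, Measure.prod_apply hcomp.measurableSet]
  have hsec : ∀ᵐ t : ℝ, volume (Prod.mk t ⁻¹' ((fun x => (x.1, F x)) '' closedBall p r))
      ≤ T.indicator (fun t => (L * ENNReal.ofReal r) ^ (m : ℝ)
        + C * L ^ (m - q) * ∫⁻ y in B, G (t, y) ^ q) t := by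
    filter_upwards [h p r hr hpV] with t ht
    by_cases htT : t ∈ T
    · rw [indicator_of_mem htT]
      set a := C * ENNReal.ofReal r ^ (q - m) * ∫⁻ y in B, G (t, y) ^ q with ha
      have hdiam : Metric.ediam (Prod.mk t ⁻¹' ((fun x => (x.1, F x)) '' closedBall p r))
          ≤ a ^ (1 / q) := by
        refine Metric.ediam_le fun u hu u' hu' => ?_
        obtain ⟨⟨t1, z⟩, hz, hze⟩ := hu
        obtain ⟨⟨t2, z'⟩, hz', hze'⟩ := hu'
        simp only [Prod.mk.injEq] at hze hze'
        obtain ⟨rfl, rfl⟩ := hze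
        obtain ⟨rfl, rfl⟩ := hze'
        rw [hBT] at hz hz'
        have := ht htT z hz.2 z' hz'.2
        rw [edist_eq_enorm_sub]
        calc _ = (‖F (t2, z) - F (t2, z')‖ₑ ^ q) ^ (1 / q) := by
              rw [← ENNReal.rpow_mul, mul_one_div_cancel hq0.ne', ENNReal.rpow_one]
          _ ≤ _ := by gcongr
      calc _ ≤ (Metric.ediam (Prod.mk t ⁻¹' ((fun x => (x.1, F x)) '' closedBall p r)))
              ^ Fintype.card (Fin m) := Real.volume_pi_le_diam_pow _
        _ ≤ (a ^ (1 / q)) ^ m := by rw [Fintype.card_fin]; gcongr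
        _ = a ^ (m / q) := by
            rw [← ENNReal.rpow_natCast, ← ENNReal.rpow_mul]; congr 1; ring
        _ ≤ (L * ENNReal.ofReal r) ^ (m : ℝ) + (L * ENNReal.ofReal r) ^ (m - q) * a :=
            rpow_div_le_add hm0 hq (mul_ne_zero hL0 hr0) (mul_ne_top hLt hrt)
        _ = _ := by
            congr 1
            rw [ha, ENNReal.mul_rpow_of_ne_zero hL0 hr0]
            have : ENNReal.ofReal r ^ (m - q) * ENNReal.ofReal r ^ (q - m) = 1 := by
              rw [← ENNReal.rpow_add _ _ hr0 hrt]; simp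
            calc _ = C * L ^ (m - q) * (∫⁻ y in B, G (t, y) ^ q)
                  * (ENNReal.ofReal r ^ (m - q) * ENNReal.ofReal r ^ (q - m)) := by ring
              _ = _ := by rw [this, mul_one]
    · have : Prod.mk t ⁻¹' ((fun x => (x.1, F x)) '' closedBall p r) = ∅ := by
        refine eq_empty_of_forall_notMem fun u hu => ?_
        obtain ⟨⟨t1, z⟩, hz, hze⟩ := hu
        simp only [Prod.mk.injEq] at hze
        rw [hBT] at hz
        exact htT (hze.1 ▸ hz.1)
      rw [this]; simp
  refine (lintegral_mono_ae hsec).trans ?_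
  rw [lintegral_indicator measurableSet_closedBall, lintegral_add_left measurable_const,
    lintegral_const_mul _ hmI, setLIntegral_const, hBT, ← Measure.prod_restrict,
    lintegral_prod _ (hG.pow_const q).aemeasurable, Measure.prod_prod]
  gcongr ?_ + _
  rw [ENNReal.mul_rpow_of_nonneg _ _ hm0.le, mul_assoc, mul_comm (volume T)]
  gcongr
  rw [hB, Real.volume_pi_closedBall _ hr.le, Fintype.card_fin, ENNReal.rpow_natCast,
    ← ENNReal.ofReal_pow hr.le]
  gcongr
  linarith

theorem volume_image_graph_le_of_finite (hm : 1 ≤ m) (hq : (m : ℝ) < q) (hC : C ≠ ⊤)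
    (hV : IsOpen V) (hF : ContinuousOn F V)
    (hG : Measurable G) (h : SliceBound q C V F G) (hGV : ∫⁻ x in V, G x ^ q ≠ ⊤)
    {L : ℝ≥0∞} (hL0 : L ≠ 0) (hLt : L ≠ ⊤) {E : Set (ℝ × (Fin m → ℝ))} (hE : E ⊆ V)
    (hEm : MeasurableSet E) :
    volume ((fun x => (x.1, F x)) '' E)
      ≤ L ^ (m : ℝ) * volume E + C * L ^ (m - q) * ∫⁻ x in E, G x ^ q := by
  have hLm : L ^ (m : ℝ) ≠ ⊤ := rpow_ne_top_of_ne_zero hL0 hLt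
  have hLq : C * L ^ (m - q) ≠ ⊤ := mul_ne_top hC (rpow_ne_top_of_ne_zero hL0 hLt)
  set μ₁ : Measure (ℝ × (Fin m → ℝ)) := (volume.restrict V).withDensity fun x => G x ^ q with hμ₁
  have : IsFiniteMeasure μ₁ := isFiniteMeasure_withDensity hGV
  set κ : Measure (ℝ × (Fin m → ℝ)) :=
    (L ^ (m : ℝ)).toNNReal • volume + (C * L ^ (m - q)).toNNReal • μ₁ with hκ
  have hκA : ∀ A ⊆ V, MeasurableSet A →
      κ A = L ^ (m : ℝ) * volume A + C * L ^ (m - q) * ∫⁻ x in A, G x ^ q := by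
    intro A hA hAm
    rw [hκ, Measure.add_apply, Measure.smul_apply, Measure.smul_apply, hμ₁, withDensity_apply _ hAm,
      Measure.restrict_restrict hAm, inter_eq_left.2 hA, ENNReal.smul_def, ENNReal.smul_def,
      smul_eq_mul, smul_eq_mul, coe_toNNReal hLm, coe_toNNReal hLq]
  have : IsFiniteMeasureOnCompacts κ := ⟨fun K hK => by
    rw [hκ, Measure.add_apply, ENNReal.add_lt_top]
    exact ⟨hK.measure_lt_top, measure_lt_top _ _⟩⟩
  have : κ.OuterRegular := inferInstance
  refine ENNReal.le_of_forall_pos_le_add fun ε hε _ => ?_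
  obtain ⟨t, r, htc, htE, hr, hcov, hsum⟩ := Besicovitch.exists_closedBall_covering_tsum_measure_le
    κ (ε := ε) (by exact_mod_cast hε.ne') (fun x => {r | 0 < r ∧ closedBall x r ⊆ V}) E
    (fun x hx δ hδ => by
      obtain ⟨r, hr, hrV⟩ := nhds_basis_closedBall.mem_iff.1 (hV.mem_nhds (hE hx))
      refine ⟨min r (δ / 2), ⟨by positivity, ?_⟩, by positivity, ?_⟩
      · exact (closedBall_subset_closedBall (min_le_left _ _)).trans hrV
      · exact (min_le_right _ _).trans_lt (by linarith))
  have : Countable t := htc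
  rw [← hκA E hE hEm]
  refine le_trans ?_ hsum
  calc _ ≤ volume (⋃ x : t, (fun x => (x.1, F x)) '' closedBall (x : ℝ × (Fin m → ℝ)) (r x)) := by
        rw [← image_iUnion]
        refine measure_mono (image_mono ?_)
        rwa [biUnion_eq_iUnion] at hcov
    _ ≤ ∑' x : t, volume ((fun x => (x.1, F x)) '' closedBall (x : ℝ × (Fin m → ℝ)) (r x)) :=
        measure_iUnion_le _
    _ ≤ _ := by
        refine ENNReal.tsum_le_tsum fun x => ?_
        have := hr x x.2
        rw [hκA _ this.2 measurableSet_closedBall]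
        exact volume_image_graph_closedBall_le hm hq hF hG h hL0 hLt this.1 this.2

/-- Maps `(t, z) ↦ (t, F (t, z))` with the slice bound satisfy a Luzin-type area estimate. -/
theorem volume_image_graph_le (hm : 1 ≤ m) (hq : (m : ℝ) < q) (hC : C ≠ ⊤)
    (hV : IsOpen V) (hF : ContinuousOn F V) (hG : Measurable G) (hGt : ∀ x, G x ≠ ⊤)
    (h : SliceBound q C V F G) (hloc : ∀ K ⊆ V, IsCompact K → ∫⁻ x in K, G x ^ q ≠ ⊤)
    {E : Set (ℝ × (Fin m → ℝ))} (hE : E ⊆ V) (hEm : MeasurableSet E) :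
    volume ((fun x => (x.1, F x)) '' E) ≤ (1 + C * 2 ^ (q - m)) * ∫⁻ x in E, G x ^ (m : ℝ) := by
  have hm0 : (0 : ℝ) < m := by exact_mod_cast hm
  have hq0 : 0 < q := hm0.trans hq
  -- reduction to small balls
  have hball : ∀ x : V, ∃ r > 0, closedBall (x : ℝ × (Fin m → ℝ)) r ⊆ V := fun x =>
    nhds_basis_closedBall.mem_iff.1 (hV.mem_nhds x.2)
  choose r hr hrV using hball
  rcases V.eq_empty_or_nonempty with rfl | hne
  · simp [subset_empty_iff.1 hE]
  obtain ⟨s, hs, hsV⟩ := TopologicalSpace.isOpen_iUnion_countable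
    (fun x : V => ball (x : ℝ × (Fin m → ℝ)) (r x)) (fun _ => isOpen_ball)
  have hVs : V ⊆ ⋃ x ∈ s, ball (x : ℝ × (Fin m → ℝ)) (r x) := by
    rw [hsV]
    exact fun x hx => mem_iUnion.2 ⟨⟨x, hx⟩, mem_ball_self (hr _)⟩
  have : Countable s := hs
  have : Nonempty s := by
    obtain ⟨x, hx⟩ := hne
    obtain ⟨y, hy, -⟩ := mem_iUnion₂.1 (hVs hx)
    exact ⟨⟨y, hy⟩⟩
  rw [biUnion_eq_iUnion] at hVs
  refine measure_image_le_of_countable_cover volume volume _ _ _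
    (A := fun x : s => ball ((x : V) : ℝ × (Fin m → ℝ)) (r x)) (fun _ => measurableSet_ball) hVs
    (fun x => ?_) hE hEm
  intro E hE hEm
  set W := ball ((x : V) : ℝ × (Fin m → ℝ)) (r x) with hW
  have hWV : W ⊆ V := ball_subset_closedBall.trans (hrV x)
  have hWf : ∫⁻ x in W, G x ^ q ≠ ⊤ :=
    ne_top_of_le_ne_top (hloc _ (hrV x) (isCompact_closedBall _ _))
      (lintegral_mono_set ball_subset_closedBall)
  have hbd : ∀ {L : ℝ≥0∞}, L ≠ 0 → L ≠ ⊤ → ∀ E ⊆ W, MeasurableSet E →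
      volume ((fun x => (x.1, F x)) '' E)
        ≤ L ^ (m : ℝ) * volume E + C * L ^ (m - q) * ∫⁻ x in E, G x ^ q := fun hL0 hLt E hE hEm =>
    volume_image_graph_le_of_finite hm hq hC isOpen_ball (hF.mono hWV) hG
      (fun p r hr hp => h p r hr (hp.trans hWV)) hWf hL0 hLt hE hEm
  -- decomposition into level sets
  refine measure_image_le_of_countable_cover volume volume _ _ _ (V := W)
    (A := fun k : Option ℤ => k.elim {x | G x = 0} fun k => {x | G x ∈ Ico (2 ^ k) (2 ^ (k + 1))})
    (fun k => ?_) (fun x _ => ?_) (fun k E hE hEm => ?_) (fun y hy => (hE hy).2) hEm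
  · cases k with
    | none => exact hG (measurableSet_singleton 0)
    | some k => exact hG measurableSet_Ico
  · by_cases hx : G x = 0
    · exact mem_iUnion.2 ⟨none, hx⟩
    · obtain ⟨k, hk⟩ := ENNReal.exists_mem_Ico_zpow hx (hGt x) (y := 2) (by simp) (by simp)
      exact mem_iUnion.2 ⟨some k, hk⟩
  · have hEW : E ⊆ W := fun y hy => (hE hy).1
    cases k with
    | none =>
      have hz : ∀ L : ℝ≥0∞, L ≠ 0 → L ≠ ⊤ → volume ((fun x => (x.1, F x)) '' E)
          ≤ L ^ (m : ℝ) * volume E := by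
        intro L hL0 hLt
        refine (hbd hL0 hLt E hEW hEm).trans (le_of_eq ?_)
        rw [setLIntegral_congr_fun (g := fun _ => 0) hEm, lintegral_zero, mul_zero, add_zero]
        intro y hy
        have : G y = 0 := (hE hy).2
        simp [this, hq0]
      have hvE : volume E ≠ ⊤ := ne_top_of_le_ne_top
        (measure_ball_lt_top (x := ((x : V) : ℝ × (Fin m → ℝ))) (r := r x)).ne (measure_mono hEW)
      have hlim : Tendsto (fun L : ℝ≥0∞ => L ^ (m : ℝ) * volume E) (𝓝[>] 0) (𝓝 (0 * volume E)) := by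
        refine ENNReal.Tendsto.mul_const ?_ (Or.inr hvE)
        have := (ENNReal.continuous_rpow_const (y := (m : ℝ))).tendsto 0
        rw [ENNReal.zero_rpow_of_pos hm0] at this
        exact this.mono_left nhdsWithin_le_nhds
      rw [zero_mul] at hlim
      have h0 := ge_of_tendsto hlim (b := volume ((fun x => (x.1, F x)) '' E)) (by
        have hev : ∀ᶠ L : ℝ≥0∞ in 𝓝[>] 0, L < ⊤ :=
          eventually_nhdsWithin_of_eventually_nhds (eventually_lt_nhds (by simp))
        filter_upwards [hev, self_mem_nhdsWithin] with L hLt hL0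
        exact hz L (ne_of_gt hL0) hLt.ne)
      exact h0.trans zero_le
    | some k =>
      have hk0 : (2 : ℝ≥0∞) ^ k ≠ 0 := (ENNReal.zpow_pos (by simp) (by simp) k).ne'
      have hkt : (2 : ℝ≥0∞) ^ k ≠ ⊤ := (ENNReal.zpow_lt_top (by simp) (by simp) k).ne
      refine (hbd hk0 hkt E hEW hEm).trans ?_
      rw [add_mul, one_mul]
      gcongr ?_ + ?_
      · rw [← setLIntegral_const]
        refine setLIntegral_mono' hEm fun y hy => ?_
        have : (2 : ℝ≥0∞) ^ k ≤ G y := (hE hy).2.1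
        gcongr
      · rw [mul_assoc, mul_assoc]
        gcongr C * ?_
        rw [← lintegral_const_mul _ (hG.pow_const q),
          ← lintegral_const_mul _ (hG.pow_const (m : ℝ))]
        refine setLIntegral_mono' hEm fun y hy => ?_
        have h1 : (2 : ℝ≥0∞) ^ k ≤ G y := (hE hy).2.1
        have h2 : G y < 2 ^ (k + 1) := (hE hy).2.2
        have h0 : G y ≠ 0 := ((pos_iff_ne_zero.2 hk0).trans_le h1).ne'
        have h3 : G y ≤ 2 * 2 ^ k := by
          rw [ENNReal.zpow_add (by simp) (by simp), zpow_one, mul_comm] at h2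
          exact h2.le
        calc ((2 : ℝ≥0∞) ^ k) ^ (m - q) * G y ^ q
            = ((2 : ℝ≥0∞) ^ k) ^ (m - q) * (G y ^ (q - m) * G y ^ (m : ℝ)) := by
              rw [← ENNReal.rpow_add _ _ h0 (hGt y), sub_add_cancel]
          _ ≤ ((2 : ℝ≥0∞) ^ k) ^ (m - q) * ((2 * 2 ^ k) ^ (q - m) * G y ^ (m : ℝ)) := by
              gcongr
          _ = (((2 : ℝ≥0∞) ^ k) ^ (m - q) * ((2 : ℝ≥0∞) ^ k) ^ (q - m)) *
                (2 ^ (q - m) * G y ^ (m : ℝ)) := by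
              rw [ENNReal.mul_rpow_of_nonneg _ _ (by linarith)]; ring
          _ = _ := by
              rw [← ENNReal.rpow_add _ _ hk0 hkt]; simp

end GraphMap

section Variation

variable {m : ℕ}

/-- The area swept by the graph of `u` dominates the integral of its increments. -/
theorem lintegral_increment_le {V : Set (ℝ × (Fin m → ℝ))} {u : ℝ × (Fin m → ℝ) → ℝ}
    (hu : ContinuousOn u V) {μ : Measure (ℝ × (Fin m → ℝ))} {C : ℝ≥0∞}
    (hμ : ∀ E ⊆ V, MeasurableSet E → volume ((fun p => (u p, p.2)) '' E) ≤ C * μ E)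
    {s h : ℝ} (hh : 0 ≤ h) {B : Set (Fin m → ℝ)} (hB : MeasurableSet B)
    (hBV : Icc s (s + h) ×ˢ B ⊆ V) :
    ∫⁻ z in B, ‖u (s, z) - u (s + h, z)‖ₑ ≤ C * μ (Icc s (s + h) ×ˢ B) := by
  have hEm : MeasurableSet (Icc s (s + h) ×ˢ B) := measurableSet_Icc.prod hB
  refine le_trans ?_ (hμ _ hBV hEm)
  have hab : ∀ s' ∈ Icc s (s + h), Measurable (B.indicator fun z => u (s', z)) := by
    intro s' hs'
    have : ContinuousOn (fun z => u (s', z)) B :=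
      hu.comp (by fun_prop) fun z hz => hBV ⟨hs', hz⟩
    classical
    have h0 := this.measurable_piecewise (g := 0) continuousOn_const hB
    rwa [piecewise_eq_indicator] at h0
  set a := B.indicator fun z => u (s, z)
  set b := B.indicator fun z => u (s + h, z)
  have ha : Measurable a := hab s ⟨le_rfl, by linarith⟩
  have hb : Measurable b := hab _ ⟨by linarith, le_rfl⟩
  set R : Set (ℝ × (Fin m → ℝ)) := Prod.snd ⁻¹' B ∩
    ({p | min (a p.2) (b p.2) < p.1} ∩ {p | p.1 < max (a p.2) (b p.2)}) with hR
  have hRm : MeasurableSet R := by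
    refine (measurable_snd hB).inter (MeasurableSet.inter ?_ ?_)
    · exact measurableSet_lt ((ha.comp measurable_snd).min (hb.comp measurable_snd)) measurable_fst
    · exact measurableSet_lt measurable_fst ((ha.comp measurable_snd).max (hb.comp measurable_snd))
  have hsub : R ⊆ (fun p => (u p, p.2)) '' (Icc s (s + h) ×ˢ B) := by
    rintro ⟨t, z⟩ ⟨hz, h1, h2⟩
    have hz' : z ∈ B := hz
    simp only [mem_ofPred_eq, a, b, indicator_of_mem hz'] at h1 h2
    have hc : ContinuousOn (fun s' => u (s', z)) (uIcc s (s + h)) := by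
      refine hu.comp (by fun_prop) fun s' hs' => hBV ⟨?_, hz'⟩
      rwa [uIcc_of_le (by linarith)] at hs'
    obtain ⟨s', hs', hs'e⟩ := intermediate_value_uIcc hc (show t ∈ uIcc _ _ from ⟨h1.le, h2.le⟩)
    rw [uIcc_of_le (by linarith)] at hs'
    exact ⟨(s', z), ⟨hs', hz'⟩, by simp [hs'e]⟩
  refine le_trans (le_of_eq ?_) (measure_mono hsub)
  rw [Measure.volume_eq_prod, Measure.prod_apply_symm hRm, ← lintegral_indicator hB]
  refine lintegral_congr fun z => ?_
  by_cases hz : z ∈ B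
  · have : (fun x => (x, z)) ⁻¹' R = Ioo (min (a z) (b z)) (max (a z) (b z)) := by
      ext t; simp [hR, hz]
    rw [this, Real.volume_Ioo, indicator_of_mem hz, max_sub_min_eq_abs, abs_sub_comm]
    simp only [a, b, indicator_of_mem hz]
    rw [← Real.norm_eq_abs, ofReal_norm]
  · have : (fun x => (x, z)) ⁻¹' R = ∅ := by
      ext t; simp [hR, hz]
    rw [this, indicator_of_notMem hz, measure_empty]

/-- Increments integrated against a nonnegative function on a slice. -/
theorem lintegral_increment_mul_le {V : Set (ℝ × (Fin m → ℝ))} {u : ℝ × (Fin m → ℝ) → ℝ}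
    (hu : ContinuousOn u V) {μ : Measure (ℝ × (Fin m → ℝ))} {C : ℝ≥0∞}
    (hμ : ∀ E ⊆ V, MeasurableSet E → volume ((fun p => (u p, p.2)) '' E) ≤ C * μ E)
    {s h : ℝ} (hh : 0 ≤ h) {Z : Set (Fin m → ℝ)} (hZ : MeasurableSet Z)
    (hZV : Icc s (s + h) ×ˢ Z ⊆ V) {f : (Fin m → ℝ) → ℝ≥0∞} (hf : Measurable f) :
    ∫⁻ z in Z, ‖u (s, z) - u (s + h, z)‖ₑ * f z
      ≤ C * ∫⁻ p, (Icc s (s + h) ×ˢ univ).indicator (fun p => f p.2) p ∂μ := by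
  have hcont : ∀ s' ∈ Icc s (s + h), ContinuousOn (fun z => u (s', z)) Z := fun s' hs' =>
    hu.comp (by fun_prop) fun z hz => hZV ⟨hs', hz⟩
  set d : (Fin m → ℝ) → ℝ≥0∞ := fun z => ‖u (s, z) - u (s + h, z)‖ₑ with hd
  have hdm : AEMeasurable d (volume.restrict Z) :=
    (((hcont s ⟨le_rfl, by linarith⟩).sub (hcont _ ⟨by linarith, le_rfl⟩)).aestronglyMeasurable
      hZ).enorm
  have hSm : MeasurableSet (Icc s (s + h) ×ˢ (univ : Set (Fin m → ℝ))) :=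
    measurableSet_Icc.prod MeasurableSet.univ
  have hle : (volume.restrict Z).withDensity d
      ≤ C • Measure.map Prod.snd (μ.restrict (Icc s (s + h) ×ˢ univ)) := by
    refine Measure.le_iff.2 fun B hB => ?_
    rw [withDensity_apply _ hB, Measure.restrict_restrict hB, Measure.smul_apply,
      Measure.map_apply measurable_snd hB, Measure.restrict_apply (measurable_snd hB), smul_eq_mul]
    refine (lintegral_increment_le hu hμ hh (hB.inter hZ)
      ((prod_mono le_rfl inter_subset_right).trans hZV)).trans ?_
    gcongr
    rintro ⟨t, z⟩ ⟨ht, hz⟩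
    exact ⟨hz.1, ht, mem_univ _⟩
  calc ∫⁻ z in Z, d z * f z = ∫⁻ z, f z ∂((volume.restrict Z).withDensity d) :=
        (lintegral_withDensity_eq_lintegral_mul₀ hdm hf.aemeasurable).symm
    _ ≤ ∫⁻ z, f z ∂(C • Measure.map Prod.snd (μ.restrict (Icc s (s + h) ×ˢ univ))) :=
        lintegral_mono' hle le_rfl
    _ = _ := by
        rw [lintegral_smul_measure, lintegral_map hf measurable_snd, lintegral_indicator hSm]
        rfl

theorem lintegral_increment_quotient_le {V : Set (ℝ × (Fin m → ℝ))}
    {u : ℝ × (Fin m → ℝ) → ℝ} (hu : ContinuousOn u V) {μ : Measure (ℝ × (Fin m → ℝ))} [SFinite μ]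
    {C : ℝ≥0∞} (hμ : ∀ E ⊆ V, MeasurableSet E → volume ((fun p => (u p, p.2)) '' E) ≤ C * μ E)
    {η : ℝ × (Fin m → ℝ) → ℝ} {L : NNReal} (hL : LipschitzWith L η) {δ : ℝ}
    (hδV : cthickening δ (tsupport η) ⊆ V) {h : ℝ} (hh : 0 ≤ h) (hhδ : h ≤ δ) :
    ∫⁻ p in tsupport η, ‖u p - u (p + (h, 0))‖ₑ * ‖η p‖ₑ
      ≤ C * (ENNReal.ofReal h * (∫⁻ p, ‖η p‖ₑ ∂μ
        + L * ENNReal.ofReal h * μ (cthickening δ (tsupport η)))) := by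
  set K := tsupport η with hK
  have hKm : MeasurableSet K := (isClosed_tsupport η).measurableSet
  have hηm : Measurable fun p => ‖η p‖ₑ := hL.continuous.enorm.measurable
  have hseg : ∀ (s : ℝ) (z : Fin m → ℝ), (s, z) ∈ K → ∀ s' ∈ Icc s (s + h),
      (s', z) ∈ cthickening δ K := by
    intro s z hz s' hs'
    refine mem_cthickening_of_dist_le _ _ _ _ hz ?_
    rw [Prod.dist_eq, dist_self, Real.dist_eq, abs_of_nonneg (by linarith [hs'.1])]
    exact max_le (by linarith [hs'.2]) (by linarith)
  have hum : AEMeasurable (fun p => ‖u p - u (p + (h, 0))‖ₑ * ‖η p‖ₑ)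
      ((volume : Measure (ℝ × (Fin m → ℝ))).restrict K) := by
    have h1 : ContinuousOn u K := hu.mono ((self_subset_cthickening K).trans hδV)
    have h2 : ContinuousOn (fun p => u (p + (h, 0))) K := by
      refine hu.comp (by fun_prop) fun p hp => hδV ?_
      have := hseg p.1 p.2 hp (p.1 + h) ⟨by linarith, le_rfl⟩
      convert this using 1
      ext <;> simp
    exact ((h1.sub h2).aestronglyMeasurable hKm).enorm.mul hηm.aemeasurable
  set Φ : ℝ → (ℝ × (Fin m → ℝ)) → ℝ≥0∞ := fun s =>
    (Icc s (s + h) ×ˢ univ).indicator fun p => ‖η (s, p.2)‖ₑ with hΦ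
  have hΦm : Measurable (Function.uncurry Φ) := by
    have : Function.uncurry Φ = {x : ℝ × (ℝ × (Fin m → ℝ)) | x.1 ≤ x.2.1 ∧ x.2.1 ≤ x.1 + h}.indicator
        fun x => ‖η (x.1, x.2.2)‖ₑ := by
      ext ⟨s, p⟩
      simp [Function.uncurry, hΦ, indicator]
    rw [this]
    refine (hηm.comp (by fun_prop)).indicator ?_
    exact (measurableSet_le measurable_fst (measurable_fst.comp measurable_snd)).inter
      (measurableSet_le (measurable_fst.comp measurable_snd) (measurable_fst.add_const h))
  calc ∫⁻ p in K, ‖u p - u (p + (h, 0))‖ₑ * ‖η p‖ₑ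
      = ∫⁻ s, ∫⁻ z in Prod.mk s ⁻¹' K, ‖u (s, z) - u (s + h, z)‖ₑ * ‖η (s, z)‖ₑ := by
        rw [← lintegral_indicator hKm, Measure.volume_eq_prod, lintegral_prod]
        · refine lintegral_congr fun s => ?_
          rw [← lintegral_indicator (measurable_prodMk_left hKm)]
          refine lintegral_congr fun z => ?_
          by_cases hz : (s, z) ∈ K
          · rw [indicator_of_mem hz, indicator_of_mem (by exact hz)]
            simp
          · rw [indicator_of_notMem hz, indicator_of_notMem (by exact hz)]
        · rw [aemeasurable_indicator_iff hKm]; exact hum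
    _ ≤ ∫⁻ s, C * (∫⁻ p, Φ s p ∂μ) := by
        refine lintegral_mono fun s => ?_
        refine lintegral_increment_mul_le hu hμ hh (measurable_prodMk_left hKm) ?_
          (hηm.comp measurable_prodMk_left)
        rintro ⟨s', z⟩ ⟨hs', hz⟩
        exact hδV (hseg s z hz s' hs')
    _ = C * ∫⁻ p, (∫⁻ s, Φ s p) ∂μ := by
        have h1 : Measurable fun s => ∫⁻ p, Φ s p ∂μ := hΦm.lintegral_prod_right'
        rw [lintegral_const_mul _ h1, lintegral_lintegral_swap hΦm.aemeasurable]
    _ ≤ C * ∫⁻ p, ENNReal.ofReal h * (‖η p‖ₑ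
          + L * ENNReal.ofReal h * (cthickening δ K).indicator 1 p) ∂μ := by
        gcongr with p
        calc ∫⁻ s, Φ s p ≤ ∫⁻ s, (Icc (p.1 - h) p.1).indicator (fun _ => ‖η p‖ₑ
              + L * ENNReal.ofReal h * (cthickening δ K).indicator 1 p) s := by
              refine lintegral_mono fun s => ?_
              by_cases hs : p.1 ∈ Icc s (s + h)
              · have hs2 : s ∈ Icc (p.1 - h) p.1 := ⟨by linarith [hs.2], hs.1⟩
                rw [indicator_of_mem hs2]
                simp only [hΦ]
                rw [indicator_of_mem (show p ∈ Icc s (s + h) ×ˢ univ from ⟨hs, mem_univ _⟩)]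
                by_cases hz : η (s, p.2) = 0
                · simp [hz]
                · have hzK : (s, p.2) ∈ K := subset_tsupport _ hz
                  rw [indicator_of_mem (show p ∈ cthickening δ K from hseg s p.2 hzK p.1 hs)]
                  have h1 : edist (η (s, p.2)) (η p) ≤ L * ENNReal.ofReal h := by
                    refine (hL.edist_le_mul _ _).trans ?_
                    gcongr
                    rw [edist_dist]
                    refine ENNReal.ofReal_le_ofReal ?_
                    rw [Prod.dist_eq, dist_self, Real.dist_eq, abs_sub_comm,
                      abs_of_nonneg (by linarith [hs.1])]
                    exact max_le (by linarith [hs.2]) hh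
                  rw [Pi.one_apply, mul_one, add_comm]
                  calc ‖η (s, p.2)‖ₑ = ‖(η (s, p.2) - η p) + η p‖ₑ := by rw [sub_add_cancel]
                    _ ≤ _ := (enorm_add_le _ _).trans (by
                        rw [← edist_eq_enorm_sub]; gcongr)
              · simp only [hΦ]
                rw [indicator_of_notMem (fun h' => hs h'.1)]
                exact zero_le
          _ = _ := by
              rw [lintegral_indicator_const measurableSet_Icc, Real.volume_Icc, mul_comm]
              congr 2; ring
    _ = _ := by
        rw [lintegral_const_mul _ (by
            refine hηm.add (measurable_const.mul (measurable_one.indicator ?_))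
            exact isClosed_cthickening.measurableSet), lintegral_add_left hηm,
          lintegral_const_mul _ (measurable_one.indicator isClosed_cthickening.measurableSet),
          lintegral_indicator_one isClosed_cthickening.measurableSet]

/-- If the graph map `p ↦ (u p, p.2)` has the area estimate with respect to `μ`, then the first
distributional derivative of `u` is dominated by `μ`. -/
theorem enorm_integral_mul_fderiv_le {V : Set (ℝ × (Fin m → ℝ))} (hV : IsOpen V)
    {u : ℝ × (Fin m → ℝ) → ℝ} (hu : ContinuousOn u V) {μ : Measure (ℝ × (Fin m → ℝ))} [SFinite μ]
    {C : ℝ≥0∞} (hC : C ≠ ⊤)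
    (hμ : ∀ E ⊆ V, MeasurableSet E → volume ((fun p => (u p, p.2)) '' E) ≤ C * μ E)
    (hμK : ∀ K ⊆ V, IsCompact K → μ K ≠ ⊤)
    {η : ℝ × (Fin m → ℝ) → ℝ} (hη : ContDiff ℝ ∞ η) (hηc : HasCompactSupport η)
    (hηV : tsupport η ⊆ V) :
    ‖∫ p in V, u p * fderiv ℝ η p (1, 0)‖ₑ ≤ C * ∫⁻ p, ‖η p‖ₑ ∂μ := by
  have hinv : (volume : Measure (ℝ × (Fin m → ℝ))).IsAddRightInvariant := by
    rw [Measure.volume_eq_prod]; infer_instance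
  have hη1 : ContDiff ℝ 1 η := hη.of_le (by simp)
  obtain ⟨L, hL⟩ := ContDiff.lipschitzWith_of_hasCompactSupport hηc hη1 (by simp)
  obtain ⟨δ, hδ, hδV⟩ := (hηc : IsCompact (tsupport η)).exists_cthickening_subset_open hV hηV
  set K := tsupport η with hK
  set K₁ := cthickening δ K with hK₁
  have hK₁c : IsCompact K₁ := IsCompact.cthickening hηc
  have hKK₁ : K ⊆ K₁ := self_subset_cthickening K
  set u₁ := K₁.indicator u with hu₁
  have huint : IntegrableOn u K₁ := (hu.mono hδV).integrableOn_compact hK₁c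
  have hu₁int : Integrable u₁ := (integrable_indicator_iff hK₁c.measurableSet).2 huint
  -- the difference quotients of the test function
  set Q : ℝ → ℝ × (Fin m → ℝ) → ℝ := fun h p => h⁻¹ * (η p - η (p - (h, 0))) with hQ
  have hlim : Tendsto (fun h => ∫ p, u₁ p * Q h p) (𝓝[>] 0)
      (𝓝 (∫ p, u₁ p * fderiv ℝ η p (1, 0))) := by
    refine tendsto_integral_filter_of_dominated_convergence (fun p => ‖u₁ p‖ * L) ?_ ?_ ?_ ?_
    · refine Eventually.of_forall fun h => hu₁int.1.mul ?_
      have : Continuous (Q h) := by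
        have := hη.continuous
        fun_prop
      exact this.aestronglyMeasurable
    · filter_upwards [self_mem_nhdsWithin] with h hh
      have hh' : 0 < h := hh
      refine Eventually.of_forall fun p => ?_
      rw [norm_mul]
      gcongr
      rw [hQ]
      simp only
      rw [norm_mul, norm_inv, Real.norm_of_nonneg hh'.le, inv_mul_le_iff₀ hh', mul_comm,
        ← dist_eq_norm]
      refine (hL.dist_le_mul _ _).trans ?_
      gcongr
      have e : p - (p - (h, 0)) = (h, 0) := by abel
      rw [dist_eq_norm, e, Prod.norm_def]
      simp [abs_of_pos hh', hh'.le]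
    · exact hu₁int.norm.mul_const _
    · refine Eventually.of_forall fun p => Tendsto.const_mul _ ?_
      have h1 : HasDerivAt (fun h : ℝ => p - (h, (0 : Fin m → ℝ))) (-(1, 0)) 0 := by
        have : HasDerivAt (fun h : ℝ => (h, (0 : Fin m → ℝ))) (1, 0) 0 :=
          (hasDerivAt_id (0 : ℝ)).prodMk (hasDerivAt_const _ _)
        exact this.const_sub p
      have h2 : HasDerivAt (fun h : ℝ => η (p - (h, 0))) (-(fderiv ℝ η p (1, 0))) 0 := by
        have h3 : HasFDerivAt η (fderiv ℝ η p) (p - ((0 : ℝ), (0 : Fin m → ℝ))) := by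
          have e : p - ((0 : ℝ), (0 : Fin m → ℝ)) = p := sub_zero p
          rw [e]; exact (hη1.differentiable one_ne_zero p).hasFDerivAt
        have := h3.comp_hasDerivAt (0 : ℝ) h1
        rwa [map_neg] at this
      have h4 := (hasDerivAt_iff_tendsto_slope_zero.1 h2).mono_left (nhdsGT_le_nhdsNE 0)
      have h5 := h4.neg
      rw [neg_neg] at h5
      refine h5.congr fun h => ?_
      have e : p - ((0 : ℝ), (0 : Fin m → ℝ)) = p := sub_zero p
      simp only [zero_add, smul_eq_mul, hQ, e]
      ring
  have hbound : ∀ h ∈ Ioc 0 δ, ‖∫ p, u₁ p * Q h p‖ₑ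
      ≤ C * (∫⁻ p, ‖η p‖ₑ ∂μ + L * ENNReal.ofReal h * μ K₁) := by
    intro h hh
    have hh0 : 0 < h := hh.1
    have hηb : ∃ M, ∀ p, ‖η p‖ ≤ M := hηc.exists_bound_of_continuous hη.continuous
    obtain ⟨M, hM⟩ := hηb
    have hi1 : Integrable fun p => u₁ p * η p :=
      hu₁int.mul_bdd hη.continuous.aestronglyMeasurable (Eventually.of_forall hM)
    have hi2 : Integrable fun p => u₁ p * η (p - (h, 0)) :=
      hu₁int.mul_bdd (hη.continuous.comp (by fun_prop)).aestronglyMeasurable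
        (Eventually.of_forall fun p => hM _)
    have hi3 : Integrable fun p => u₁ (p + (h, 0)) * η p :=
      (hu₁int.comp_add_right (h, 0)).mul_bdd hη.continuous.aestronglyMeasurable
        (Eventually.of_forall hM)
    have e1 : ∫ p, u₁ p * Q h p = h⁻¹ * ∫ p, (u₁ p - u₁ (p + (h, 0))) * η p := by
      have e2 : ∫ p, u₁ p * η (p - (h, 0)) = ∫ p, u₁ (p + (h, 0)) * η p := by
        rw [← integral_add_right_eq_self _ (h, (0 : Fin m → ℝ))]
        simp only [add_sub_cancel_right]
      simp_rw [sub_mul]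
      rw [integral_sub hi1 hi3, ← e2, ← integral_sub hi1 hi2, ← integral_const_mul]
      congr 1; ext p
      simp only [hQ]; ring
    have hshift : ∀ p ∈ K, p + (h, 0) ∈ K₁ := by
      intro p hp
      refine mem_cthickening_of_dist_le _ p _ _ hp ?_
      rw [dist_eq_norm, add_sub_cancel_left, Prod.norm_def]
      simp [abs_of_pos hh0, hh.2, hδ.le]
    rw [e1, enorm_mul]
    calc _ ≤ ‖h⁻¹‖ₑ * ∫⁻ p in K, ‖u p - u (p + (h, 0))‖ₑ * ‖η p‖ₑ := by
          gcongr
          refine (enorm_integral_le_lintegral_enorm _).trans (le_of_eq ?_)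
          rw [← lintegral_indicator (isClosed_tsupport η).measurableSet]
          refine lintegral_congr fun p => ?_
          by_cases hp : p ∈ K
          · rw [indicator_of_mem hp, enorm_mul, hu₁, indicator_of_mem (hKK₁ hp),
              indicator_of_mem (hshift p hp)]
          · rw [indicator_of_notMem hp, image_eq_zero_of_notMem_tsupport hp]; simp
      _ ≤ ‖h⁻¹‖ₑ * (C * (ENNReal.ofReal h * (∫⁻ p, ‖η p‖ₑ ∂μ + L * ENNReal.ofReal h * μ K₁))) := by
          gcongr
          exact lintegral_increment_quotient_le hu hμ hL hδV hh0.le hh.2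
      _ = _ := by
          rw [Real.enorm_of_nonneg (inv_nonneg.2 hh0.le), ENNReal.ofReal_inv_of_pos hh0]
          have h0 : ENNReal.ofReal h ≠ 0 := by simpa using hh0
          calc _ = ((ENNReal.ofReal h)⁻¹ * ENNReal.ofReal h) *
                (C * (∫⁻ p, ‖η p‖ₑ ∂μ + L * ENNReal.ofReal h * μ K₁)) := by ring
            _ = _ := by rw [ENNReal.inv_mul_cancel h0 ofReal_ne_top, one_mul]
  have hR : Tendsto (fun h => C * (∫⁻ p, ‖η p‖ₑ ∂μ + L * ENNReal.ofReal h * μ K₁)) (𝓝[>] 0)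
      (𝓝 (C * (∫⁻ p, ‖η p‖ₑ ∂μ + L * ENNReal.ofReal 0 * μ K₁))) := by
    refine ENNReal.Tendsto.const_mul (tendsto_const_nhds.add ?_) (Or.inr hC)
    refine ENNReal.Tendsto.mul_const (ENNReal.Tendsto.const_mul ?_ (Or.inr coe_ne_top))
      (Or.inr (hμK K₁ hδV hK₁c))
    exact (ENNReal.continuous_ofReal.tendsto 0).mono_left nhdsWithin_le_nhds
  have hfin := le_of_tendsto_of_tendsto hlim.enorm hR (by
    filter_upwards [Ioc_mem_nhdsGT hδ] with h hh
    exact hbound h hh)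
  simp only [ENNReal.ofReal_zero, mul_zero, zero_mul, add_zero] at hfin
  refine le_trans (le_of_eq ?_) hfin
  congr 1
  rw [← integral_indicator hV.measurableSet]
  refine integral_congr_ae (Eventually.of_forall fun p => ?_)
  by_cases hp : p ∈ K
  · simp [indicator_of_mem (hηV hp), hu₁, indicator_of_mem (hKK₁ hp)]
  · have : fderiv ℝ η p = 0 := fderiv_of_notMem_tsupport ℝ hp
    by_cases hpV : p ∈ V
    · simp [indicator_of_mem hpV, this]
    · simp [indicator_of_notMem hpV, this]

end Variation

section Jacobi

variable {n : ℕ}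

/-- The `i`-th row of a matrix, as a Euclidean vector. -/
def rowVec (M : Matrix (Fin n) (Fin n) ℝ) (i : Fin n) : En n :=
  (EuclideanSpace.equiv (Fin n) ℝ).symm (M i)

theorem rowVec_apply (M : Matrix (Fin n) (Fin n) ℝ) (i j : Fin n) : rowVec M i j = M i j := rfl

theorem opNorm_nonneg (M : Matrix (Fin n) (Fin n) ℝ) : 0 ≤ opNorm M := norm_nonneg _

theorem norm_rowVec_le_opNorm (M : Matrix (Fin n) (Fin n) ℝ) (i : Fin n) :
    ‖rowVec M i‖ ≤ opNorm M := by
  set r := rowVec M i with hr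
  have h1 : (Matrix.toEuclideanCLM (𝕜 := ℝ) M r) i = ‖r‖ ^ 2 := by
    rw [EuclideanSpace.norm_sq_eq, Matrix.ofLp_toEuclideanCLM, Matrix.mulVec, dotProduct]
    refine Finset.sum_congr rfl fun j _ => ?_
    rw [hr, rowVec_apply, Real.norm_eq_abs, sq_abs, sq]
  have h2 : ‖r‖ ^ 2 ≤ opNorm M * ‖r‖ := by
    rw [← h1]
    exact (le_abs_self _).trans ((PiLp.norm_apply_le (Matrix.toEuclideanCLM (𝕜 := ℝ) M r) i).trans
      (ContinuousLinearMap.le_opNorm _ _))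
  rcases (norm_nonneg r).eq_or_lt with h | h
  · rw [← h]; exact opNorm_nonneg M
  · nlinarith

theorem enorm_rowVec_le (M : Matrix (Fin n) (Fin n) ℝ) (i : Fin n) :
    ‖rowVec M i‖ₑ ≤ ENNReal.ofReal (opNorm M) := by
  rw [← ofReal_norm]
  exact ENNReal.ofReal_le_ofReal (norm_rowVec_le_opNorm M i)

theorem continuous_opNorm : Continuous fun M : Fin n → Fin n → ℝ => opNorm (Matrix.of M) := by
  have : Continuous ((Matrix.toEuclideanCLM (𝕜 := ℝ) (n := Fin n)).toAlgEquiv.toLinearMap ∘ₗ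
      (Matrix.ofLinearEquiv ℝ).toLinearMap) := LinearMap.continuous_of_finiteDimensional _
  exact this.norm

theorem measurable_opNorm {M : En n → Matrix (Fin n) (Fin n) ℝ}
    (hM : ∀ i, Measurable fun x => rowVec (M x) i) : Measurable fun x => opNorm (M x) := by
  refine continuous_opNorm.measurable.comp (g := fun M : Fin n → Fin n → ℝ => opNorm (Matrix.of M))
    (f := fun x i j => M x i j) ?_
  refine measurable_pi_lambda _ fun i => measurable_pi_lambda _ fun j => ?_
  have : Measurable fun v : En n => v j := by fun_prop
  exact this.comp (hM i)

end Jacobi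

/-- A homeomorphism with a measurable weak Jacobi matrix that is locally `L^q`. -/
structure SobolevHomeo {n : ℕ} (q : ℝ) (U U' : Set (En n)) (φ ψ : En n → En n)
    (M : En n → Matrix (Fin n) (Fin n) ℝ) : Prop where
  isOpen : IsOpen U
  isOpen' : IsOpen U'
  homeo : IsHomeoOn U U' φ ψ
  jacobi : IsWeakJacobiOn U φ M
  meas : ∀ i, Measurable fun x => rowVec (M x) i
  loc : ∀ K ⊆ U, IsCompact K → ∫⁻ x in K, ENNReal.ofReal (opNorm (M x)) ^ q ≠ ⊤

namespace SobolevHomeo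

section

variable {n : ℕ} {q : ℝ} {U U' : Set (En n)} {φ ψ : En n → En n}
  {M : En n → Matrix (Fin n) (Fin n) ℝ}

theorem measurable_ofReal_opNorm (h : SobolevHomeo q U U' φ ψ M) :
    Measurable fun x => ENNReal.ofReal (opNorm (M x)) :=
  (measurable_opNorm h.meas).ennreal_ofReal

theorem measurableSet_inter_preimage (h : SobolevHomeo q U U' φ ψ M) {E : Set (En n)}
    (hE : MeasurableSet E) : MeasurableSet (U ∩ φ ⁻¹' E) := by
  have h1 : Measurable (U.domRestrict φ) :=
    (continuousOn_iff_continuous_domRestrict.1 h.homeo.1).measurable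
  have h2 := h.isOpen.measurableSet.subtype_image (h1 hE)
  convert h2 using 1
  ext x; constructor
  · rintro ⟨hx, hx'⟩; exact ⟨⟨x, hx⟩, hx', rfl⟩
  · rintro ⟨⟨y, hy⟩, hy', rfl⟩; exact ⟨hy, hy'⟩

/-- The image under the homeomorphism of the measure with density `|Dφ|^(n-1)`. -/
def pushMeasure (U : Set (En n)) (φ : En n → En n) (M : En n → Matrix (Fin n) (Fin n) ℝ) :
    Measure (En n) :=
  Measure.map φ ((volume.restrict U).withDensity
    fun x => ENNReal.ofReal (opNorm (M x)) ^ ((n : ℝ) - 1))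

theorem aemeasurable (h : SobolevHomeo q U U' φ ψ M) : AEMeasurable φ (volume.restrict U) :=
  h.homeo.1.aemeasurable h.isOpen.measurableSet

theorem lintegral_pushMeasure (h : SobolevHomeo q U U' φ ψ M) {F : En n → ℝ≥0∞}
    (hF : Measurable F) : ∫⁻ y, F y ∂(pushMeasure U φ M)
      = ∫⁻ x in U, ENNReal.ofReal (opNorm (M x)) ^ ((n : ℝ) - 1) * F (φ x) := by
  have hac := withDensity_absolutelyContinuous (volume.restrict U)
    fun x => ENNReal.ofReal (opNorm (M x)) ^ ((n : ℝ) - 1)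
  rw [pushMeasure, lintegral_map' hF.aemeasurable (h.aemeasurable.mono_ac hac)]
  exact lintegral_withDensity_eq_lintegral_mul₀ (h.measurable_ofReal_opNorm.pow_const _).aemeasurable
    (hF.comp_aemeasurable h.aemeasurable)

theorem pushMeasure_apply (h : SobolevHomeo q U U' φ ψ M) {E : Set (En n)}
    (hE : MeasurableSet E) : pushMeasure U φ M E
      = ∫⁻ x in U ∩ φ ⁻¹' E, ENNReal.ofReal (opNorm (M x)) ^ ((n : ℝ) - 1) := by
  have hac := withDensity_absolutelyContinuous (volume.restrict U)
    fun x => ENNReal.ofReal (opNorm (M x)) ^ ((n : ℝ) - 1)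
  rw [← lintegral_indicator_one hE, h.lintegral_pushMeasure (measurable_one.indicator hE),
    ← lintegral_indicator h.isOpen.measurableSet,
    ← lintegral_indicator (h.measurableSet_inter_preimage hE)]
  refine lintegral_congr fun x => ?_
  by_cases hx : x ∈ U <;> by_cases hx' : φ x ∈ E <;> simp [hx, hx', indicator]

instance : SFinite (pushMeasure U φ M) := by
  unfold pushMeasure; infer_instance

theorem lintegral_rpow_ne_top (h : SobolevHomeo q U U' φ ψ M) {p : ℝ} (hp : 0 ≤ p) (hpq : p ≤ q)
    {K : Set (En n)} (hKU : K ⊆ U) (hK : IsCompact K) :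
    ∫⁻ x in K, ENNReal.ofReal (opNorm (M x)) ^ p ≠ ⊤ := by
  have hle : ∫⁻ x in K, ENNReal.ofReal (opNorm (M x)) ^ p
      ≤ ∫⁻ x in K, (1 + ENNReal.ofReal (opNorm (M x)) ^ q) := by
    refine lintegral_mono fun x => ?_
    rcases le_total (ENNReal.ofReal (opNorm (M x))) 1 with h1 | h1
    · exact (ENNReal.rpow_le_one h1 hp).trans le_self_add
    · exact (ENNReal.rpow_le_rpow_of_exponent_le h1 hpq).trans le_add_self
  refine ne_top_of_le_ne_top ?_ hle
  rw [lintegral_add_left measurable_const, lintegral_const, one_mul, Measure.restrict_apply_univ]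
  exact ENNReal.add_ne_top.2 ⟨hK.measure_ne_top, h.loc K hKU hK⟩

theorem image_subset (h : SobolevHomeo q U U' φ ψ M) {K : Set (En n)} (hK : K ⊆ U') :
    ψ '' K ⊆ U := image_subset_iff.2 fun _ hy => h.homeo.2.2.2.1 (hK hy)

theorem inter_preimage_eq (h : SobolevHomeo q U U' φ ψ M) {K : Set (En n)} (hK : K ⊆ U') :
    U ∩ φ ⁻¹' K = ψ '' K := by
  obtain ⟨-, -, -, h4, h5, h6⟩ := h.homeo
  ext x; constructor
  · rintro ⟨hx, hx'⟩; exact ⟨φ x, hx', h5 x hx⟩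
  · rintro ⟨y, hy, rfl⟩; exact ⟨h4 (hK hy), by simpa [h6 y (hK hy)] using hy⟩

theorem isCompact_image (h : SobolevHomeo q U U' φ ψ M) {K : Set (En n)} (hK : K ⊆ U')
    (hKc : IsCompact K) : IsCompact (ψ '' K) :=
  hKc.image_of_continuousOn (h.homeo.2.1.mono hK)

end

section

variable {m : ℕ} {q : ℝ} {U U' : Set (En (m + 1))} {φ ψ : En (m + 1) → En (m + 1)}
  {M : En (m + 1) → Matrix (Fin (m + 1)) (Fin (m + 1)) ℝ}

theorem pushMeasure_ne_top (h : SobolevHomeo q U U' φ ψ M) (hq : (m : ℝ) < q)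
    {K : Set (En (m + 1))} (hK : K ⊆ U') (hKc : IsCompact K) : pushMeasure U φ M K ≠ ⊤ := by
  rw [h.pushMeasure_apply hKc.measurableSet, h.inter_preimage_eq hK]
  exact h.lintegral_rpow_ne_top (by simp) (by push_cast; linarith) (h.image_subset hK)
    (h.isCompact_image hK hKc)

theorem exists_sliceBound (h : SobolevHomeo q U U' φ ψ M) (hm : 1 ≤ m) (hq : (m : ℝ) < q) :
    ∃ C : ℝ≥0∞, C ≠ ⊤ ∧ ∀ i j : Fin (m + 1), SliceBound q C (slice j ⁻¹' U)
      (fun p k => φ (slice j p) (i.succAbove k))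
      (fun p => ENNReal.ofReal (opNorm (M (slice j p)))) := by
  have hq0 : 0 < q := (Nat.cast_nonneg m).trans_lt hq
  obtain ⟨C, hC, hmor⟩ := exists_slice_morrey_const hm hq
  refine ⟨C, hC, fun i j p r hr hpr => ?_⟩
  have hrow : ∀ k, ∀ K ⊆ U, IsCompact K → ∫⁻ x in K, ‖rowVec (M x) k‖ₑ ^ q ≠ ⊤ :=
    fun k K hKU hK => ne_top_of_le_ne_top (h.loc K hKU hK)
      (lintegral_mono fun x => ENNReal.rpow_le_rpow (enorm_rowVec_le _ _) hq0.le)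
  have hcont : ∀ k, ContinuousOn (fun x => φ x k) U := fun k =>
    (EuclideanSpace.proj k : En (m + 1) →L[ℝ] ℝ).continuous.comp_continuousOn h.homeo.1
  have hall := ae_all_iff.2 fun k => hmor j h.isOpen (hcont k) (h.jacobi k) (h.meas k) (hrow k) p r
    hr (image_subset_iff.2 hpr)
  filter_upwards [hall] with t ht htr z hz z' hz'
  have hne : ∀ k, ‖φ (slice j (t, z)) k - φ (slice j (t, z')) k‖ₑ ^ q ≤ C * ENNReal.ofReal r ^ (q - m) *
      ∫⁻ y in closedBall p.2 r, ENNReal.ofReal (opNorm (M (slice j (t, y)))) ^ q := fun k =>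
    (ht k htr z hz z' hz').trans (by gcongr with y; exact enorm_rowVec_le _ _)
  obtain ⟨k₀⟩ : Nonempty (Fin m) := ⟨⟨0, hm⟩⟩
  obtain ⟨k, -, hk⟩ := Finset.exists_mem_eq_sup Finset.univ ⟨k₀, Finset.mem_univ _⟩
    fun k => ‖((fun k => φ (slice j (t, z)) (i.succAbove k)) -
      fun k => φ (slice j (t, z')) (i.succAbove k)) k‖₊
  rw [enorm_eq_nnnorm, Pi.nnnorm_def, hk]
  exact hne _

theorem exists_volume_mixed_image_le (h : SobolevHomeo q U U' φ ψ M) (hm : 1 ≤ m)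
    (hq : (m : ℝ) < q) : ∃ C : ℝ≥0∞, C ≠ ⊤ ∧ ∀ (i j : Fin (m + 1)), ∀ E ⊆ U', MeasurableSet E →
      volume ((fun y => (ψ y j, fun k => y (i.succAbove k))) '' E) ≤ C * pushMeasure U φ M E := by
  have hq0 : 0 < q := (Nat.cast_nonneg m).trans_lt hq
  obtain ⟨C, hC, hsl⟩ := h.exists_sliceBound hm hq
  refine ⟨1 + C * 2 ^ (q - m), ?_, fun i j E hE hEm => ?_⟩
  · exact ENNReal.add_ne_top.2 ⟨one_ne_top, mul_ne_top hC (by simp)⟩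
  have hEm' := h.measurableSet_inter_preimage hEm
  have hmp := measurePreserving_slice j
  have hme := measurableEmbedding_slice j
  have hloc : ∀ K ⊆ slice j ⁻¹' U, IsCompact K →
      ∫⁻ p in K, ENNReal.ofReal (opNorm (M (slice j p))) ^ q ≠ ⊤ := by
    intro K hKU hK
    have := h.loc (slice j '' K) (image_subset_iff.2 hKU) (hK.image (slice j).continuous)
    rwa [← hmp.setLIntegral_comp_emb hme] at this
  have hcont : ContinuousOn (fun (p : ℝ × (Fin m → ℝ)) (k : Fin m) => φ (slice j p) (i.succAbove k))
      (slice j ⁻¹' U) := by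
    refine continuousOn_pi.2 fun k => ?_
    refine (EuclideanSpace.proj (i.succAbove k) : En (m + 1) →L[ℝ] ℝ).continuous.comp_continuousOn ?_
    exact h.homeo.1.comp (slice j).continuous.continuousOn fun p hp => hp
  have key := volume_image_graph_le hm hq hC (h.isOpen.preimage (slice j).continuous) hcont
    (h.measurable_ofReal_opNorm.comp (slice j).continuous.measurable) (fun x => ofReal_ne_top)
    (hsl i j) hloc (E := slice j ⁻¹' (U ∩ φ ⁻¹' E)) (preimage_mono inter_subset_left)
    ((slice j).continuous.measurable hEm')
  rw [h.pushMeasure_apply hEm]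
  refine (measure_mono ?_).trans (key.trans (le_of_eq ?_))
  · rintro _ ⟨y, hy, rfl⟩
    refine ⟨(slice j).symm (ψ y), ?_, ?_⟩
    · rw [mem_preimage, ContinuousLinearEquiv.apply_symm_apply, h.inter_preimage_eq hE]
      exact ⟨y, hy, rfl⟩
    · simp only [ContinuousLinearEquiv.apply_symm_apply, h.homeo.2.2.2.2.2 y (hE hy)]
      rfl
  · congr 1
    have := hmp.setLIntegral_comp_emb hme
      (fun x => ENNReal.ofReal (opNorm (M x)) ^ (m : ℝ)) (slice j ⁻¹' (U ∩ φ ⁻¹' E))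
    rw [Function.comp_def, this, image_preimage_eq _ (slice j).surjective]
    simp

/-- The distributional derivatives of the inverse are dominated by the push-forward measure. -/
theorem exists_enorm_integral_mul_fderiv_le (h : SobolevHomeo q U U' φ ψ M) (hm : 1 ≤ m)
    (hq : (m : ℝ) < q) : ∃ C : ℝ≥0∞, C ≠ ⊤ ∧ ∀ (i j : Fin (m + 1)) (η : En (m + 1) → ℝ),
      ContDiff ℝ ∞ η → HasCompactSupport η → tsupport η ⊆ U' →
      ‖∫ y in U', ψ y j * fderiv ℝ η y (EuclideanSpace.single i 1)‖ₑ
        ≤ C * ∫⁻ y, ‖η y‖ₑ ∂(pushMeasure U φ M) := by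
  obtain ⟨C, hC, hvol⟩ := h.exists_volume_mixed_image_le hm hq
  refine ⟨C, hC, fun i j η hη hηc hηU => ?_⟩
  set μ := pushMeasure U φ M
  set μ₂ : Measure (ℝ × (Fin m → ℝ)) := Measure.map (slice i).symm μ with hμ₂
  have hsm : Measurable (slice i).symm := (slice i).symm.continuous.measurable
  have hμ₂a : ∀ E, MeasurableSet E → μ₂ E = μ (slice i '' E) := by
    intro E hE
    rw [hμ₂, Measure.map_apply hsm hE]
    congr 1
    exact ((slice i).image_eq_preimage_symm E).symm
  have hmp := measurePreserving_slice i
  have hme := measurableEmbedding_slice i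
  have hcont : ContinuousOn (fun p => ψ (slice i p) j) (slice i ⁻¹' U') := by
    refine (EuclideanSpace.proj j : En (m + 1) →L[ℝ] ℝ).continuous.comp_continuousOn ?_
    exact h.homeo.2.1.comp (slice i).continuous.continuousOn fun p hp => hp
  have hcs : tsupport (η ∘ slice i) ⊆ slice i ⁻¹' tsupport η :=
    tsupport_comp_subset_preimage η (slice i).continuous
  have key := enorm_integral_mul_fderiv_le (h.isOpen'.preimage (slice i).continuous) hcont
    (μ := μ₂) hC ?_ ?_ (hη.comp (slice i).contDiff)
    (hηc.comp_homeomorph (slice i).toHomeomorph) (hcs.trans (preimage_mono hηU))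
  · have e1 : ∫⁻ p, ‖(η ∘ slice i) p‖ₑ ∂μ₂ = ∫⁻ y, ‖η y‖ₑ ∂μ := by
      rw [hμ₂, lintegral_map _ hsm]
      · simp
      · exact (hη.continuous.comp (slice i).continuous).enorm.measurable
    have e2 : ∫ p in slice i ⁻¹' U', ψ (slice i p) j * fderiv ℝ (η ∘ slice i) p (1, 0)
        = ∫ y in U', ψ y j * fderiv ℝ η y (EuclideanSpace.single i 1) := by
      rw [← hmp.setIntegral_preimage_emb hme]
      congr 1; ext p
      have hd : DifferentiableAt ℝ η (slice i p) := (hη.differentiable (by simp)) _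
      rw [fderiv_comp p hd (slice i).differentiableAt, (slice i).fderiv]
      simp only [ContinuousLinearMap.comp_apply, ContinuousLinearEquiv.coe_coe]
      congr 2
      ext k
      refine Fin.succAboveCases i ?_ (fun k => ?_) k
      · rw [slice_apply_same]; simp
      · rw [slice_apply_succAbove]; simp
    rw [← e1, ← e2]; exact key
  · intro E hE hEm
    rw [hμ₂a E hEm]
    refine (measure_mono ?_).trans (hvol i j (slice i '' E) (image_subset_iff.2 hE)
      (hme.measurableSet_image.2 hEm))
    rintro _ ⟨p, hp, rfl⟩
    refine ⟨slice i p, mem_image_of_mem _ hp, ?_⟩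
    simp [slice_apply_succAbove]
  · intro K hK hKc
    rw [hμ₂a K hKc.measurableSet]
    exact h.pushMeasure_ne_top hq (image_subset_iff.2 hK) (hKc.image (slice i).continuous)

end

end SobolevHomeo

section Pointwise

variable {n : ℕ}

theorem setLIntegral_closedBall_comp_homothety (F : En n → ℝ≥0∞) (x : En n) {s r : ℝ} (hs : 0 < s) :
    ∫⁻ y in closedBall x r, F (x + s • (y - x))
      = ENNReal.ofReal ((s ^ n)⁻¹) * ∫⁻ y in closedBall x (s * r), F y := by
  rw [← lintegral_indicator measurableSet_closedBall, ← lintegral_indicator measurableSet_closedBall]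
  have := lintegral_comp_smul_add (volume : Measure (En n)) ((closedBall x (s * r)).indicator F)
    hs.ne' (x - s • x)
  rw [abs_of_nonneg (by positivity), finrank_euclideanSpace_fin] at this
  rw [← this]
  refine lintegral_congr fun y => ?_
  have e : s • y + (x - s • x) = x + s • (y - x) := by rw [smul_sub]; abel
  rw [e]
  have hiff : x + s • (y - x) ∈ closedBall x (s * r) ↔ y ∈ closedBall x r := by
    rw [mem_closedBall, mem_closedBall, dist_eq_norm, dist_eq_norm, add_sub_cancel_left, norm_smul,
      Real.norm_of_nonneg hs.le, mul_le_mul_iff_right₀ hs]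
  by_cases hy : y ∈ closedBall x r
  · rw [indicator_of_mem hy, indicator_of_mem (hiff.2 hy)]
  · rw [indicator_of_notMem hy, indicator_of_notMem (fun h => hy (hiff.1 h))]

theorem volume_closedBall_mul (x y : En n) {s r : ℝ} (hs : 0 ≤ s) (hr : 0 ≤ r) :
    volume (closedBall x (s * r)) = ENNReal.ofReal (s ^ n) * volume (closedBall y r) := by
  rw [Measure.addHaar_closedBall_mul _ _ hs hr, finrank_euclideanSpace_fin,
    Measure.addHaar_closedBall_center _ y r]

theorem lintegral_closedBall_sub_homothety_le {v : En n → ℝ} (hv : ContDiff ℝ 1 v)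
    {g : En n → En n} {x : En n} {r : ℝ} {ε κ : ℝ≥0∞}
    (hgm : AEStronglyMeasurable g (volume.restrict (closedBall x r)))
    (hg : ∀ s ∈ Ioc 0 r, ∫⁻ y in closedBall x s, ‖g y‖ₑ ≤ ε * volume (closedBall x s))
    (hκ : ∫⁻ y in closedBall x r, ‖gradient v y - g y‖ₑ ≤ κ) (hr : 0 < r)
    {δ : ℝ} (hδ : 0 < δ) (h1 : δ ≤ 1) :
    ∫⁻ y in closedBall x r, ‖v y - v (x + δ • (y - x))‖ₑ
      ≤ ENNReal.ofReal r * (ENNReal.ofReal ((δ ^ n)⁻¹) * κ + ε * volume (closedBall x r)) := by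
  have hcont : Continuous fun p : En n × ℝ => ‖fderiv ℝ v (x + p.2 • (p.1 - x))‖ₑ :=
    ((hv.continuous_fderiv one_ne_zero).comp (by fun_prop)).enorm
  calc ∫⁻ y in closedBall x r, ‖v y - v (x + δ • (y - x))‖ₑ
      ≤ ∫⁻ y in closedBall x r, ENNReal.ofReal r *
          ∫⁻ s in Ioc δ 1, ‖fderiv ℝ v (x + s • (y - x))‖ₑ := by
        refine setLIntegral_mono' measurableSet_closedBall fun y hy => ?_
        have := enorm_sub_le_lintegral_fderiv hv x (y - x) h1
        rw [one_smul, add_sub_cancel] at this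
        refine this.trans ?_
        rw [lintegral_mul_const' _ _ (by simp), mul_comm]
        gcongr
        rw [← ofReal_norm, ← dist_eq_norm]
        exact ENNReal.ofReal_le_ofReal hy
    _ = ENNReal.ofReal r * ∫⁻ s in Ioc δ 1,
          ∫⁻ y in closedBall x r, ‖fderiv ℝ v (x + s • (y - x))‖ₑ := by
        rw [lintegral_const_mul' _ _ ofReal_ne_top, lintegral_lintegral_swap]
        exact hcont.measurable.aemeasurable
    _ ≤ ENNReal.ofReal r * ∫⁻ s in Ioc δ 1,
          (ENNReal.ofReal ((δ ^ n)⁻¹) * κ + ε * volume (closedBall x r)) := by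
        refine mul_le_mul' le_rfl (setLIntegral_mono' measurableSet_Ioc fun s hs => ?_)
        have hs0 : 0 < s := hδ.trans hs.1
        have hsr : s * r ≤ r := by nlinarith [hs.2]
        rw [setLIntegral_closedBall_comp_homothety (fun y => ‖fderiv ℝ v y‖ₑ) x hs0]
        have hle : ∫⁻ y in closedBall x (s * r), ‖fderiv ℝ v y‖ₑ
            ≤ κ + ε * (ENNReal.ofReal (s ^ n) * volume (closedBall x r)) := by
          rw [← volume_closedBall_mul x x hs0.le hr.le]
          calc ∫⁻ y in closedBall x (s * r), ‖fderiv ℝ v y‖ₑ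
              ≤ ∫⁻ y in closedBall x (s * r), (‖gradient v y - g y‖ₑ + ‖g y‖ₑ) := by
                refine lintegral_mono fun y => ?_
                rw [enorm_fderiv_eq_enorm_gradient]
                calc ‖gradient v y‖ₑ = ‖(gradient v y - g y) + g y‖ₑ := by rw [sub_add_cancel]
                  _ ≤ _ := enorm_add_le _ _
            _ = (∫⁻ y in closedBall x (s * r), ‖gradient v y - g y‖ₑ) +
                  ∫⁻ y in closedBall x (s * r), ‖g y‖ₑ :=
                lintegral_add_right' _ (hgm.mono_set (closedBall_subset_closedBall hsr)).enorm
            _ ≤ _ := add_le_add ((lintegral_mono_set (closedBall_subset_closedBall hsr)).trans hκ)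
                (hg _ ⟨by positivity, hsr⟩)
        refine (mul_le_mul_right hle _).trans ?_
        rw [mul_add]
        refine add_le_add ?_ (le_of_eq ?_)
        · gcongr
          exact hs.1.le
        · rw [mul_left_comm, ← mul_assoc (ENNReal.ofReal _) (ENNReal.ofReal _), ← ENNReal.ofReal_mul (by positivity),
            inv_mul_cancel₀ (by positivity), ENNReal.ofReal_one, one_mul]
    _ ≤ _ := by
        gcongr
        rw [lintegral_const, Measure.restrict_apply_univ, Real.volume_Ioc]
        refine mul_le_of_le_one_right' ?_
        exact ENNReal.ofReal_le_one.2 (by linarith)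

/-- A continuous Sobolev function is close on average to its value at a point where the averages
of the gradient are bounded. -/
theorem lintegral_closedBall_sub_center_le {U : Set (En n)} (hU : IsOpen U) {f : En n → ℝ}
    {g : En n → En n} (hf : ContinuousOn f U) (hg : IsWeakGradOn U f g) {x : En n} {r : ℝ}
    {ε : ℝ≥0∞} (hr : 0 < r) (hrU : closedBall x r ⊆ U)
    (hgε : ∀ s ∈ Ioc 0 r, ∫⁻ y in closedBall x s, ‖g y‖ₑ ≤ ε * volume (closedBall x s)) :
    ∫⁻ y in closedBall x r, ‖f y - f x‖ₑ
      ≤ ENNReal.ofReal r * ε * volume (closedBall x r) := by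
  set B := closedBall x r with hB
  have hBt : volume B ≠ ⊤ := measure_closedBall_lt_top.ne
  have hgp : ∀ K ⊆ U, IsCompact K → ∫⁻ x in K, ‖g x‖ₑ ^ (1 : ℝ) ≠ ⊤ := by
    intro K hKU hK
    simp only [ENNReal.rpow_one]
    exact (hg.2.1.integrableOn_compact_subset hKU hK).2.ne
  have hfx : ContinuousAt f x := hf.continuousAt (hU.mem_nhds (hrU (mem_closedBall_self hr.le)))
  have hstep : ∀ τ : ℝ, 0 < τ → ∫⁻ y in B, ‖f y - f x‖ₑ
      ≤ ENNReal.ofReal r * (ε * volume B) + ENNReal.ofReal τ * volume B := by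
    intro τ hτ
    obtain ⟨δ₀, hδ₀, hδ₀f⟩ := Metric.continuousAt_iff.1 hfx τ hτ
    set δ := min 1 (δ₀ / (2 * r)) with hδdef
    have hδ : 0 < δ := lt_min one_pos (by positivity)
    have hosc : ∀ y ∈ B, ‖f (x + δ • (y - x)) - f x‖ₑ ≤ ENNReal.ofReal τ := by
      intro y hy
      have hy' : ‖y - x‖ ≤ r := by rw [← dist_eq_norm]; exact hy
      have h1 : dist (x + δ • (y - x)) x < δ₀ := by
        rw [dist_eq_norm, add_sub_cancel_left, norm_smul, Real.norm_of_nonneg hδ.le]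
        calc δ * ‖y - x‖ ≤ δ₀ / (2 * r) * r := by gcongr; exact min_le_right _ _
          _ = δ₀ / 2 := by field_simp
          _ < δ₀ := by linarith
      have h2 := hδ₀f h1
      rw [← ofReal_norm, ← dist_eq_norm]
      exact ENNReal.ofReal_le_ofReal h2.le
    have hκ : ∀ κ : ℝ, 0 < κ → ∫⁻ y in B, ‖f y - f x‖ₑ
        ≤ ENNReal.ofReal r * (ENNReal.ofReal ((δ ^ n)⁻¹) * ENNReal.ofReal κ + ε * volume B)
          + (2 * ENNReal.ofReal κ + ENNReal.ofReal τ) * volume B := by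
      intro κ hκ
      obtain ⟨v, hv, hvf, hvg⟩ := exists_contDiff_approx hU hf hg le_rfl hgp
        (isCompact_closedBall x r) hrU hκ
      simp only [ENNReal.rpow_one] at hvg
      have hvf' : ∀ y ∈ B, ‖v y - f y‖ₑ ≤ ENNReal.ofReal κ := fun y hy => by
        rw [← ofReal_norm]; exact ENNReal.ofReal_le_ofReal (hvf y hy)
      have hmem : ∀ y ∈ B, x + δ • (y - x) ∈ B := fun y hy =>
        (convex_closedBall x r).add_smul_sub_mem (mem_closedBall_self hr.le) hy
          ⟨hδ.le, min_le_left _ _⟩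
      calc ∫⁻ y in B, ‖f y - f x‖ₑ
          ≤ ∫⁻ y in B, (‖v y - v (x + δ • (y - x))‖ₑ
              + (2 * ENNReal.ofReal κ + ENNReal.ofReal τ)) := by
            refine setLIntegral_mono' measurableSet_closedBall fun y hy => ?_
            have e : f y - f x = (v y - v (x + δ • (y - x))) + ((f y - v y)
              + (v (x + δ • (y - x)) - f (x + δ • (y - x))) + (f (x + δ • (y - x)) - f x)) := by ring
            rw [e]
            refine (enorm_add_le _ _).trans ?_
            gcongr
            refine (enorm_add_le _ _).trans ?_
            refine add_le_add ((enorm_add_le _ _).trans ?_) (hosc y hy)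
            rw [two_mul]
            refine add_le_add ?_ (hvf' _ (hmem y hy))
            rw [← enorm_neg, neg_sub]; exact hvf' y hy
        _ = (∫⁻ y in B, ‖v y - v (x + δ • (y - x))‖ₑ)
              + (2 * ENNReal.ofReal κ + ENNReal.ofReal τ) * volume B := by
            rw [lintegral_add_right _ measurable_const, lintegral_const, Measure.restrict_apply_univ]
        _ ≤ _ := by
            gcongr
            exact lintegral_closedBall_sub_homothety_le (hv.of_le (by simp))
              (hg.2.1.integrableOn_compact_subset hrU (isCompact_closedBall x r)).1 hgε hvg hr hδ
              (min_le_left _ _)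
    have hlim : Tendsto (fun κ : ℝ => ENNReal.ofReal r *
        (ENNReal.ofReal ((δ ^ n)⁻¹) * ENNReal.ofReal κ + ε * volume B)
          + (2 * ENNReal.ofReal κ + ENNReal.ofReal τ) * volume B) (𝓝[>] 0)
        (𝓝 (ENNReal.ofReal r * (ENNReal.ofReal ((δ ^ n)⁻¹) * ENNReal.ofReal 0 + ε * volume B)
          + (2 * ENNReal.ofReal 0 + ENNReal.ofReal τ) * volume B)) := by
      have h0 : Tendsto ENNReal.ofReal (𝓝[>] 0) (𝓝 (ENNReal.ofReal 0)) :=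
        (ENNReal.continuous_ofReal.tendsto 0).mono_left nhdsWithin_le_nhds
      refine Tendsto.add ?_ ?_
      · exact ENNReal.Tendsto.const_mul ((ENNReal.Tendsto.const_mul h0 (Or.inr ofReal_ne_top)).add
          tendsto_const_nhds) (Or.inr ofReal_ne_top)
      · exact ENNReal.Tendsto.mul_const ((ENNReal.Tendsto.const_mul h0 (Or.inr (by simp))).add
          tendsto_const_nhds) (Or.inr hBt)
    have := ge_of_tendsto hlim (by
      filter_upwards [self_mem_nhdsWithin] with κ hκ'
      exact hκ κ hκ')
    simpa using this
  have hlim : Tendsto (fun τ : ℝ => ENNReal.ofReal r * (ε * volume B)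
      + ENNReal.ofReal τ * volume B) (𝓝[>] 0)
      (𝓝 (ENNReal.ofReal r * (ε * volume B) + ENNReal.ofReal 0 * volume B)) :=
    tendsto_const_nhds.add (ENNReal.Tendsto.mul_const
      ((ENNReal.continuous_ofReal.tendsto 0).mono_left nhdsWithin_le_nhds) (Or.inr hBt))
  have := ge_of_tendsto hlim (by
    filter_upwards [self_mem_nhdsWithin] with τ hτ
    exact hstep τ hτ)
  simpa [mul_assoc] using this

/-- Two points with bounded gradient averages satisfy a Lipschitz estimate. -/
theorem enorm_sub_le_of_averages {U : Set (En n)} (hU : IsOpen U) {f : En n → ℝ}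
    {g : En n → En n} (hf : ContinuousOn f U) (hg : IsWeakGradOn U f g) {x y : En n} {r₀ : ℝ}
    {ε : ℝ≥0∞} (hxU : closedBall x r₀ ⊆ U) (hyU : closedBall y r₀ ⊆ U)
    (hx : ∀ s ∈ Ioc 0 r₀, ∫⁻ z in closedBall x s, ‖g z‖ₑ ≤ ε * volume (closedBall x s))
    (hy : ∀ s ∈ Ioc 0 r₀, ∫⁻ z in closedBall y s, ‖g z‖ₑ ≤ ε * volume (closedBall y s))
    (hxy : 2 * dist x y ≤ r₀) :
    ‖f x - f y‖ₑ ≤ (1 + 2 * 2 ^ n) * ε * ENNReal.ofReal (dist x y) := by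
  rcases eq_or_ne x y with rfl | hne
  · simp
  set r := dist x y with hr
  have hr0 : 0 < r := dist_pos.2 hne
  have hB0 : volume (closedBall y r) ≠ 0 := (measure_closedBall_pos _ _ hr0).ne'
  have hBt : volume (closedBall y r) ≠ ⊤ := measure_closedBall_lt_top.ne
  have h1 := lintegral_closedBall_sub_center_le hU hf hg hr0
    ((closedBall_subset_closedBall (by linarith)).trans hyU)
    (fun s hs => hy s ⟨hs.1, hs.2.trans (by linarith)⟩)
  have h2 := lintegral_closedBall_sub_center_le hU hf hg (by positivity : 0 < 2 * r)
    ((closedBall_subset_closedBall hxy).trans hxU)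
    (fun s hs => hx s ⟨hs.1, hs.2.trans hxy⟩)
  have hsub : closedBall y r ⊆ closedBall x (2 * r) :=
    closedBall_subset_closedBall' (by rw [dist_comm y x]; linarith)
  have h3 : ‖f x - f y‖ₑ * volume (closedBall y r)
      ≤ (1 + 2 * 2 ^ n) * ε * ENNReal.ofReal r * volume (closedBall y r) := by
    calc ‖f x - f y‖ₑ * volume (closedBall y r)
        = ∫⁻ z in closedBall y r, ‖f x - f y‖ₑ := by
          rw [lintegral_const, Measure.restrict_apply_univ]
      _ ≤ ∫⁻ z in closedBall y r, (‖f z - f y‖ₑ + ‖f z - f x‖ₑ) := by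
          refine lintegral_mono fun z => ?_
          have e : f x - f y = (f z - f y) - (f z - f x) := by ring
          rw [e]; exact enorm_sub_le
      _ = (∫⁻ z in closedBall y r, ‖f z - f y‖ₑ) + ∫⁻ z in closedBall y r, ‖f z - f x‖ₑ := by
          refine lintegral_add_left' ?_ _
          exact (((hf.mono ((closedBall_subset_closedBall (by linarith)).trans hyU)).sub
            continuousOn_const).aestronglyMeasurable measurableSet_closedBall).enorm
      _ ≤ ENNReal.ofReal r * ε * volume (closedBall y r)
          + ENNReal.ofReal (2 * r) * ε * volume (closedBall x (2 * r)) :=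
          add_le_add h1 ((lintegral_mono_set hsub).trans h2)
      _ = _ := by
          rw [volume_closedBall_mul x y two_pos.le hr0.le, ENNReal.ofReal_mul two_pos.le,
            ENNReal.ofReal_pow two_pos.le]
          simp only [ENNReal.ofReal_ofNat]
          ring
  exact (ENNReal.mul_le_mul_iff_left hB0 hBt).1 h3

/-- Lebesgue differentiation on closed balls for locally integrable functions on an open set. -/
theorem ae_tendsto_lintegral_closedBall_div {U : Set (En n)} (hU : IsOpen U) {f : En n → ℝ≥0∞}
    (hf : Measurable f) (hloc : ∀ K ⊆ U, IsCompact K → ∫⁻ x in K, f x ≠ ⊤) :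
    ∀ᵐ x, x ∈ U → Tendsto (fun r => (∫⁻ y in closedBall x r, f y) / volume (closedBall x r))
      (𝓝[>] 0) (𝓝 (f x)) := by
  rw [ae_iff]
  refine measure_null_of_locally_null _ fun x₀ hx₀ => ?_
  simp only [Classical.not_imp, mem_ofPred_eq] at hx₀
  obtain ⟨r₀, hr₀, hr₀U⟩ := nhds_basis_closedBall.mem_iff.1 (hU.mem_nhds hx₀.1)
  set K := closedBall x₀ r₀
  refine ⟨_, inter_mem_nhdsWithin _ (ball_mem_nhds x₀ hr₀), ?_⟩
  have hfK : ∫⁻ x, K.indicator f x ≠ ⊤ := by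
    rw [lintegral_indicator measurableSet_closedBall]
    exact hloc K hr₀U (isCompact_closedBall _ _)
  have key := (Besicovitch.vitaliFamily (volume : Measure (En n))).ae_tendsto_lintegral_div
    (hf.indicator measurableSet_closedBall).aemeasurable hfK
  refine measure_mono_null ?_ (ae_iff.1 key)
  rintro x ⟨hx, hxb⟩ hlim
  simp only [Classical.not_imp, mem_ofPred_eq] at hx
  refine hx.2 ?_
  have h1 := hlim.comp (Besicovitch.tendsto_filterAt volume x)
  rw [indicator_of_mem (ball_subset_closedBall hxb)] at h1
  refine h1.congr' ?_
  obtain ⟨r₁, hr₁, hr₁K⟩ := nhds_basis_closedBall.mem_iff.1 (isOpen_ball.mem_nhds hxb)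
  filter_upwards [Ioc_mem_nhdsGT hr₁] with r hr
  simp only [Function.comp]
  congr 1
  refine setLIntegral_congr_fun measurableSet_closedBall fun y hy => ?_
  exact indicator_of_mem (ball_subset_closedBall (hr₁K (closedBall_subset_closedBall hr.2 hy))) _

end Pointwise

section WeakGradient

variable {n : ℕ}

theorem norm_le_sum_norm_apply (v : En n) : ‖v‖ ≤ ∑ i, ‖v i‖ := by
  rw [EuclideanSpace.norm_eq]
  refine Real.sqrt_le_iff.2 ⟨Finset.sum_nonneg fun i _ => norm_nonneg _, ?_⟩
  exact Finset.sum_sq_le_sq_sum_of_nonneg fun i _ => norm_nonneg _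

theorem isWeakGradOn_gradient {v : En n → ℝ} (hv : ContDiff ℝ 1 v) (U : Set (En n)) :
    IsWeakGradOn U v (gradient v) := by
  have hgc : Continuous (gradient v) :=
    (InnerProductSpace.toDual ℝ (En n)).symm.continuous.comp (hv.continuous_fderiv one_ne_zero)
  refine ⟨hv.continuous.locallyIntegrable.locallyIntegrableOn U,
    hgc.locallyIntegrable.locallyIntegrableOn U, fun η hη hηc hηU i => ?_⟩
  have hη1 : ContDiff ℝ 1 η := hη.of_le (by simp)
  have h1 : ∀ x ∉ U, v x * fderiv ℝ η x (EuclideanSpace.single i 1) = 0 := fun x hx => by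
    rw [fderiv_of_notMem_tsupport ℝ fun h => hx (hηU h)]; simp
  have h2 : ∀ x ∉ U, gradient v x i * η x = 0 := fun x hx => by
    rw [image_eq_zero_of_notMem_tsupport fun h => hx (hηU h)]; simp
  rw [setIntegral_eq_integral_of_forall_compl_eq_zero h1,
    setIntegral_eq_integral_of_forall_compl_eq_zero h2]
  simp_rw [gradient_apply]
  have hdη : Continuous fun x => fderiv ℝ η x (EuclideanSpace.single i 1) :=
    (hη1.continuous_fderiv one_ne_zero).clm_apply continuous_const
  have hdv : Continuous fun x => fderiv ℝ v x (EuclideanSpace.single i 1) :=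
    (hv.continuous_fderiv one_ne_zero).clm_apply continuous_const
  have hdηc : HasCompactSupport fun x => fderiv ℝ η x (EuclideanSpace.single i 1) :=
    hηc.fderiv_apply ℝ _
  refine integral_mul_fderiv_eq_neg_fderiv_mul_of_integrable ?_ ?_ ?_
    (fun x _ => hv.differentiable one_ne_zero x) fun x _ => hη1.differentiable one_ne_zero x
  · exact (hdv.mul hη.continuous).integrable_of_hasCompactSupport hηc.mul_left
  · exact (hv.continuous.mul hdη).integrable_of_hasCompactSupport hdηc.mul_left
  · exact (hv.continuous.mul hη.continuous).integrable_of_hasCompactSupport hηc.mul_left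

theorem locallyIntegrableOn_mul_integrable {U : Set (En n)} {f η : En n → ℝ}
    (hf : LocallyIntegrableOn f U) (hη : Continuous η) (hηc : HasCompactSupport η)
    (hηU : tsupport η ⊆ U) : IntegrableOn (fun x => f x * η x) U := by
  have h1 : IntegrableOn f (tsupport η) := hf.integrableOn_compact_subset hηU hηc
  obtain ⟨C, hC⟩ := hηc.exists_bound_of_continuous hη
  have h2 : IntegrableOn (fun x => f x * η x) (tsupport η) :=
    Integrable.mul_bdd h1 hη.aestronglyMeasurable (Eventually.of_forall hC)
  have h3 : Integrable ((tsupport η).indicator fun x => f x * η x) :=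
    (integrable_indicator_iff (isClosed_tsupport η).measurableSet).2 h2
  refine Integrable.integrableOn (h3.congr (Eventually.of_forall fun x => ?_))
  by_cases hx : x ∈ tsupport η
  · rw [indicator_of_mem hx]
  · rw [indicator_of_notMem hx]
    simp [image_eq_zero_of_notMem_tsupport hx]

theorem locallyIntegrableOn_apply {U : Set (En n)} {g : En n → En n}
    (hg : LocallyIntegrableOn g U) (i : Fin n) : LocallyIntegrableOn (fun x => g x i) U := by
  intro x hx
  obtain ⟨s, hs, hgs⟩ := hg x hx
  exact ⟨s, hs, (EuclideanSpace.proj i : En n →L[ℝ] ℝ).integrable_comp hgs⟩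

theorem IsWeakGradOn.sub {U : Set (En n)} {f₁ f₂ : En n → ℝ} {g₁ g₂ : En n → En n}
    (h₁ : IsWeakGradOn U f₁ g₁) (h₂ : IsWeakGradOn U f₂ g₂) :
    IsWeakGradOn U (fun x => f₁ x - f₂ x) fun x => g₁ x - g₂ x := by
  refine ⟨h₁.1.sub h₂.1, h₁.2.1.sub h₂.2.1, fun η hη hηc hηU i => ?_⟩
  have hη1 : ContDiff ℝ 1 η := hη.of_le (by simp)
  have hd : Continuous fun x => fderiv ℝ η x (EuclideanSpace.single i 1) :=
    (hη1.continuous_fderiv one_ne_zero).clm_apply continuous_const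
  have hdc : HasCompactSupport fun x => fderiv ℝ η x (EuclideanSpace.single i 1) :=
    hηc.fderiv_apply ℝ _
  have hds : tsupport (fun x => fderiv ℝ η x (EuclideanSpace.single i 1)) ⊆ U :=
    (tsupport_fderiv_apply_subset ℝ _).trans hηU
  simp only [PiLp.sub_apply, sub_mul]
  rw [integral_sub (locallyIntegrableOn_mul_integrable h₁.1 hd hdc hds)
      (locallyIntegrableOn_mul_integrable h₂.1 hd hdc hds),
    integral_sub
      (locallyIntegrableOn_mul_integrable (locallyIntegrableOn_apply h₁.2.1 i) hη.continuous hηc hηU)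
      (locallyIntegrableOn_mul_integrable (locallyIntegrableOn_apply h₂.2.1 i) hη.continuous hηc hηU),
    h₁.2.2 η hη hηc hηU i, h₂.2.2 η hη hηc hηU i]
  ring

theorem IsWeakGradOn.mono {U V : Set (En n)} (hVU : V ⊆ U) {f : En n → ℝ} {g : En n → En n}
    (h : IsWeakGradOn U f g) : IsWeakGradOn V f g := by
  refine ⟨h.1.mono_set hVU, h.2.1.mono_set hVU, fun η hη hηc hηV i => ?_⟩
  have := h.2.2 η hη hηc (hηV.trans hVU) i
  have h1 : ∀ x ∉ V, f x * fderiv ℝ η x (EuclideanSpace.single i 1) = 0 := fun x hx => by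
    rw [fderiv_of_notMem_tsupport ℝ fun h => hx (hηV h)]; simp
  have h2 : ∀ x ∉ V, g x i * η x = 0 := fun x hx => by
    rw [image_eq_zero_of_notMem_tsupport fun h => hx (hηV h)]; simp
  rw [setIntegral_eq_integral_of_forall_compl_eq_zero h1,
    setIntegral_eq_integral_of_forall_compl_eq_zero h2]
  rwa [setIntegral_eq_integral_of_forall_compl_eq_zero fun x hx => h1 x fun h => hx (hVU h),
    setIntegral_eq_integral_of_forall_compl_eq_zero fun x hx => h2 x fun h => hx (hVU h)] at this

theorem gradient_inner_left (a x : En n) : gradient (fun y => inner ℝ a y) x = a := by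
  refine HasGradientAt.gradient ?_
  rw [hasGradientAt_iff_hasFDerivAt]
  exact (innerSL ℝ a).hasFDerivAt

theorem det_toEuclideanCLM (A : Matrix (Fin n) (Fin n) ℝ) :
    (Matrix.toEuclideanCLM (𝕜 := ℝ) A).det = A.det := by
  rw [ContinuousLinearMap.det, Matrix.coe_toEuclideanCLM_eq_toEuclideanLin]
  rw [Matrix.toEuclideanLin_eq_toLin_orthonormal, LinearMap.det_toLin]

theorem toEuclideanCLM_apply_eq_inner (A : Matrix (Fin n) (Fin n) ℝ) (x : En n) (i : Fin n) :
    Matrix.toEuclideanCLM (𝕜 := ℝ) A x i = inner ℝ (rowVec A i) x := by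
  rw [Matrix.ofLp_toEuclideanCLM, Matrix.mulVec, dotProduct, PiLp.inner_apply]
  refine Finset.sum_congr rfl fun j _ => ?_
  simp [rowVec_apply, mul_comm]

end WeakGradient

namespace SobolevHomeo

variable {n : ℕ} {q : ℝ} {U U' : Set (En n)} {φ ψ : En n → En n}
  {M : En n → Matrix (Fin n) (Fin n) ℝ}

/-- Points whose Jacobi matrix is, on average over all small balls, within `ε` of `A`. -/
def nearSet (U : Set (En n)) (M : En n → Matrix (Fin n) (Fin n) ℝ) (A : Matrix (Fin n) (Fin n) ℝ)
    (ε : ℝ≥0∞) (r : ℝ) : Set (En n) :=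
  {x | closedBall x r ⊆ U ∧ ∀ i, ∀ s ∈ Ioc 0 r,
    ∫⁻ z in closedBall x s, ‖rowVec (M z) i - rowVec A i‖ₑ ≤ ε * volume (closedBall x s)}

theorem approximatesLinearOn_nearSet (h : SobolevHomeo q U U' φ ψ M)
    (A : Matrix (Fin n) (Fin n) ℝ) {δ : NNReal} {ε : ℝ≥0∞} (hε : n * ((1 + 2 * 2 ^ n) * ε) ≤ δ) {r : ℝ}
    {S : Set (En n)} (hS : S ⊆ nearSet U M A ε r) (hSr : ∀ x ∈ S, ∀ y ∈ S, 2 * dist x y ≤ r) :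
    ApproximatesLinearOn φ (Matrix.toEuclideanCLM (𝕜 := ℝ) A) S δ := by
  intro x hx y hy
  have hcont : ∀ i, ContinuousOn (fun x => φ x i - inner ℝ (rowVec A i) x) U := fun i =>
    ((EuclideanSpace.proj i : En n →L[ℝ] ℝ).continuous.comp_continuousOn h.homeo.1).sub (by fun_prop)
  have hweak : ∀ i, IsWeakGradOn U (fun x => φ x i - inner ℝ (rowVec A i) x)
      fun x => rowVec (M x) i - rowVec A i := fun i => by
    have h1 := isWeakGradOn_gradient (v := fun x : En n => inner ℝ (rowVec A i) x)
      (innerSL ℝ (rowVec A i)).contDiff U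
    have h2 := (h.jacobi i).sub h1
    simp only [gradient_inner_left] at h2
    exact h2
  have hcomp : ∀ i, ‖(φ x - φ y - Matrix.toEuclideanCLM (𝕜 := ℝ) A (x - y)) i‖ₑ
      ≤ (1 + 2 * 2 ^ n) * ε * ENNReal.ofReal (dist x y) := fun i => by
    have := enorm_sub_le_of_averages h.isOpen (hcont i) (hweak i) (hS hx).1 (hS hy).1
      ((hS hx).2 i) ((hS hy).2 i) (hSr x hx y hy)
    convert this using 2
    rw [PiLp.sub_apply, PiLp.sub_apply, toEuclideanCLM_apply_eq_inner, inner_sub_right]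
    ring
  have hfin : ‖φ x - φ y - Matrix.toEuclideanCLM (𝕜 := ℝ) A (x - y)‖ₑ ≤ δ * ‖x - y‖ₑ := by
    set v := φ x - φ y - Matrix.toEuclideanCLM (𝕜 := ℝ) A (x - y)
    calc ‖v‖ₑ ≤ ∑ i, ‖v i‖ₑ := by
          have := ENNReal.ofReal_le_ofReal (norm_le_sum_norm_apply v)
          rw [ENNReal.ofReal_sum_of_nonneg fun i _ => norm_nonneg _] at this
          simpa only [ofReal_norm] using this
      _ ≤ ∑ _i : Fin n, (1 + 2 * 2 ^ n) * ε * ENNReal.ofReal (dist x y) :=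
          Finset.sum_le_sum fun i _ => hcomp i
      _ = n * ((1 + 2 * 2 ^ n) * ε) * ENNReal.ofReal (dist x y) := by
          rw [Finset.sum_const, Finset.card_univ, Fintype.card_fin, nsmul_eq_mul]
          ring
      _ ≤ δ * ‖x - y‖ₑ := by
          rw [dist_eq_norm, ofReal_norm]
          gcongr
  rw [← ofReal_norm, ← ofReal_norm, ← ENNReal.ofReal_coe_nnreal,
    ← ENNReal.ofReal_mul NNReal.zero_le_coe] at hfin
  exact (ENNReal.ofReal_le_ofReal_iff (by positivity)).1 hfin

/-- The Jacobian vanishes almost everywhere on the preimage of a null set. -/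
theorem ae_det_eq_zero (h : SobolevHomeo q U U' φ ψ M) {N : Set (En n)} (hN : N ⊆ U)
    (hφN : volume (φ '' N) = 0) : ∀ᵐ x, x ∈ N → (M x).det = 0 := by
  -- a good scale for each invertible matrix
  have hgood : ∀ A : {A : Matrix (Fin n) (Fin n) ℝ // A.det ≠ 0}, ∃ ε : ℝ, 0 < ε ∧
      ∀ r : ℝ, 0 < r → volume (N ∩ nearSet U M A (ENNReal.ofReal ε) r) = 0 := by
    rintro ⟨A, hA⟩
    set A' := Matrix.toEuclideanCLM (𝕜 := ℝ) A
    have hdet : ((‖A.det‖₊ / 2 : NNReal) : ℝ≥0∞) < ENNReal.ofReal |A'.det| := by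
      rw [det_toEuclideanCLM, ← Real.norm_eq_abs, ofReal_norm, enorm_eq_nnnorm]
      exact_mod_cast NNReal.half_lt_self (by simpa using hA)
    have hev := (mul_le_addHaar_image_of_lt_det volume A' hdet).and self_mem_nhdsWithin
    obtain ⟨δ, hδ, hδ0⟩ := hev.exists
    have hδ0 : 0 < δ := hδ0
    refine ⟨δ / ((n + 1) * (1 + 2 * 2 ^ n)), by positivity, fun r hr => ?_⟩
    have hε : (n : ℝ≥0∞) * ((1 + 2 * 2 ^ n) *
        ENNReal.ofReal (δ / ((n + 1) * (1 + 2 * 2 ^ n)))) ≤ δ := by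
      have e : (n : ℝ≥0∞) * ((1 + 2 * 2 ^ n) * ENNReal.ofReal (δ / ((n + 1) * (1 + 2 * 2 ^ n))))
          = ENNReal.ofReal (n * ((1 + 2 * 2 ^ n) * (δ / ((n + 1) * (1 + 2 * 2 ^ n))))) := by
        rw [ENNReal.ofReal_mul (by positivity), ENNReal.ofReal_mul (by positivity),
          ENNReal.ofReal_natCast, ENNReal.ofReal_add (by positivity) (by positivity),
          ENNReal.ofReal_mul (by positivity), ENNReal.ofReal_pow (by positivity)]
        simp
      rw [e, ← ENNReal.ofReal_coe_nnreal]
      refine ENNReal.ofReal_le_ofReal ?_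
      have : (n : ℝ) * ((1 + 2 * 2 ^ n) * (δ / ((n + 1) * (1 + 2 * 2 ^ n)))) = n / (n + 1) * δ := by
        field_simp
      rw [this]
      refine mul_le_of_le_one_left (by positivity) ?_
      rw [div_le_one (by positivity)]; linarith
    refine measure_null_of_locally_null _ fun x _ => ?_
    refine ⟨_, inter_mem_nhdsWithin _ (ball_mem_nhds x (show 0 < r / 4 by positivity)), ?_⟩
    set S := N ∩ nearSet U M A (ENNReal.ofReal (δ / ((n + 1) * (1 + 2 * 2 ^ n)))) r ∩ ball x (r / 4)
    have hap : ApproximatesLinearOn φ A' S δ := by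
      refine h.approximatesLinearOn_nearSet A hε (fun y hy => hy.1.2) fun y hy z hz => ?_
      have h1 : dist y x < r / 4 := hy.2
      have h2 : dist z x < r / 4 := hz.2
      have := dist_triangle_right y z x
      linarith
    have h1 := hδ S φ hap
    have h2 : volume (φ '' S) = 0 := measure_mono_null (image_mono fun y hy => hy.1.1) hφN
    rw [h2, nonpos_iff_eq_zero, mul_eq_zero] at h1
    refine h1.resolve_left ?_
    simpa using hA
  choose ε hε hnull using hgood
  -- countably many of the corresponding neighbourhoods cover the invertible matrices
  obtain ⟨T, hT, hTU⟩ := TopologicalSpace.isOpen_iUnion_countable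
    (fun A : {A : Matrix (Fin n) (Fin n) ℝ // A.det ≠ 0} =>
      {B : Fin n → Fin n → ℝ | ∀ i, ‖rowVec (Matrix.of B) i - rowVec A i‖ < ε A}) fun A => by
    rw [ofPred_forall]
    refine isOpen_iInter_of_finite fun i => isOpen_lt ?_ continuous_const
    refine (Continuous.sub ?_ continuous_const).norm
    exact (EuclideanSpace.equiv (Fin n) ℝ).symm.continuous.comp (continuous_apply i)
  have hleb : ∀ A ∈ T, ∀ᵐ x, ∀ i : Fin n, x ∈ U →
      Tendsto (fun r => (∫⁻ y in closedBall x r, ‖rowVec (M y) i - rowVec A.1 i‖ₑ)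
        / volume (closedBall x r)) (𝓝[>] 0) (𝓝 ‖rowVec (M x) i - rowVec A.1 i‖ₑ) := by
    intro A _
    refine ae_all_iff.2 fun i => ae_tendsto_lintegral_closedBall_div h.isOpen
      ((h.meas i).sub_const _).enorm fun K hKU hK => ?_
    have hi := ((h.jacobi i).2.1.integrableOn_compact_subset hKU hK)
    exact (hi.sub (integrableOn_const hK.measure_ne_top (C := rowVec A.1 i))).2.ne
  have hz : ∀ A ∈ T, ∀ᵐ x, ∀ k : ℕ,
      x ∉ N ∩ nearSet U M A.1 (ENNReal.ofReal (ε A)) (1 / (k + 1)) := fun A _ =>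
    ae_all_iff.2 fun k => measure_eq_zero_iff_ae_notMem.1 (hnull A _ (by positivity))
  filter_upwards [(ae_ball_iff hT).2 hleb, (ae_ball_iff hT).2 hz] with x hx1 hx2 hxN
  by_contra hdet
  have hxU := hN hxN
  have hmem : (M x : Fin n → Fin n → ℝ) ∈ ⋃ A : {A : Matrix (Fin n) (Fin n) ℝ // A.det ≠ 0},
      {B : Fin n → Fin n → ℝ | ∀ i, ‖rowVec (Matrix.of B) i - rowVec A i‖ < ε A} := by
    refine mem_iUnion.2 ⟨⟨M x, hdet⟩, fun i => ?_⟩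
    have : rowVec (Matrix.of (M x)) i - rowVec (M x) i = 0 := sub_self _
    rw [this, norm_zero]
    exact hε _
  rw [← hTU] at hmem
  obtain ⟨A, hAT, hA⟩ := mem_iUnion₂.1 hmem
  have hev : ∀ᶠ r in 𝓝[>] (0 : ℝ), closedBall x r ⊆ U ∧ ∀ i : Fin n,
      (∫⁻ y in closedBall x r, ‖rowVec (M y) i - rowVec A.1 i‖ₑ)
        / volume (closedBall x r) < ENNReal.ofReal (ε A) := by
    refine Eventually.and ?_ (eventually_all.2 fun i => ?_)
    · obtain ⟨r, hr, hrU⟩ := nhds_basis_closedBall.mem_iff.1 (h.isOpen.mem_nhds hxU)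
      filter_upwards [Ioc_mem_nhdsGT hr] with s hs
      exact (closedBall_subset_closedBall hs.2).trans hrU
    · refine (hx1 A hAT i hxU).eventually_lt_const ?_
      rw [← ofReal_norm]
      exact (ENNReal.ofReal_lt_ofReal_iff (hε A)).2 (hA i)
  obtain ⟨r, hr, hrs⟩ := (mem_nhdsGT_iff_exists_Ioc_subset).1 hev
  obtain ⟨k, hk⟩ := exists_nat_one_div_lt (show 0 < r from hr)
  refine hx2 A hAT k ⟨hxN, (hrs ⟨by positivity, hk.le⟩).1, fun i s hs => ?_⟩
  have := (hrs ⟨hs.1, hs.2.trans hk.le⟩).2 i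
  rw [ENNReal.div_lt_iff (Or.inl (measure_closedBall_pos _ _ hs.1).ne')
    (Or.inl measure_closedBall_lt_top.ne)] at this
  exact this.le

theorem pushMeasure_absolutelyContinuous (h : SobolevHomeo q U U' φ ψ M) (hn : 2 ≤ n)
    (hFD : ∀ᵐ x, x ∈ U → (M x).det = 0 → M x = 0) : pushMeasure U φ M ≪ volume := by
  have hn' : (2 : ℝ) ≤ n := by exact_mod_cast hn
  refine Measure.AbsolutelyContinuous.mk fun E hE hE0 => ?_
  rw [h.pushMeasure_apply hE, setLIntegral_eq_zero_iff (h.measurableSet_inter_preimage hE)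
    (h.measurable_ofReal_opNorm.pow_const _)]
  have := h.ae_det_eq_zero (N := U ∩ φ ⁻¹' E) inter_subset_left
    (measure_mono_null (by rintro _ ⟨x, hx, rfl⟩; exact hx.2) hE0)
  filter_upwards [this, hFD] with x h1 h2 hx
  have h3 : opNorm (M x) = 0 := by rw [h2 hx.1 (h1 hx)]; simp [opNorm]
  rw [h3, ENNReal.ofReal_zero, ENNReal.zero_rpow_of_pos (by linarith)]

end SobolevHomeo

section Riesz

variable {n : ℕ}

/-- A linear functional dominated by the norm of a linear map into a Hilbert space is represented
by a vector of that space. -/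
theorem exists_inner_eq_of_abs_le {E H : Type*} [AddCommGroup E] [Module ℝ E]
    [NormedAddCommGroup H] [InnerProductSpace ℝ H] [CompleteSpace H] (T : E →ₗ[ℝ] H)
    (l : E →ₗ[ℝ] ℝ) (C : ℝ) (hl : ∀ v, |l v| ≤ C * ‖T v‖) : ∃ g : H, ∀ v, l v = inner ℝ g (T v) := by
  obtain ⟨s, hs⟩ := T.rangeRestrict.exists_rightInverse_of_surjective T.range_rangeRestrict
  have hTs : ∀ w : LinearMap.range T, T (s w) = w := fun w => by
    have := congrArg (fun f : LinearMap.range T →ₗ[ℝ] LinearMap.range T => ((f w : LinearMap.range T) : H)) hs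
    simpa using this
  have hker : ∀ v, T v = 0 → l v = 0 := fun v hv => by
    have := hl v
    rw [hv, norm_zero, mul_zero] at this
    exact abs_eq_zero.1 (le_antisymm this (abs_nonneg _))
  have hls : ∀ v, l (s (T.rangeRestrict v)) = l v := fun v => by
    rw [← sub_eq_zero, ← map_sub]
    refine hker _ ?_
    rw [map_sub, hTs, sub_eq_zero]
    rfl
  obtain ⟨F, hF, -⟩ := exists_extension_norm_eq (LinearMap.range T)
    ((l.comp s).mkContinuous C fun w => by
      have := hl (s w)
      rw [hTs] at this
      exact this)
  refine ⟨(InnerProductSpace.toDual ℝ H).symm F, fun v => ?_⟩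
  rw [InnerProductSpace.toDual_symm_apply]
  have := (hF (T.rangeRestrict v)).trans (hls v)
  exact this.symm

/-- Pointwise comparison from comparison against test functions. -/
theorem ae_abs_le_of_forall_abs_integral_le {V : Set (En n)} (hV : IsOpen V) {k b : En n → ℝ}
    (hk : LocallyIntegrableOn k V) (hb : LocallyIntegrableOn b V)
    (hkb : ∀ η : En n → ℝ, ContDiff ℝ ∞ η → HasCompactSupport η → tsupport η ⊆ V →
      |∫ x in V, k x * η x| ≤ ∫ x in V, b x * |η x|) :
    ∀ᵐ x, x ∈ V → |k x| ≤ b x := by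
  refine measure_null_of_locally_null _ fun x₀ hx₀ => ?_
  have hx₀V : x₀ ∈ V := by
    by_contra h
    exact hx₀ fun h' => (h h').elim
  obtain ⟨r, hr, hrV⟩ := nhds_basis_closedBall.mem_iff.1 (hV.mem_nhds hx₀V)
  refine ⟨_, inter_mem_nhdsWithin _ (ball_mem_nhds x₀ (half_pos hr)), ?_⟩
  set B := closedBall x₀ r
  have hBc : IsCompact B := isCompact_closedBall x₀ r
  have hkB : Integrable (B.indicator k) :=
    (integrable_indicator_iff hBc.measurableSet).2 (hk.integrableOn_compact_subset hrV hBc)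
  have hbB : Integrable (B.indicator b) :=
    (integrable_indicator_iff hBc.measurableSet).2 (hb.integrableOn_compact_subset hrV hBc)
  let β : ℕ → ContDiffBump (0 : En n) := fun i =>
    ⟨r / 4 * (1 / ((i : ℝ) + 1)), r / 2 * (1 / ((i : ℝ) + 1)), by positivity, by
      have : 0 < r * (1 / ((i : ℝ) + 1)) := by positivity
      linarith⟩
  have hβ : Tendsto (fun i => (β i).rOut) atTop (𝓝 0) := by
    have := (tendsto_one_div_add_atTop_nhds_zero_nat (𝕜 := ℝ)).const_mul (r / 2)
    rw [mul_zero] at this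
    exact this
  have hβ2 : ∀ᶠ i in atTop, (β i).rOut ≤ 2 * (β i).rIn := Eventually.of_forall fun i => by
    show r / 2 * (1 / ((i : ℝ) + 1)) ≤ 2 * (r / 4 * (1 / ((i : ℝ) + 1)))
    linarith
  have hk1 := ContDiffBump.ae_convolution_tendsto_right_of_locallyIntegrable hβ hβ2
    hkB.locallyIntegrable
  have hb1 := ContDiffBump.ae_convolution_tendsto_right_of_locallyIntegrable hβ hβ2
    hbB.locallyIntegrable
  have key : ∀ᵐ x, x ∈ ball x₀ (r / 2) → |k x| ≤ b x := by
    filter_upwards [hk1, hb1] with x hx1 hx2 hx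
    have hxB : x ∈ B := ball_subset_closedBall (ball_subset_ball (half_le_self hr.le) hx)
    rw [indicator_of_mem hxB] at hx1 hx2
    refine le_of_tendsto_of_tendsto' hx1.abs hx2 fun i => ?_
    set η : En n → ℝ := fun y => (β i).normed volume (x - y)
    have hηs : Function.support η ⊆ ball x (r / 2) := fun y hy => by
      have : x - y ∈ Function.support ((β i).normed volume) := hy
      rw [ContDiffBump.support_normed_eq, mem_ball_zero_iff, ← dist_eq_norm, dist_comm] at this
      refine mem_ball.2 (this.trans_le ?_)
      show r / 2 * (1 / ((i : ℝ) + 1)) ≤ r / 2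
      refine mul_le_of_le_one_right (by positivity) ?_
      rw [div_le_one (by positivity)]
      have : (0 : ℝ) ≤ i := Nat.cast_nonneg i
      linarith
    have hηt : tsupport η ⊆ B := by
      refine closure_minimal (hηs.trans fun y hy => ?_) isClosed_closedBall
      have h1 : dist y x < r / 2 := hy
      have h2 : dist x x₀ < r / 2 := hx
      exact mem_closedBall.2 ((dist_triangle y x x₀).trans (by linarith))
    have hηsm : ContDiff ℝ ∞ η := (β i).contDiff_normed.comp (contDiff_const.sub contDiff_id)
    have hηc : HasCompactSupport η := hBc.of_isClosed_subset (isClosed_tsupport _) hηt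
    have hη0 : ∀ y, 0 ≤ η y := fun y => (β i).nonneg_normed _
    have hconv : ∀ f : En n → ℝ,
        ((β i).normed volume ⋆[ContinuousLinearMap.lsmul ℝ ℝ, volume] B.indicator f) x
          = ∫ y in V, f y * η y := fun f => by
      have h0 : ∀ y ∉ V, f y * η y = 0 := fun y hy => by
        rw [image_eq_zero_of_notMem_tsupport fun h => hy (hrV (hηt h)), mul_zero]
      rw [setIntegral_eq_integral_of_forall_compl_eq_zero h0, convolution_eq_swap]
      refine integral_congr_ae (Eventually.of_forall fun y => ?_)
      show η y * B.indicator f y = f y * η y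
      by_cases hy : y ∈ B
      · rw [indicator_of_mem hy, mul_comm]
      · rw [image_eq_zero_of_notMem_tsupport fun h => hy (hηt h), mul_zero, zero_mul]
    rw [hconv, hconv]
    have := hkb η hηsm hηc (hηt.trans hrV)
    simpa only [abs_of_nonneg (hη0 _)] using this
  refine measure_mono_null ?_ key
  rintro x ⟨hx1, hx2⟩ hx3
  exact hx1 fun _ => hx3 hx2

/-- Smooth functions with compact support in `V`. -/
def testFunctions (V : Set (En n)) : Submodule ℝ (En n → ℝ) where
  carrier := {η | ContDiff ℝ ∞ η ∧ HasCompactSupport η ∧ tsupport η ⊆ V}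
  add_mem' := fun {a b} ha hb => ⟨ha.1.add hb.1, ha.2.1.add hb.2.1,
    (tsupport_add a b).trans (union_subset ha.2.2 hb.2.2)⟩
  zero_mem' := ⟨contDiff_const, HasCompactSupport.zero, by simp [tsupport]⟩
  smul_mem' := fun c a ha => ⟨contDiff_const.smul ha.1, ha.2.1.smul_left (f := fun _ => c),
    (tsupport_smul_subset_right (fun _ => c) a).trans ha.2.2⟩

/-- A functional on test functions dominated by an absolutely continuous measure `ρ dx` is given by
integration against a function dominated by `ρ`. -/
theorem exists_density_of_abs_le {V : Set (En n)} (hV : IsOpen V) {ρ θ : En n → ℝ}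
    (hρ0 : ∀ x, 0 ≤ ρ x) (hρV : LocallyIntegrableOn ρ V)
    (hθ : ContinuousOn θ V) (hθ0 : ∀ x ∈ V, 0 < θ x) (hθρ : IntegrableOn (fun x => θ x * ρ x) V)
    (l : testFunctions V →ₗ[ℝ] ℝ) {C : ℝ} (hC : 0 ≤ C)
    (hl : ∀ η : testFunctions V, |l η| ≤ C * ∫ x in V, |(η : En n → ℝ) x| * ρ x) :
    ∃ k : En n → ℝ, LocallyIntegrableOn k V ∧ (∀ᵐ x, x ∈ V → |k x| ≤ C * ρ x) ∧
      ∀ η : testFunctions V, l η = ∫ x in V, k x * (η : En n → ℝ) x := by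
  set f : En n → NNReal := fun x => (θ x * ρ x).toNNReal with hf
  have hθm : AEMeasurable θ (volume.restrict V) := hθ.aemeasurable hV.measurableSet
  have hfm : AEMeasurable f (volume.restrict V) := hθρ.aemeasurable.real_toNNReal
  have hfx : ∀ x ∈ V, (f x : ℝ) = θ x * ρ x := fun x hx =>
    Real.coe_toNNReal _ (mul_nonneg (hθ0 x hx).le (hρ0 x))
  set ν : Measure (En n) := (volume.restrict V).withDensity fun x => (f x : ℝ≥0∞) with hν
  have hνfin : IsFiniteMeasure ν := isFiniteMeasure_withDensity_ofReal hθρ.2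
  have hac : ν ≪ volume.restrict V := withDensity_absolutelyContinuous _ _
  -- test functions divided by the weight are bounded
  have hmem : ∀ η : testFunctions V, MemLp (fun x => (η : En n → ℝ) x / θ x) 2 ν := by
    rintro ⟨η, hη, hηc, hηV⟩
    have hmeas : AEStronglyMeasurable (fun x => η x / θ x) ν :=
      ((hη.continuous.measurable.aemeasurable.div hθm).mono_ac hac).aestronglyMeasurable
    have hcont : ContinuousOn (fun x => η x / θ x) (tsupport η) :=
      hη.continuous.continuousOn.div (hθ.mono hηV) fun x hx => (hθ0 x (hηV hx)).ne'
    obtain ⟨B, hB⟩ := hηc.isCompact.exists_bound_of_continuousOn hcont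
    refine MemLp.of_bound hmeas (max B 0) (Eventually.of_forall fun x => ?_)
    by_cases hx : x ∈ tsupport η
    · exact (hB x hx).trans (le_max_left _ _)
    · show ‖η x / θ x‖ ≤ _
      rw [image_eq_zero_of_notMem_tsupport hx, zero_div, norm_zero]
      exact le_max_right _ _
  let T : testFunctions V →ₗ[ℝ] Lp ℝ 2 ν :=
    { toFun := fun η => (hmem η).toLp _
      map_add' := fun a b => by
        rw [← MemLp.toLp_add]
        refine MemLp.toLp_congr _ _ (Eventually.of_forall fun x => ?_)
        simp [add_div]
      map_smul' := fun c a => by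
        rw [RingHom.id_apply, ← MemLp.toLp_const_smul]
        refine MemLp.toLp_congr _ _ (Eventually.of_forall fun x => ?_)
        simp [mul_div_assoc] }
  have hint : ∀ F : En n → ℝ, ∫ x, F x ∂ν = ∫ x in V, θ x * ρ x * F x := fun F => by
    rw [hν, integral_withDensity_eq_integral_smul₀ hfm]
    refine setIntegral_congr_fun hV.measurableSet fun x hx => ?_
    show (f x : ℝ) * F x = _
    rw [hfx x hx]
  have hTbound : ∀ η, |l η| ≤ C * (ν.real univ) ^ (1 / 2 : ℝ) * ‖T η‖ := fun η => by
    refine (hl η).trans ?_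
    rw [mul_assoc]
    refine mul_le_mul_of_nonneg_left ?_ hC
    have h1 : ∫ x in V, |(η : En n → ℝ) x| * ρ x = ∫ x, |(η : En n → ℝ) x / θ x| ∂ν := by
      rw [hint]
      refine setIntegral_congr_fun hV.measurableSet fun x hx => ?_
      have := hθ0 x hx
      simp only [abs_div, abs_of_pos this]
      field_simp
    have h2 : ∫ x, |(η : En n → ℝ) x / θ x| ∂ν
        = (eLpNorm (fun x => (η : En n → ℝ) x / θ x) 1 ν).toReal := by
      rw [eLpNorm_one_eq_lintegral_enorm, ← integral_norm_eq_lintegral_enorm (hmem η).1]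
      rfl
    rw [h1, h2]
    have h3 : ‖T η‖ = (eLpNorm (fun x => (η : En n → ℝ) x / θ x) 2 ν).toReal :=
      Lp.norm_toLp _ (hmem η)
    rw [h3, Measure.real, ENNReal.toReal_rpow, ← ENNReal.toReal_mul, mul_comm (_ ^ _)]
    refine ENNReal.toReal_mono (ENNReal.mul_ne_top (hmem η).2.ne
      (ENNReal.rpow_ne_top_of_nonneg (by norm_num) (measure_ne_top ν univ))) ?_
    have := eLpNorm_le_eLpNorm_mul_rpow_measure_univ (p := 1) (q := 2) (by norm_num) (hmem η).1
    convert this using 3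
    norm_num
  obtain ⟨g, hg⟩ := exists_inner_eq_of_abs_le T l _ hTbound
  have hgm : Measurable g := (Lp.stronglyMeasurable g).measurable
  have hgint : Integrable g ν := (Lp.memLp g).integrable (by norm_num)
  have hgV : IntegrableOn (fun x => θ x * ρ x * g x) V := by
    have := (integrable_withDensity_iff_integrable_smul₀ hfm).1 hgint
    refine (integrableOn_congr_fun (fun x hx => ?_) hV.measurableSet).1 this
    show (f x : ℝ) * g x = _
    rw [hfx x hx]
  have hrep : ∀ η : testFunctions V, l η = ∫ x in V, g x * ρ x * (η : En n → ℝ) x := fun η => by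
    rw [hg, L2.inner_def]
    have : ∫ x, inner ℝ (g x) (T η x) ∂ν = ∫ x, g x * ((η : En n → ℝ) x / θ x) ∂ν := by
      refine integral_congr_ae ?_
      filter_upwards [(hmem η).coeFn_toLp] with x hx
      have hx : T η x = (η : En n → ℝ) x / θ x := hx
      rw [hx, real_inner_eq_re_inner]
      simp [mul_comm]
    rw [this, hint]
    refine setIntegral_congr_fun hV.measurableSet fun x hx => ?_
    have := hθ0 x hx
    field_simp
  have hkV : LocallyIntegrableOn (fun x => g x * ρ x) V := by
    rw [locallyIntegrableOn_iff hV.isLocallyClosed]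
    intro K hK hKc
    have hcont : ContinuousOn (fun x => (θ x)⁻¹) K :=
      (hθ.mono hK).inv₀ fun x hx => (hθ0 x (hK hx)).ne'
    have := (hgV.mono_set hK).continuousOn_mul hcont hKc
    refine (integrableOn_congr_fun (fun x hx => ?_) hKc.measurableSet).1 this
    have := hθ0 x (hK hx)
    field_simp
  refine ⟨_, hkV, ?_, hrep⟩
  refine ae_abs_le_of_forall_abs_integral_le hV hkV ?_ fun η h1 h2 h3 => ?_
  · exact fun x hx => (hρV x hx).imp fun s hs => ⟨hs.1, hs.2.const_mul C⟩
  · rw [← hrep ⟨η, h1, h2, h3⟩]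
    refine (hl _).trans (le_of_eq ?_)
    rw [← integral_const_mul]
    exact integral_congr_ae (Eventually.of_forall fun x => by simp only []; ring)

end Riesz

namespace SobolevHomeo

section Inverse

variable {m : ℕ} {q : ℝ} {U U' : Set (En (m + 1))} {φ ψ : En (m + 1) → En (m + 1)}
  {M : En (m + 1) → Matrix (Fin (m + 1)) (Fin (m + 1)) ℝ}

theorem lintegral_comp_inverse_pushMeasure (h : SobolevHomeo q U U' φ ψ M)
    {F : En (m + 1) → ℝ≥0∞} (hF : Measurable F) :
    ∫⁻ y in U', F (ψ y) ∂(pushMeasure U φ M)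
      = ∫⁻ x in U, ENNReal.ofReal (opNorm (M x)) ^ (m : ℝ) * F x := by
  classical
  have hψ : Measurable (U'.piecewise ψ fun _ => 0) :=
    h.homeo.2.1.measurable_piecewise continuousOn_const h.isOpen'.measurableSet
  have hF' : Measurable fun y => F (U'.piecewise ψ (fun _ => 0) y) := hF.comp hψ
  have h1 : ∫⁻ y in U', F (ψ y) ∂(pushMeasure U φ M)
      = ∫⁻ y, U'.indicator (fun y => F (U'.piecewise ψ (fun _ => 0) y)) y ∂(pushMeasure U φ M) := by
    rw [lintegral_indicator h.isOpen'.measurableSet]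
    exact setLIntegral_congr_fun h.isOpen'.measurableSet fun y hy => by
      simp only [piecewise_eq_of_mem _ _ _ hy]
  rw [h1, h.lintegral_pushMeasure (hF'.indicator h.isOpen'.measurableSet)]
  refine setLIntegral_congr_fun h.isOpen.measurableSet fun x hx => ?_
  have hx' := h.homeo.2.2.1 hx
  simp only [indicator_of_mem hx', piecewise_eq_of_mem _ _ _ hx', h.homeo.2.2.2.2.1 x hx]
  push_cast
  rw [add_sub_cancel_right]

/-- The inverse of a Sobolev homeomorphism of finite distortion is weakly differentiable, and its
derivative is dominated by the density of the push-forward measure. -/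
theorem exists_jacobi_inverse (h : SobolevHomeo q U U' φ ψ M) (hm : 1 ≤ m) (hq : (m : ℝ) < q)
    (hFD : ∀ᵐ x, x ∈ U → (M x).det = 0 → M x = 0) {W : En (m + 1) → ℝ} (hW : ContinuousOn W U)
    (hW0 : ∀ x ∈ U, 0 < W x) (hWm : Measurable W)
    (hWint : ∫⁻ x in U, ENNReal.ofReal (opNorm (M x)) ^ (m : ℝ) * ENNReal.ofReal (W x) ≠ ⊤) :
    ∃ (ρ : En (m + 1) → ℝ) (C : ℝ) (D : En (m + 1) → Matrix (Fin (m + 1)) (Fin (m + 1)) ℝ),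
      Measurable ρ ∧ (∀ y, 0 ≤ ρ y) ∧ 0 ≤ C ∧ IsWeakJacobiOn U' ψ D ∧
      (∀ᵐ y, y ∈ U' → ∀ i j, |D y i j| ≤ C * ρ y) ∧
      ∀ F : En (m + 1) → ℝ≥0∞, Measurable F → ∫⁻ y in U', F (ψ y) * ENNReal.ofReal (ρ y)
        ≤ ∫⁻ x in U, ENNReal.ofReal (opNorm (M x)) ^ (m : ℝ) * F x := by
  classical
  set μ := pushMeasure U φ M with hμ
  have hac : μ ≪ volume := h.pushMeasure_absolutelyContinuous (by omega) hFD
  set d := μ.rnDeriv volume with hd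
  have hdm : Measurable d := Measure.measurable_rnDeriv _ _
  have hwd : volume.withDensity d = μ := Measure.withDensity_rnDeriv_eq _ _ hac
  set ρ : En (m + 1) → ℝ := fun y => (d y).toReal with hρ
  have hρm : Measurable ρ := hdm.ennreal_toReal
  have hρ0 : ∀ y, 0 ≤ ρ y := fun y => ENNReal.toReal_nonneg
  have hU'm := h.isOpen'.measurableSet
  have hψm : AEMeasurable ψ (volume.restrict U') := h.homeo.2.1.aemeasurable hU'm
  have htrans : ∀ F : En (m + 1) → ℝ≥0∞, Measurable F → ∫⁻ y in U', F (ψ y) * ENNReal.ofReal (ρ y)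
      ≤ ∫⁻ x in U, ENNReal.ofReal (opNorm (M x)) ^ (m : ℝ) * F x := fun F hF => by
    rw [← h.lintegral_comp_inverse_pushMeasure hF, ← hμ, ← hwd, restrict_withDensity hU'm,
      lintegral_withDensity_eq_lintegral_mul₀ hdm.aemeasurable (g := fun y => F (ψ y))
        (hF.comp_aemeasurable hψm)]
    refine lintegral_mono fun y => ?_
    show F (ψ y) * ENNReal.ofReal (ρ y) ≤ d y * F (ψ y)
    rw [mul_comm]
    exact mul_le_mul' ENNReal.ofReal_toReal_le le_rfl
  have hdK : ∀ K ⊆ U', IsCompact K → ∫⁻ y in K, d y ≠ ⊤ := fun K hK hKc => by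
    rw [← withDensity_apply _ hKc.measurableSet, hwd]
    exact h.pushMeasure_ne_top hq hK hKc
  have hρK : ∀ K ⊆ U', IsCompact K → IntegrableOn ρ K := fun K hK hKc =>
    integrable_toReal_of_lintegral_ne_top hdm.aemeasurable (hdK K hK hKc)
  have hρV : LocallyIntegrableOn ρ U' :=
    (locallyIntegrableOn_iff h.isOpen'.isLocallyClosed).2 hρK
  have hθ : ContinuousOn (fun y => W (ψ y)) U' := hW.comp h.homeo.2.1 h.homeo.2.2.2.1
  have hθ0 : ∀ y ∈ U', 0 < W (ψ y) := fun y hy => hW0 _ (h.homeo.2.2.2.1 hy)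
  have hθρ : IntegrableOn (fun y => W (ψ y) * ρ y) U' := by
    refine ⟨((hθ.aemeasurable hU'm).mul hρm.aemeasurable).aestronglyMeasurable, ?_⟩
    refine lt_of_le_of_lt ?_ ((htrans _ hWm.ennreal_ofReal).trans_lt hWint.lt_top)
    refine le_of_eq (setLIntegral_congr_fun hU'm fun y hy => ?_)
    show ‖W (ψ y) * ρ y‖ₑ = ENNReal.ofReal (W (ψ y)) * ENNReal.ofReal (ρ y)
    rw [← ENNReal.ofReal_mul (hθ0 y hy).le, Real.enorm_eq_ofReal (mul_nonneg (hθ0 y hy).le (hρ0 y))]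
  obtain ⟨C, hCtop, hC⟩ := h.exists_enorm_integral_mul_fderiv_le hm hq
  have hrep : ∀ i j : Fin (m + 1), ∃ k : En (m + 1) → ℝ, LocallyIntegrableOn k U' ∧
      (∀ᵐ x, x ∈ U' → |k x| ≤ C.toReal * ρ x) ∧ ∀ η : testFunctions U',
        ∫ y in U', ψ y j * fderiv ℝ (η : En (m + 1) → ℝ) y (EuclideanSpace.single i 1)
          = ∫ x in U', k x * (η : En (m + 1) → ℝ) x := by
    intro i j
    have hψj : LocallyIntegrableOn (fun y => ψ y j) U' :=
      ((EuclideanSpace.proj j : En (m + 1) →L[ℝ] ℝ).continuous.comp_continuousOn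
        h.homeo.2.1).locallyIntegrableOn hU'm
    have hI : ∀ η : testFunctions U', IntegrableOn
        (fun y => ψ y j * fderiv ℝ (η : En (m + 1) → ℝ) y (EuclideanSpace.single i 1)) U' := by
      rintro ⟨η, hη, hηc, hηU⟩
      exact locallyIntegrableOn_mul_integrable hψj
        ((hη.continuous_fderiv (by simp)).clm_apply continuous_const)
        (hηc.fderiv_apply ℝ _) ((tsupport_fderiv_apply_subset ℝ _).trans hηU)
    have hdiff : ∀ (η : testFunctions U') y, DifferentiableAt ℝ (η : En (m + 1) → ℝ) y :=
      fun η y => η.2.1.differentiable (by simp) y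
    let l : testFunctions U' →ₗ[ℝ] ℝ :=
      { toFun := fun η =>
          ∫ y in U', ψ y j * fderiv ℝ (η : En (m + 1) → ℝ) y (EuclideanSpace.single i 1)
        map_add' := fun a b => by
          rw [← integral_add (hI a) (hI b)]
          refine integral_congr_ae (Eventually.of_forall fun y => ?_)
          simp only [Submodule.coe_add]
          rw [fderiv_add (hdiff a y) (hdiff b y), add_apply, mul_add]
        map_smul' := fun c a => by
          rw [RingHom.id_apply, smul_eq_mul, ← integral_const_mul]
          refine integral_congr_ae (Eventually.of_forall fun y => ?_)
          simp only [Submodule.coe_smul]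
          rw [fderiv_const_smul (hdiff a y), smul_apply, smul_eq_mul]
          ring }
    refine exists_density_of_abs_le h.isOpen' hρ0 hρV hθ hθ0 hθρ l ENNReal.toReal_nonneg ?_
    rintro ⟨η, hη, hηc, hηU⟩
    have h1 := hC i j η hη hηc hηU
    have hηK := hρK _ hηU hηc.isCompact
    have h2 : ∫⁻ y, ‖η y‖ₑ ∂μ = ENNReal.ofReal (∫ x in U', |η x| * ρ x) := by
      have e1 : IntegrableOn (fun x => |η x| * ρ x) U' := by
        have := locallyIntegrableOn_mul_integrable hρV hη.continuous hηc hηU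
        refine this.norm.congr (Eventually.of_forall fun x => ?_)
        show ‖ρ x * η x‖ = |η x| * ρ x
        rw [norm_mul, Real.norm_of_nonneg (hρ0 x), Real.norm_eq_abs, mul_comm]
      rw [ofReal_integral_eq_lintegral_ofReal e1
        (Eventually.of_forall fun x => mul_nonneg (abs_nonneg _) (hρ0 x)), ← hwd,
        lintegral_withDensity_eq_lintegral_mul₀ hdm.aemeasurable
          hη.continuous.enorm.measurable.aemeasurable, ← setLIntegral_eq_of_support_subset (s := U')]
      · have hfin : ∀ᵐ y, y ∈ tsupport η → d y < ⊤ :=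
          (ae_restrict_iff' (isClosed_tsupport η).measurableSet).1
            (ae_lt_top hdm (hdK _ hηU hηc.isCompact))
        refine lintegral_congr_ae (ae_restrict_of_ae ?_)
        filter_upwards [hfin] with y hy
        show d y * ‖η y‖ₑ = ENNReal.ofReal (|η y| * ρ y)
        by_cases hyt : y ∈ tsupport η
        · rw [ENNReal.ofReal_mul (abs_nonneg _), ENNReal.ofReal_toReal (hy hyt).ne,
            Real.enorm_eq_ofReal_abs, mul_comm]
        · rw [image_eq_zero_of_notMem_tsupport hyt]; simp
      · intro y hy
        by_contra hyU
        refine hy ?_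
        simp [image_eq_zero_of_notMem_tsupport fun h => hyU (hηU h)]
    rw [h2, ← ENNReal.ofReal_toReal hCtop, ← ENNReal.ofReal_mul ENNReal.toReal_nonneg,
      Real.enorm_eq_ofReal_abs] at h1
    exact (ENNReal.ofReal_le_ofReal_iff (mul_nonneg ENNReal.toReal_nonneg
      (integral_nonneg fun x => mul_nonneg (abs_nonneg _) (hρ0 x)))).1 h1
  choose k hkV hkρ hkint using hrep
  refine ⟨ρ, C.toReal, fun y => Matrix.of fun j i => -k i j y, hρm, hρ0, ENNReal.toReal_nonneg,
    fun j => ⟨?_, ?_, ?_⟩, ?_, htrans⟩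
  · exact ((EuclideanSpace.proj j : En (m + 1) →L[ℝ] ℝ).continuous.comp_continuousOn
        h.homeo.2.1).locallyIntegrableOn hU'm
  · rw [locallyIntegrableOn_iff h.isOpen'.isLocallyClosed]
    intro K hK hKc
    have : IntegrableOn (fun y i => -k i j y) K :=
      Integrable.of_eval fun i => ((hkV i j).integrableOn_compact_subset hK hKc).neg
    exact (EuclideanSpace.equiv (Fin (m + 1)) ℝ).symm.toContinuousLinearMap.integrable_comp this
  · intro η hη hηc hηU i
    have := hkint i j ⟨η, hη, hηc, hηU⟩
    rw [← integral_neg]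
    simp only at this
    rw [this]
    refine integral_congr_ae (Eventually.of_forall fun y => ?_)
    show k i j y * η y = -(-k i j y * η y)
    ring
  · have : ∀ᵐ y, ∀ i j, y ∈ U' → |k i j y| ≤ C.toReal * ρ y :=
      ae_all_iff.2 fun i => ae_all_iff.2 fun j => hkρ i j
    filter_upwards [this] with y hy hyU i j
    show |-k j i y| ≤ _
    rw [abs_neg]
    exact hy j i hyU

end Inverse

end SobolevHomeo

section ChainRule

variable {n : ℕ}

/-- Weak gradients are stable under local `L¹` limits. -/
theorem isWeakGradOn_of_approx {U : Set (En n)} {F : En n → ℝ} {g : En n → En n}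
    (hF : LocallyIntegrableOn F U) (hg : LocallyIntegrableOn g U)
    (H : ∀ K ⊆ U, IsCompact K → ∀ ε : ℝ≥0∞, 0 < ε → ∃ F' g', IsWeakGradOn U F' g' ∧
      ∫⁻ x in K, ‖F' x - F x‖ₑ ≤ ε ∧ ∫⁻ x in K, ‖g' x - g x‖ₑ ≤ ε) : IsWeakGradOn U F g := by
  refine ⟨hF, hg, fun η hη hηc hηU i => ?_⟩
  set dη : En n → ℝ := fun x => fderiv ℝ η x (EuclideanSpace.single i 1) with hdη
  have hd : Continuous dη := (hη.continuous_fderiv (by simp)).clm_apply continuous_const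
  have hdc : HasCompactSupport dη := hηc.fderiv_apply ℝ _
  have hds : tsupport dη ⊆ tsupport η := tsupport_fderiv_apply_subset ℝ _
  have hdU : tsupport dη ⊆ U := hds.trans hηU
  obtain ⟨A, hA⟩ := hηc.exists_bound_of_continuous hη.continuous
  obtain ⟨B, hB⟩ := hdc.exists_bound_of_continuous hd
  have hsmall : ∀ ε : ℝ≥0∞, 0 < ε →
      ‖(∫ x in U, F x * dη x) - -∫ x in U, g x i * η x‖ₑ
        ≤ ENNReal.ofReal B * ε + ENNReal.ofReal A * ε := by
    intro ε hε
    obtain ⟨F', g', h', hF', hg'⟩ := H _ hηU hηc.isCompact ε hε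
    have e := h'.2.2 η hη hηc hηU i
    have i1 := locallyIntegrableOn_mul_integrable hF hd hdc hdU
    have i2 := locallyIntegrableOn_mul_integrable h'.1 hd hdc hdU
    have i3 := locallyIntegrableOn_mul_integrable (locallyIntegrableOn_apply hg i)
      hη.continuous hηc hηU
    have i4 := locallyIntegrableOn_mul_integrable (locallyIntegrableOn_apply h'.2.1 i)
      hη.continuous hηc hηU
    have e2 : (∫ x in U, F x * dη x) - -∫ x in U, g x i * η x
        = -((∫ x in U, (F' x - F x) * dη x) + ∫ x in U, (g' x i - g x i) * η x) := by
      simp only [sub_mul]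
      rw [integral_sub i2 i1, integral_sub i4 i3, hdη, e]
      ring
    rw [e2, enorm_neg]
    refine (enorm_add_le _ _).trans (add_le_add ?_ ?_)
    · rw [setIntegral_eq_integral_of_forall_compl_eq_zero fun x hx => by
          rw [image_eq_zero_of_notMem_tsupport fun h => hx (hdU h), mul_zero],
        ← setIntegral_eq_integral_of_forall_compl_eq_zero (s := tsupport η) fun x hx => by
          rw [image_eq_zero_of_notMem_tsupport fun h => hx (hds h), mul_zero]]
      refine (enorm_integral_le_lintegral_enorm _).trans ?_
      refine le_trans ?_ (mul_le_mul' le_rfl hF')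
      rw [← lintegral_const_mul' _ _ ENNReal.ofReal_ne_top]
      refine lintegral_mono fun x => ?_
      rw [enorm_mul, mul_comm, Real.enorm_eq_ofReal_abs (dη x)]
      exact mul_le_mul' (ENNReal.ofReal_le_ofReal (hB x)) le_rfl
    · rw [setIntegral_eq_integral_of_forall_compl_eq_zero fun x hx => by
          rw [image_eq_zero_of_notMem_tsupport fun h => hx (hηU h), mul_zero],
        ← setIntegral_eq_integral_of_forall_compl_eq_zero (s := tsupport η) fun x hx => by
          rw [image_eq_zero_of_notMem_tsupport hx, mul_zero]]
      refine (enorm_integral_le_lintegral_enorm _).trans ?_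
      refine le_trans ?_ (mul_le_mul' le_rfl hg')
      rw [← lintegral_const_mul' _ _ ENNReal.ofReal_ne_top]
      refine lintegral_mono fun x => ?_
      rw [enorm_mul, mul_comm, Real.enorm_eq_ofReal_abs (η x)]
      refine mul_le_mul' (ENNReal.ofReal_le_ofReal (hA x)) ?_
      rw [← PiLp.sub_apply, ← ofReal_norm, ← ofReal_norm]
      exact ENNReal.ofReal_le_ofReal (PiLp.norm_apply_le _ _)
  have hzero : ‖(∫ x in U, F x * dη x) - -∫ x in U, g x i * η x‖ₑ ≤ 0 := by
    have hlim : Tendsto (fun ε : ℝ≥0∞ => ENNReal.ofReal B * ε + ENNReal.ofReal A * ε) (𝓝[>] 0)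
        (𝓝 (ENNReal.ofReal B * 0 + ENNReal.ofReal A * 0)) :=
      (((ENNReal.Tendsto.const_mul tendsto_id (Or.inr ENNReal.ofReal_ne_top)).add
        (ENNReal.Tendsto.const_mul tendsto_id (Or.inr ENNReal.ofReal_ne_top)))).mono_left
          nhdsWithin_le_nhds
    rw [mul_zero, mul_zero, add_zero] at hlim
    exact ge_of_tendsto hlim (eventually_nhdsWithin_of_forall fun ε hε => hsmall ε hε)
  exact sub_eq_zero.1 (enorm_eq_zero.1 (nonpos_iff_eq_zero.1 hzero))

theorem gradient_comp_eq_sum {v : En n → ℝ} (hv : ContDiff ℝ 1 v) {Ψ : Fin n → En n → ℝ}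
    (hΨ : ∀ j, ContDiff ℝ 1 (Ψ j)) (y : En n) :
    gradient (fun y => v (WithLp.toLp 2 fun j => Ψ j y)) y
      = ∑ j, fderiv ℝ v (WithLp.toLp 2 fun j => Ψ j y) (EuclideanSpace.single j 1) •
        gradient (Ψ j) y := by
  ext i
  have hd : HasFDerivAt (fun y => (WithLp.toLp 2 fun j => Ψ j y : En n))
      ((EuclideanSpace.equiv (Fin n) ℝ).symm.toContinuousLinearMap.comp
        (ContinuousLinearMap.pi fun j => fderiv ℝ (Ψ j) y)) y := by
    refine (EuclideanSpace.equiv (Fin n) ℝ).symm.toContinuousLinearMap.hasFDerivAt.comp y ?_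
    exact hasFDerivAt_pi.2 fun j => ((hΨ j).differentiable one_ne_zero y).hasFDerivAt
  have hc := ((hv.differentiable one_ne_zero _).hasFDerivAt.comp y hd).fderiv
  rw [gradient_apply]
  have : (fun y => v (WithLp.toLp 2 fun j => Ψ j y))
      = v ∘ fun y => (WithLp.toLp 2 fun j => Ψ j y : En n) := rfl
  rw [this, hc, ContinuousLinearMap.comp_apply]
  set b := ((EuclideanSpace.equiv (Fin n) ℝ).symm.toContinuousLinearMap.comp
        (ContinuousLinearMap.pi fun j => fderiv ℝ (Ψ j) y)) (EuclideanSpace.single i 1) with hb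
  have hb' : b = ∑ j, b j • (EuclideanSpace.single j (1 : ℝ) : En n) := by
    ext k
    simp [Finset.sum_apply, Pi.single_apply, WithLp.ofLp_sum]
  rw [hb', map_sum]
  simp only [map_smul, WithLp.ofLp_sum, Finset.sum_apply, PiLp.smul_apply, smul_eq_mul,
    gradient_apply]
  refine Finset.sum_congr rfl fun j _ => ?_
  rw [mul_comm]
  rfl

/-- Chain rule for a smooth function composed with a continuous weakly differentiable map. -/
theorem isWeakGradOn_comp_of_contDiff {U : Set (En n)} (hU : IsOpen U) {ψ : En n → En n}
    (hψ : ContinuousOn ψ U) {D : En n → Matrix (Fin n) (Fin n) ℝ} (hD : IsWeakJacobiOn U ψ D)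
    {v : En n → ℝ} (hv : ContDiff ℝ 1 v) :
    IsWeakGradOn U (fun y => v (ψ y))
      fun y => ∑ j, fderiv ℝ v (ψ y) (EuclideanSpace.single j 1) • rowVec (D y) j := by
  set dv : Fin n → En n → ℝ := fun j z => fderiv ℝ v z (EuclideanSpace.single j 1) with hdv
  have hdvc : ∀ j, Continuous (dv j) := fun j =>
    (hv.continuous_fderiv one_ne_zero).clm_apply continuous_const
  have hvψ : ContinuousOn (fun y => v (ψ y)) U := hv.continuous.comp_continuousOn hψ
  have hdvψ : ∀ j, ContinuousOn (fun y => dv j (ψ y)) U := fun j => (hdvc j).comp_continuousOn hψ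
  have hDi : ∀ j, ∀ K ⊆ U, IsCompact K → IntegrableOn (fun y => rowVec (D y) j) K :=
    fun j K hK hKc => (hD j).2.1.integrableOn_compact_subset hK hKc
  refine isWeakGradOn_of_approx (hvψ.locallyIntegrableOn hU.measurableSet) ?_ ?_
  · rw [locallyIntegrableOn_iff hU.isLocallyClosed]
    intro K hK hKc
    exact integrable_finsetSum _ fun j _ =>
      (hDi j K hK hKc).continuousOn_smul ((hdvψ j).mono hK) hKc
  intro K hK hKc ε hε
  have happ : ∀ (k : ℕ) (j : Fin n), ∃ u : En n → ℝ, ContDiff ℝ ∞ u ∧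
      (∀ x ∈ K, |u x - ψ x j| ≤ 1 / ((k : ℝ) + 1)) ∧
      ∫⁻ x in K, ‖gradient u x - rowVec (D x) j‖ₑ ≤ ENNReal.ofReal (1 / ((k : ℝ) + 1)) := by
    intro k j
    have hψj : ContinuousOn (fun y => ψ y j) U :=
      (EuclideanSpace.proj j : En n →L[ℝ] ℝ).continuous.comp_continuousOn hψ
    have := exists_contDiff_approx hU hψj (hD j) le_rfl (fun L hL hLc => by
      simp only [ENNReal.rpow_one]
      exact (hDi j L hL hLc).2.ne) hKc hK (ε := 1 / ((k : ℝ) + 1)) (by positivity)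
    simp only [ENNReal.rpow_one] at this
    exact this
  choose u hu huψ hug using happ
  set Ψ : ℕ → En n → En n := fun k y => WithLp.toLp 2 fun j => u k j y with hΨ
  have hu1 : ∀ k j, ContDiff ℝ 1 (u k j) := fun k j => (hu k j).of_le (by simp)
  have hΨs : ∀ k, ContDiff ℝ 1 (Ψ k) := fun k =>
    (EuclideanSpace.equiv (Fin n) ℝ).symm.contDiff.comp (contDiff_pi.2 fun j => hu1 k j)
  have hdist : ∀ k, ∀ y ∈ K, ‖Ψ k y - ψ y‖ ≤ n * (1 / ((k : ℝ) + 1)) := fun k y hy => by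
    refine (norm_le_sum_norm_apply _).trans ?_
    refine (Finset.sum_le_sum fun j _ => huψ k j y hy).trans ?_
    simp
  have hlim : ∀ y ∈ K, Tendsto (fun k => Ψ k y) atTop (𝓝 (ψ y)) := fun y hy => by
    rw [tendsto_iff_norm_sub_tendsto_zero]
    have := (tendsto_one_div_add_atTop_nhds_zero_nat (𝕜 := ℝ)).const_mul (n : ℝ)
    rw [mul_zero] at this
    exact squeeze_zero (fun _ => norm_nonneg _) (fun k => hdist k y hy) this
  set L := cthickening (n : ℝ) (ψ '' K)
  have hLc : IsCompact L := (hKc.image_of_continuousOn (hψ.mono hK)).cthickening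
  have hψL : ∀ y ∈ K, ψ y ∈ L := fun y hy =>
    self_subset_cthickening _ (mem_image_of_mem ψ hy)
  have hΨL : ∀ k, ∀ y ∈ K, Ψ k y ∈ L := fun k y hy => by
    refine mem_cthickening_of_dist_le _ (ψ y) _ _ (mem_image_of_mem ψ hy) ?_
    rw [dist_eq_norm]
    refine (hdist k y hy).trans (mul_le_of_le_one_right (Nat.cast_nonneg n) ?_)
    rw [div_le_one (by positivity)]
    have : (0 : ℝ) ≤ k := Nat.cast_nonneg k
    linarith
  -- convergence of continuous functions along the approximations
  have hconv : ∀ (F : En n → ℝ), Continuous F → ∀ E : En n → ℝ≥0∞,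
      AEMeasurable E (volume.restrict K) → ∫⁻ y in K, E y ≠ ⊤ →
      Tendsto (fun k => ∫⁻ y in K, ‖F (Ψ k y) - F (ψ y)‖ₑ * E y) atTop (𝓝 0) := by
    intro F hF E hE hEtop
    obtain ⟨B, hB⟩ := hLc.exists_bound_of_continuousOn hF.continuousOn
    have h0 : (0 : ℝ≥0∞) = ∫⁻ _ in K, 0 := by simp
    rw [h0]
    refine tendsto_lintegral_of_dominated_convergence' (fun y => ENNReal.ofReal (B + B) * E y)
      (fun k => ?_) (fun k => ?_) ?_ ?_
    · have h1 : AEMeasurable (fun y => F (Ψ k y) - F (ψ y)) (volume.restrict K) :=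
        ((hF.comp (hΨs k).continuous).continuousOn.sub
          ((hF.comp_continuousOn hψ).mono hK)).aemeasurable hKc.measurableSet
      exact h1.enorm.mul hE
    · refine ae_restrict_of_forall_mem hKc.measurableSet fun y hy => mul_le_mul' ?_ le_rfl
      rw [← ofReal_norm]
      exact ENNReal.ofReal_le_ofReal ((norm_sub_le _ _).trans
        (add_le_add (hB _ (hΨL k y hy)) (hB _ (hψL y hy))))
    · rw [lintegral_const_mul' _ _ ENNReal.ofReal_ne_top]
      exact ENNReal.mul_ne_top ENNReal.ofReal_ne_top hEtop
    · have hfin : ∀ᵐ y ∂(volume.restrict K), E y < ⊤ := ae_lt_top' hE hEtop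
      filter_upwards [hfin, ae_restrict_mem hKc.measurableSet] with y hy1 hy
      have h1 := (((hF.tendsto _).comp (hlim y hy)).sub_const (F (ψ y))).enorm
      rw [sub_self, enorm_zero] at h1
      have := ENNReal.Tendsto.mul_const h1 (Or.inr hy1.ne)
      rwa [zero_mul] at this
  have hT1 : Tendsto (fun k => ∫⁻ y in K, ‖v (Ψ k y) - v (ψ y)‖ₑ) atTop (𝓝 0) := by
    have := hconv v hv.continuous (fun _ => 1) aemeasurable_const (by
      rw [lintegral_one, Measure.restrict_apply_univ]; exact hKc.measure_ne_top)
    simpa only [mul_one] using this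
  have hT2 : Tendsto (fun k => ∫⁻ y in K, ‖gradient (fun y => v (Ψ k y)) y
      - ∑ j, dv j (ψ y) • rowVec (D y) j‖ₑ) atTop (𝓝 0) := by
    have hB : ∀ j, ∃ B : ℝ, ∀ z ∈ L, ‖dv j z‖ ≤ B := fun j =>
      hLc.exists_bound_of_continuousOn (hdvc j).continuousOn
    choose B hB using hB
    have hsum : Tendsto (fun k : ℕ => ∑ j, (ENNReal.ofReal (B j) * ENNReal.ofReal (1 / ((k : ℝ) + 1))
        + ∫⁻ y in K, ‖dv j (Ψ k y) - dv j (ψ y)‖ₑ * ‖rowVec (D y) j‖ₑ)) atTop (𝓝 0) := by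
      have h0 : (0 : ℝ≥0∞) = ∑ j : Fin n, (ENNReal.ofReal (B j) * ENNReal.ofReal 0 + 0) := by simp
      rw [h0]
      refine tendsto_finsetSum _ fun j _ => Tendsto.add ?_ ?_
      · exact ENNReal.Tendsto.const_mul ((ENNReal.continuous_ofReal.tendsto 0).comp
          tendsto_one_div_add_atTop_nhds_zero_nat) (Or.inr ENNReal.ofReal_ne_top)
      · exact hconv (dv j) (hdvc j) _ (hDi j K hK hKc).1.enorm (hDi j K hK hKc).2.ne
    refine tendsto_of_tendsto_of_tendsto_of_le_of_le tendsto_const_nhds hsum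
      (fun _ => zero_le) fun k => ?_
    have hgm : ∀ j, AEMeasurable (fun y => ‖dv j (Ψ k y)‖ₑ * ‖gradient (u k j) y - rowVec (D y) j‖ₑ)
        (volume.restrict K) := fun j => by
      refine ((hdvc j).comp (hΨs k).continuous).enorm.aemeasurable.mul ?_
      have hg : Continuous (gradient (u k j)) := (InnerProductSpace.toDual ℝ (En n)).symm.continuous.comp
        ((hu1 k j).continuous_fderiv one_ne_zero)
      exact (hg.aestronglyMeasurable.sub (hDi j K hK hKc).1).enorm
    have hpt : ∀ y, ‖gradient (fun y => v (Ψ k y)) y - ∑ j, dv j (ψ y) • rowVec (D y) j‖ₑ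
        ≤ ∑ j, (‖dv j (Ψ k y)‖ₑ * ‖gradient (u k j) y - rowVec (D y) j‖ₑ
          + ‖dv j (Ψ k y) - dv j (ψ y)‖ₑ * ‖rowVec (D y) j‖ₑ) := fun y => by
      rw [gradient_comp_eq_sum hv (hu1 k), ← Finset.sum_sub_distrib]
      refine (enorm_sum_le _ _).trans (Finset.sum_le_sum fun j _ => ?_)
      have e : fderiv ℝ v (WithLp.toLp 2 fun j => u k j y) (EuclideanSpace.single j 1) •
          gradient (u k j) y - dv j (ψ y) • rowVec (D y) j
          = dv j (Ψ k y) • (gradient (u k j) y - rowVec (D y) j)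
            + (dv j (Ψ k y) - dv j (ψ y)) • rowVec (D y) j := by
        rw [smul_sub, sub_smul]
        simp only [hdv, hΨ]
        abel
      rw [e]
      refine (enorm_add_le _ _).trans ?_
      rw [enorm_smul, enorm_smul]
    have hgm2 : ∀ j, AEMeasurable (fun y => ‖dv j (Ψ k y)‖ₑ * ‖gradient (u k j) y - rowVec (D y) j‖ₑ
        + ‖dv j (Ψ k y) - dv j (ψ y)‖ₑ * ‖rowVec (D y) j‖ₑ) (volume.restrict K) := fun j => by
      refine (hgm j).add (AEMeasurable.mul ?_ (hDi j K hK hKc).1.enorm)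
      have h1 : AEMeasurable (fun y => dv j (Ψ k y) - dv j (ψ y)) (volume.restrict K) :=
        (((hdvc j).comp (hΨs k).continuous).continuousOn.sub
          ((hdvψ j).mono hK)).aemeasurable hKc.measurableSet
      exact h1.enorm
    refine (lintegral_mono hpt).trans ?_
    rw [lintegral_finsetSum' _ fun j _ => hgm2 j]
    refine Finset.sum_le_sum fun j _ => ?_
    rw [lintegral_add_left' (hgm j)]
    refine add_le_add ?_ le_rfl
    refine le_trans ?_ (mul_le_mul' le_rfl (hug k j))
    rw [← lintegral_const_mul' _ _ ENNReal.ofReal_ne_top]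
    refine setLIntegral_mono' hKc.measurableSet fun y hy => mul_le_mul' ?_ le_rfl
    rw [← ofReal_norm]
    exact ENNReal.ofReal_le_ofReal (hB j _ (hΨL k y hy))
  obtain ⟨k, hk1, hk2⟩ := ((hT1.eventually_le_const hε).and (hT2.eventually_le_const hε)).exists
  exact ⟨_, _, isWeakGradOn_gradient (hv.comp (hΨs k)) U, hk1, hk2⟩

end ChainRule

section Composition

theorem IsWeakGradOn.congr {n : ℕ} {U : Set (En n)} {f : En n → ℝ} {g g' : En n → En n}
    (h : IsWeakGradOn U f g) (hgg' : g =ᵐ[volume.restrict U] g') : IsWeakGradOn U f g' := by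
  refine ⟨h.1, h.2.1.congr hgg', fun η hη hηc hηU i => ?_⟩
  rw [h.2.2 η hη hηc hηU i]
  congr 1
  refine integral_congr_ae ?_
  filter_upwards [hgg'] with x hx
  rw [hx]

theorem norm_sum_smul_rowVec_le {n : ℕ} (a : En n) (A : Matrix (Fin n) (Fin n) ℝ) {c : ℝ}
    (hA : ∀ i j, |A i j| ≤ c) : ‖∑ j, a j • rowVec A j‖ ≤ n * n * c * ‖a‖ := by
  refine (norm_sum_le _ _).trans ?_
  have h1 : ∀ j, ‖a j • rowVec A j‖ ≤ ‖a‖ * (n * c) := fun j => by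
    rw [norm_smul]
    refine mul_le_mul (PiLp.norm_apply_le _ _) ?_ (norm_nonneg _) (norm_nonneg _)
    refine (norm_le_sum_norm_apply _).trans ?_
    refine (Finset.sum_le_sum fun i _ => hA j i).trans ?_
    simp
  refine (Finset.sum_le_sum fun j _ => h1 j).trans (le_of_eq ?_)
  rw [Finset.sum_const, Finset.card_univ, Fintype.card_fin, nsmul_eq_mul]
  ring

theorem lintegral_rpow_mul_le {α : Type*} [MeasurableSpace α] {μ : Measure α} {G F : α → ℝ≥0∞}
    {m q p : ℝ} (hm : 0 < m) (hp : p.HolderConjugate (q / m)) (hG : AEMeasurable G μ)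
    (hF : AEMeasurable F μ) : ∫⁻ x, G x ^ m * F x ∂μ
      ≤ (∫⁻ x, G x ^ q ∂μ) ^ (m / q) * (∫⁻ x, F x ^ p ∂μ) ^ (1 / p) := by
  have := ENNReal.lintegral_mul_le_Lp_mul_Lq μ hp.symm (hG.pow_const m) hF
  simp only [Pi.mul_apply, ← ENNReal.rpow_mul, mul_div_cancel₀ q hm.ne', one_div_div] at this
  exact this

namespace SobolevHomeo

variable {m : ℕ} {q : ℝ} {U U' : Set (En (m + 1))} {φ ψ : En (m + 1) → En (m + 1)}
  {M : En (m + 1) → Matrix (Fin (m + 1)) (Fin (m + 1)) ℝ}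

theorem setLIntegral_comp_inverse_le (h : SobolevHomeo q U U' φ ψ M) {ρ : En (m + 1) → ℝ}
    (hρ : ∀ F : En (m + 1) → ℝ≥0∞, Measurable F → ∫⁻ y in U', F (ψ y) * ENNReal.ofReal (ρ y)
        ≤ ∫⁻ x in U, ENNReal.ofReal (opNorm (M x)) ^ (m : ℝ) * F x)
    {K : Set (En (m + 1))} (hK : K ⊆ U') (hKc : IsCompact K) {F : En (m + 1) → ℝ≥0∞}
    (hF : Measurable F) : ∫⁻ y in K, F (ψ y) * ENNReal.ofReal (ρ y)
      ≤ ∫⁻ x in ψ '' K, ENNReal.ofReal (opNorm (M x)) ^ (m : ℝ) * F x := by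
  have hLm : MeasurableSet (ψ '' K) := (h.isCompact_image hK hKc).measurableSet
  have h1 := hρ _ (hF.indicator hLm)
  calc ∫⁻ y in K, F (ψ y) * ENNReal.ofReal (ρ y)
      = ∫⁻ y in K, (ψ '' K).indicator F (ψ y) * ENNReal.ofReal (ρ y) :=
        setLIntegral_congr_fun hKc.measurableSet fun y hy => by
          simp only [indicator_of_mem (mem_image_of_mem ψ hy)]
    _ ≤ _ := lintegral_mono_set hK
    _ ≤ _ := h1
    _ = ∫⁻ x in U, (ψ '' K).indicator
          (fun x => ENNReal.ofReal (opNorm (M x)) ^ (m : ℝ) * F x) x := by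
        refine lintegral_congr fun x => ?_
        by_cases hx : x ∈ ψ '' K <;> simp [hx]
    _ = _ := by
        rw [lintegral_indicator hLm, Measure.restrict_restrict hLm,
          inter_eq_self_of_subset_left (h.image_subset hK)]

/-- Composition with the inverse of a Sobolev homeomorphism of finite distortion. -/
theorem isWeakGradOn_comp_inverse (h : SobolevHomeo q U U' φ ψ M) (hm : 1 ≤ m)
    {p : ℝ} (hp : p.HolderConjugate (q / m)) {ρ : En (m + 1) → ℝ} {C : ℝ}
    {D : En (m + 1) → Matrix (Fin (m + 1)) (Fin (m + 1)) ℝ} (hC : 0 ≤ C)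
    (hD : IsWeakJacobiOn U' ψ D) (hDρ : ∀ᵐ y, y ∈ U' → ∀ i j, |D y i j| ≤ C * ρ y)
    (hρ : ∀ F : En (m + 1) → ℝ≥0∞, Measurable F → ∫⁻ y in U', F (ψ y) * ENNReal.ofReal (ρ y)
        ≤ ∫⁻ x in U, ENNReal.ofReal (opNorm (M x)) ^ (m : ℝ) * F x)
    {f : En (m + 1) → ℝ} {g : En (m + 1) → En (m + 1)} (hf : ContinuousOn f U)
    (hfg : IsWeakGradOn U f g) (hg : Measurable g)
    (hgp : ∀ K ⊆ U, IsCompact K → ∫⁻ x in K, ‖g x‖ₑ ^ p ≠ ⊤) :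
    IsWeakGradOn U' (fun y => f (ψ y)) (fun y => ∑ j, g (ψ y) j • rowVec (D y) j) ∧
      ∀ᵐ y, y ∈ U' → ‖∑ j, g (ψ y) j • rowVec (D y) j‖ₑ
        ≤ ENNReal.ofReal ((m + 1) * (m + 1) * C) * (‖g (ψ y)‖ₑ * ENNReal.ofReal (ρ y)) := by
  have hmR : (0 : ℝ) < m := by exact_mod_cast hm
  set A : ℝ≥0∞ := ENNReal.ofReal ((m + 1) * (m + 1) * C) with hA
  have hbound : ∀ᵐ y, y ∈ U' → ∀ a : En (m + 1), ‖∑ j, a j • rowVec (D y) j‖ₑ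
      ≤ A * (‖a‖ₑ * ENNReal.ofReal (ρ y)) := by
    filter_upwards [hDρ] with y hy hyU a
    have := norm_sum_smul_rowVec_le a (D y) (hy hyU)
    rw [← ofReal_norm, ← ofReal_norm, hA, ← ENNReal.ofReal_mul (norm_nonneg _),
      ← ENNReal.ofReal_mul (by positivity)]
    refine ENNReal.ofReal_le_ofReal (this.trans (le_of_eq ?_))
    push_cast
    ring
  have hU'm := h.isOpen'.measurableSet
  -- the key integral estimate
  have hest : ∀ K ⊆ U', IsCompact K → ∀ a : En (m + 1) → En (m + 1), Measurable a →
      ∫⁻ y in K, ‖∑ j, a (ψ y) j • rowVec (D y) j‖ₑ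
        ≤ A * ((∫⁻ x in ψ '' K, ENNReal.ofReal (opNorm (M x)) ^ q) ^ (m / q)
          * (∫⁻ x in ψ '' K, ‖a x‖ₑ ^ p) ^ (1 / p)) := by
    intro K hK hKc a ha
    calc ∫⁻ y in K, ‖∑ j, a (ψ y) j • rowVec (D y) j‖ₑ
        ≤ ∫⁻ y in K, A * (‖a (ψ y)‖ₑ * ENNReal.ofReal (ρ y)) := by
          refine lintegral_mono_ae ((ae_restrict_iff' hKc.measurableSet).2 ?_)
          filter_upwards [hbound] with y hy hyK using hy (hK hyK) _
      _ = A * ∫⁻ y in K, ‖a (ψ y)‖ₑ * ENNReal.ofReal (ρ y) :=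
          lintegral_const_mul' _ _ ENNReal.ofReal_ne_top
      _ ≤ _ := mul_le_mul' le_rfl ((h.setLIntegral_comp_inverse_le hρ hK hKc ha.enorm).trans
          (lintegral_rpow_mul_le hmR hp h.measurable_ofReal_opNorm.aemeasurable
            ha.enorm.aemeasurable))
  have hSfin : ∀ K ⊆ U', IsCompact K →
      (∫⁻ x in ψ '' K, ENNReal.ofReal (opNorm (M x)) ^ q) ^ (m / q) ≠ ⊤ := fun K hK hKc =>
    ENNReal.rpow_ne_top_of_nonneg (by rw [← one_div_div]; exact (one_div_pos.2 hp.symm.pos).le)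
      (h.loc _ (h.image_subset hK) (h.isCompact_image hK hKc))
  have hψf : ContinuousOn (fun y => f (ψ y)) U' := hf.comp h.homeo.2.1 h.homeo.2.2.2.1
  refine ⟨?_, hbound.mono fun y hy hyU => hy hyU _⟩
  refine isWeakGradOn_of_approx (hψf.locallyIntegrableOn hU'm) ?_ ?_
  · rw [locallyIntegrableOn_iff h.isOpen'.isLocallyClosed]
    intro K hK hKc
    refine ⟨?_, ?_⟩
    · refine Finset.aestronglyMeasurable_fun_sum _ fun j _ => ?_
      have h1 : AEMeasurable (fun y => g (ψ y)) (volume.restrict K) :=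
        hg.comp_aemeasurable ((h.homeo.2.1.mono hK).aemeasurable hKc.measurableSet)
      have h2 : AEMeasurable (fun y => g (ψ y) j) (volume.restrict K) :=
        (EuclideanSpace.proj j : En (m + 1) →L[ℝ] ℝ).measurable.comp_aemeasurable h1
      exact h2.aestronglyMeasurable.smul ((hD j).2.1.integrableOn_compact_subset hK hKc).1
    · refine (hest K hK hKc g hg).trans_lt (ENNReal.mul_lt_top ENNReal.ofReal_lt_top
        (ENNReal.mul_lt_top (hSfin K hK hKc).lt_top ?_))
      exact ENNReal.rpow_lt_top_of_nonneg (one_div_pos.2 hp.pos).le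
        (hgp _ (h.image_subset hK) (h.isCompact_image hK hKc))
  intro K hK hKc ε hε
  set L := ψ '' K
  have hLc : IsCompact L := h.isCompact_image hK hKc
  have happ : ∀ k : ℕ, ∃ v : En (m + 1) → ℝ, ContDiff ℝ ∞ v ∧
      (∀ x ∈ L, |v x - f x| ≤ 1 / ((k : ℝ) + 1)) ∧
      ∫⁻ x in L, ‖gradient v x - g x‖ₑ ^ p ≤ ENNReal.ofReal (1 / ((k : ℝ) + 1)) := fun k =>
    exists_contDiff_approx h.isOpen hf hfg hp.lt.le hgp hLc (h.image_subset hK) (by positivity)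
  choose v hv hvf hvg using happ
  have hv1 : ∀ k, ContDiff ℝ 1 (v k) := fun k => (hv k).of_le (by simp)
  have hlim : Tendsto (fun k : ℕ => ENNReal.ofReal (1 / ((k : ℝ) + 1))) atTop (𝓝 0) := by
    have := (ENNReal.continuous_ofReal.tendsto 0).comp
      (tendsto_one_div_add_atTop_nhds_zero_nat (𝕜 := ℝ))
    rwa [ENNReal.ofReal_zero] at this
  have hT1 : Tendsto (fun k => ∫⁻ y in K, ‖v k (ψ y) - f (ψ y)‖ₑ) atTop (𝓝 0) := by
    have := ENNReal.Tendsto.mul_const (b := volume K) hlim (Or.inr hKc.measure_ne_top)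
    rw [zero_mul] at this
    refine tendsto_of_tendsto_of_tendsto_of_le_of_le tendsto_const_nhds this
      (fun _ => zero_le) fun k => ?_
    rw [← setLIntegral_const]
    refine setLIntegral_mono' hKc.measurableSet fun y hy => ?_
    rw [Real.enorm_eq_ofReal_abs]
    exact ENNReal.ofReal_le_ofReal (hvf k _ (mem_image_of_mem ψ hy))
  have hT2 : Tendsto (fun k => ∫⁻ y in K,
      ‖∑ j, fderiv ℝ (v k) (ψ y) (EuclideanSpace.single j 1) • rowVec (D y) j
        - ∑ j, g (ψ y) j • rowVec (D y) j‖ₑ) atTop (𝓝 0) := by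
    have h1 : Tendsto (fun k : ℕ => ENNReal.ofReal (1 / ((k : ℝ) + 1)) ^ (1 / p)) atTop (𝓝 0) := by
      have := ((ENNReal.continuous_rpow_const (y := 1 / p)).tendsto 0).comp hlim
      rwa [ENNReal.zero_rpow_of_pos (one_div_pos.2 hp.pos)] at this
    have h2 := ENNReal.Tendsto.const_mul (ENNReal.Tendsto.const_mul h1 (Or.inr (hSfin K hK hKc)))
      (Or.inr (ENNReal.ofReal_ne_top (r := (m + 1) * (m + 1) * C)))
    rw [mul_zero, mul_zero] at h2
    refine tendsto_of_tendsto_of_tendsto_of_le_of_le tendsto_const_nhds h2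
      (fun _ => zero_le) fun k => ?_
    have hgr : Measurable (gradient (v k)) := ((InnerProductSpace.toDual ℝ (En (m + 1))).symm.continuous.comp
      ((hv1 k).continuous_fderiv one_ne_zero)).measurable
    have := hest K hK hKc (fun x => gradient (v k) x - g x) (hgr.sub hg)
    simp only [PiLp.sub_apply, sub_smul, Finset.sum_sub_distrib, gradient_apply] at this
    refine this.trans (mul_le_mul' le_rfl (mul_le_mul' le_rfl ?_))
    exact ENNReal.rpow_le_rpow (hvg k) (one_div_pos.2 hp.pos).le
  obtain ⟨k, hk1, hk2⟩ := ((hT1.eventually_le_const hε).and (hT2.eventually_le_const hε)).exists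
  exact ⟨_, _, isWeakGradOn_comp_of_contDiff h.isOpen' h.homeo.2.1 hD (hv1 k), hk1, hk2⟩

end SobolevHomeo

end Composition

section RemovablePoint

variable {n : ℕ}

/-- The functions `x ↦ χ ((k + 1) • (x - a))` concentrate at the point `a`. -/
theorem exists_cutoff_sequence (hn : 2 ≤ n) (a : En n) :
    ∃ η : ℕ → En n → ℝ, (∀ k, ContDiff ℝ ∞ (η k)) ∧ (∀ k x, |η k x| ≤ 1) ∧
      (∀ k, ∀ᶠ x in 𝓝 a, η k x = 1) ∧ (∀ x, x ≠ a → ∀ᶠ k in atTop, η k x = 0) ∧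
      ∀ i, (∀ k, Integrable fun x => fderiv ℝ (η k) x (EuclideanSpace.single i 1)) ∧
        Tendsto (fun k => ∫ x, |fderiv ℝ (η k) x (EuclideanSpace.single i 1)|) atTop (𝓝 0) := by
  let χ : ContDiffBump (0 : En n) := ⟨1, 2, one_pos, one_lt_two⟩
  have hχ : ContDiff ℝ ∞ χ := χ.contDiff
  have hS : ∀ k : ℕ, ContDiff ℝ ∞ fun x : En n => ((k : ℝ) + 1) • (x - a) := fun k =>
    (contDiff_id.sub contDiff_const).const_smul _
  have hfd : ∀ (k : ℕ) (i : Fin n) (x : En n),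
      fderiv ℝ (fun x => χ (((k : ℝ) + 1) • (x - a))) x (EuclideanSpace.single i 1)
        = ((k : ℝ) + 1) * fderiv ℝ χ (((k : ℝ) + 1) • (x - a)) (EuclideanSpace.single i 1) := by
    intro k i x
    have h1 : HasFDerivAt (fun x : En n => ((k : ℝ) + 1) • (x - a))
        (((k : ℝ) + 1) • ContinuousLinearMap.id ℝ (En n)) x :=
      ((hasFDerivAt_id x).sub_const a).const_smul ((k : ℝ) + 1)
    have h2 : HasFDerivAt χ (fderiv ℝ χ (((k : ℝ) + 1) • (x - a))) (((k : ℝ) + 1) • (x - a)) :=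
      ((hχ.differentiable (by simp)) _).hasFDerivAt
    have := (h2.comp x h1).fderiv
    rw [Function.comp_def] at this
    rw [this]
    simp
  have hint : ∀ i, Integrable fun x => fderiv ℝ χ x (EuclideanSpace.single i 1) := fun i =>
    ((hχ.continuous_fderiv (by simp)).clm_apply continuous_const).integrable_of_hasCompactSupport
      (χ.hasCompactSupport.fderiv_apply ℝ _)
  refine ⟨fun k x => χ (((k : ℝ) + 1) • (x - a)), fun k => hχ.comp (hS k), fun k x => ?_,
    fun k => ?_, fun x hx => ?_, fun i => ⟨fun k => ?_, ?_⟩⟩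
  · rw [abs_of_nonneg χ.nonneg]
    exact χ.le_one
  · have : Tendsto (fun x : En n => ((k : ℝ) + 1) • (x - a)) (𝓝 a) (𝓝 0) := by
      have := (hS k).continuous.tendsto a
      simpa using this
    exact this.eventually χ.eventuallyEq_one
  · have hpos : 0 < ‖x - a‖ := norm_pos_iff.2 (sub_ne_zero.2 hx)
    filter_upwards [eventually_ge_atTop ⌈2 / ‖x - a‖⌉₊] with k hk
    apply χ.zero_of_le_dist
    rw [dist_zero_right, norm_smul, Real.norm_of_nonneg (by positivity)]
    have : 2 / ‖x - a‖ ≤ k := (Nat.le_ceil _).trans (by exact_mod_cast hk)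
    rw [div_le_iff₀ hpos] at this
    change (2 : ℝ) ≤ _
    nlinarith
  · simp only [hfd]
    exact (((hint i).comp_smul (R := (k : ℝ) + 1) (by positivity)).comp_sub_right a).const_mul _
  · have hval : ∀ k : ℕ, ∫ x, |fderiv ℝ (fun x => χ (((k : ℝ) + 1) • (x - a))) x
        (EuclideanSpace.single i 1)|
        = (((k : ℝ) + 1) * (((k : ℝ) + 1) ^ n)⁻¹)
          * ∫ x, |fderiv ℝ χ x (EuclideanSpace.single i 1)| := by
      intro k
      have hk : (0 : ℝ) < (k : ℝ) + 1 := by positivity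
      simp only [hfd, abs_mul, abs_of_pos hk]
      rw [integral_const_mul, integral_sub_right_eq_self
        (fun x => |fderiv ℝ χ (((k : ℝ) + 1) • x) (EuclideanSpace.single i 1)|) a,
        Measure.integral_comp_smul volume
          (fun x => |fderiv ℝ χ x (EuclideanSpace.single i 1)|) ((k : ℝ) + 1),
        finrank_euclideanSpace_fin, smul_eq_mul, abs_of_pos (by positivity), mul_assoc]
    simp only [hval]
    rw [← zero_mul (∫ x, |fderiv ℝ χ x (EuclideanSpace.single i 1)|)]
    refine Tendsto.mul_const _ (squeeze_zero (fun k => by positivity) (fun k => ?_)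
      tendsto_one_div_add_atTop_nhds_zero_nat)
    obtain ⟨l, rfl⟩ := Nat.exists_eq_add_of_le hn
    have hk : (1 : ℝ) ≤ (k : ℝ) + 1 := by linarith [(Nat.cast_nonneg k : (0 : ℝ) ≤ k)]
    rw [pow_add, ← div_eq_mul_inv, div_le_div_iff₀ (by positivity) (by positivity)]
    nlinarith [one_le_pow₀ hk (n := l), sq_nonneg ((k : ℝ) + 1)]

/-- Points are removable for weak gradients of continuous functions. -/
theorem isWeakGradOn_of_diff_singleton (hn : 2 ≤ n) {U : Set (En n)} (hU : IsOpen U) {a : En n}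
    {F : En n → ℝ} {g : En n → En n} (hF : ContinuousOn F U) (hg : LocallyIntegrableOn g U)
    (h : IsWeakGradOn (U \ {a}) F g) : IsWeakGradOn U F g := by
  have hFl : LocallyIntegrableOn F U := hF.locallyIntegrableOn hU.measurableSet
  refine ⟨hFl, hg, fun ζ hζ hζc hζU i => ?_⟩
  have : Nonempty (Fin n) := ⟨i⟩
  obtain ⟨η, hη, hη1, hηa, hη0, hηi⟩ := exists_cutoff_sequence hn a
  obtain ⟨hηint, hηlim⟩ := hηi i
  set e : En n := EuclideanSpace.single i 1
  have hae : (U \ {a} : Set (En n)) =ᵐ[volume] U := sdiff_null_ae_eq_self (measure_singleton a)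
  have hζ' : Continuous fun x => fderiv ℝ ζ x e :=
    (hζ.continuous_fderiv (by simp)).clm_apply continuous_const
  have hζ'c : HasCompactSupport fun x => fderiv ℝ ζ x e := hζc.fderiv_apply ℝ _
  have hζ'U : tsupport (fun x => fderiv ℝ ζ x e) ⊆ U := (tsupport_fderiv_apply_subset ℝ _).trans hζU
  have hFζ' : IntegrableOn (fun x => F x * fderiv ℝ ζ x e) U :=
    locallyIntegrableOn_mul_integrable hFl hζ' hζ'c hζ'U
  have hgζ : IntegrableOn (fun x => g x i * ζ x) U :=
    locallyIntegrableOn_mul_integrable (locallyIntegrableOn_apply hg i) hζ.continuous hζc hζU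
  have hη0' : ∀ᵐ x ∂volume.restrict U, ∀ᶠ k in atTop, η k x = 0 := by
    refine ae_restrict_of_ae ?_
    filter_upwards [compl_mem_ae_iff.2 (measure_singleton (μ := volume) a)] with x hx
    exact hη0 x hx
  have hDCT : ∀ G : En n → ℝ, IntegrableOn G U →
      Tendsto (fun k => ∫ x in U, G x * (1 - η k x)) atTop (𝓝 (∫ x in U, G x)) := by
    intro G hG
    refine tendsto_integral_of_dominated_convergence (fun x => ‖G x‖ * 2) (fun k => ?_)
      (hG.norm.mul_const 2) (fun k => Eventually.of_forall fun x => ?_) ?_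
    · exact hG.1.mul (continuous_const.sub (hη k).continuous).aestronglyMeasurable
    · rw [norm_mul]
      refine mul_le_mul_of_nonneg_left ?_ (norm_nonneg _)
      have := abs_le.1 (hη1 k x)
      rw [Real.norm_eq_abs, abs_le]
      constructor <;> linarith
    · filter_upwards [hη0'] with x hx
      refine tendsto_const_nhds.congr' ?_
      filter_upwards [hx] with k hk
      simp [hk]
  obtain ⟨B, hB0, hB⟩ : ∃ B, 0 ≤ B ∧ ∀ x ∈ U, |F x * ζ x| ≤ B := by
    obtain ⟨B, hB⟩ := (hζc.isCompact.image_of_continuousOn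
      ((hF.mono hζU).mul hζ.continuous.continuousOn)).isBounded.exists_norm_le
    refine ⟨max B 0, le_max_right _ _, fun x _ => ?_⟩
    by_cases hx : x ∈ tsupport ζ
    · exact (hB _ (mem_image_of_mem _ hx)).trans (le_max_left _ _)
    · rw [image_eq_zero_of_notMem_tsupport hx]
      simp
  have hFζm : AEStronglyMeasurable (fun x => F x * ζ x) (volume.restrict U) :=
    (hF.mul hζ.continuous.continuousOn).aestronglyMeasurable hU.measurableSet
  have hint2 : ∀ k, IntegrableOn (fun x => F x * ζ x * fderiv ℝ (η k) x e) U := fun k =>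
    (hηint k).integrableOn.bdd_mul hFζm
      (ae_restrict_of_forall_mem hU.measurableSet fun x hx => hB x hx)
  have hlim2 : Tendsto (fun k => ∫ x in U, F x * ζ x * fderiv ℝ (η k) x e) atTop (𝓝 0) := by
    have hT : Tendsto (fun k => B * ∫ x, |fderiv ℝ (η k) x e|) atTop (𝓝 0) := by
      simpa using hηlim.const_mul B
    refine squeeze_zero_norm (fun k => ?_) hT
    refine (norm_integral_le_integral_norm _).trans ?_
    rw [← integral_const_mul]
    refine (setIntegral_mono_on (hint2 k).norm
      ((hηint k).abs.const_mul B).integrableOn hU.measurableSet fun x hx => ?_).trans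
      (setIntegral_le_integral ((hηint k).abs.const_mul B) (Eventually.of_forall fun x => ?_))
    · rw [norm_mul]
      exact mul_le_mul_of_nonneg_right (hB x hx) (abs_nonneg _)
    · exact mul_nonneg hB0 (abs_nonneg _)
  have hid : ∀ k, (∫ x in U, F x * fderiv ℝ ζ x e * (1 - η k x))
      - (∫ x in U, F x * ζ x * fderiv ℝ (η k) x e) = -∫ x in U, g x i * ζ x * (1 - η k x) := by
    intro k
    have hθ : ContDiff ℝ ∞ fun x => ζ x * (1 - η k x) := hζ.mul (contDiff_const.sub (hη k))
    have hθs : tsupport (fun x => ζ x * (1 - η k x)) ⊆ tsupport ζ := tsupport_mul_subset_left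
    have key := h.2.2 (fun x => ζ x * (1 - η k x)) hθ
      (hζc.isCompact.of_isClosed_subset (isClosed_tsupport _) hθs)
      (fun x hx => ⟨hζU (hθs hx), fun hxa => by
        rw [mem_singleton_iff.1 hxa] at hx
        refine notMem_tsupport_iff_eventuallyEq.2 ?_ hx
        filter_upwards [hηa k] with z hz
        simp [hz]⟩) i
    rw [setIntegral_congr_set hae, setIntegral_congr_set hae] at key
    rw [← integral_sub]
    · simp only [← mul_assoc] at key
      rw [← key]
      refine integral_congr_ae (Eventually.of_forall fun x => ?_)
      have h1 := ((hζ.differentiable (by simp)) x).hasFDerivAt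
      have h2 := (((hη k).differentiable (by simp)) x).hasFDerivAt.const_sub 1
      have := (h1.mul h2).fderiv
      simp only [Pi.mul_def] at this
      simp only [this]
      simp
      ring
    · exact hFζ'.mul_bdd (c := 2) (continuous_const.sub (hη k).continuous).aestronglyMeasurable
        (Eventually.of_forall fun x => by
          have := abs_le.1 (hη1 k x)
          rw [Real.norm_eq_abs, abs_le]
          constructor <;> linarith)
    · exact hint2 k
  have hL := ((hDCT _ hFζ').sub hlim2)
  simp only [hid, sub_zero] at hL
  exact tendsto_nhds_unique hL (hDCT _ hgζ).neg

end RemovablePoint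

section PowerWeight

variable {n : ℕ}

theorem locallyIntegrable_norm_rpow (hn : 1 ≤ n) {β : ℝ} (hβ : -(n : ℝ) < β) :
    LocallyIntegrable (fun x : En n => ‖x‖ ^ β) := by
  refine locallyIntegrable_of_norm_le_rpow (C := 1) (α := -β) (by simpa using hn)
    (by rw [finrank_euclideanSpace_fin]; linarith) (Eventually.of_forall fun x => ?_)
    (measurable_norm.pow_const β).aestronglyMeasurable
  rw [neg_neg, one_mul, Real.norm_of_nonneg (by positivity)]

theorem continuousOn_norm_rpow (β : ℝ) :
    ContinuousOn (fun x : En n => ‖x‖ ^ β) {0}ᶜ :=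
  continuous_norm.continuousOn.rpow_const fun _ hx => Or.inl (norm_ne_zero_iff.2 hx)

/-- Hölder's inequality with the weight `‖x‖ ^ α` distributed over the two factors. -/
theorem setLIntegral_rpow_mul_le_norm_rpow {S : Set (En n)} (hS : MeasurableSet S)
    (hS0 : S ⊆ {0}ᶜ) {m q p : ℝ} (hm : 0 < m) (hp : p.HolderConjugate (q / m)) (α : ℝ)
    {G H : En n → ℝ≥0∞} (hG : Measurable G) (hH : Measurable H) :
    ∫⁻ x in S, G x ^ m * H x ≤ (∫⁻ x in S, (G x * ENNReal.ofReal (‖x‖ ^ α)) ^ q) ^ (m / q)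
      * (∫⁻ x in S, (H x * ENNReal.ofReal (‖x‖ ^ (-(α * m)))) ^ p) ^ (1 / p) := by
  refine le_trans (le_of_eq (setLIntegral_congr_fun hS fun x hx => ?_))
    (lintegral_rpow_mul_le hm hp (G := fun x => G x * ENNReal.ofReal (‖x‖ ^ α))
      (F := fun x => H x * ENNReal.ofReal (‖x‖ ^ (-(α * m))))
      (hG.mul (by fun_prop)).aemeasurable (hH.mul (by fun_prop)).aemeasurable)
  have hx0 : 0 < ‖x‖ := norm_pos_iff.2 (hS0 hx)
  have h1 : ENNReal.ofReal (‖x‖ ^ α) ^ m * ENNReal.ofReal (‖x‖ ^ (-(α * m))) = 1 := by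
    rw [ENNReal.ofReal_rpow_of_nonneg (by positivity) hm.le, ← Real.rpow_mul hx0.le,
      ← ENNReal.ofReal_mul (by positivity), ← Real.rpow_add hx0]
    simp
  change G x ^ m * H x = (G x * _) ^ m * (H x * _)
  rw [ENNReal.mul_rpow_of_nonneg _ _ hm.le, mul_mul_mul_comm, h1, mul_one]

/-- Away from the origin a power weight does not affect local integrability. -/
theorem setLIntegral_rpow_ne_top_of_norm_rpow {K : Set (En n)} (hK : K ⊆ {0}ᶜ) (hKc : IsCompact K)
    {p : ℝ} (hp : 0 ≤ p) (β : ℝ) {H : En n → ℝ≥0∞}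
    (h : ∫⁻ x in K, (H x * ENNReal.ofReal (‖x‖ ^ β)) ^ p ≠ ⊤) : ∫⁻ x in K, H x ^ p ≠ ⊤ := by
  obtain ⟨B, hB⟩ := hKc.exists_bound_of_continuousOn ((continuousOn_norm_rpow (-β)).mono hK)
  refine ne_top_of_le_ne_top (ENNReal.mul_ne_top
    (ENNReal.rpow_ne_top_of_nonneg hp (ENNReal.ofReal_ne_top (r := B))) h) ?_
  rw [← lintegral_const_mul' _ _ (ENNReal.rpow_ne_top_of_nonneg hp ENNReal.ofReal_ne_top)]
  refine setLIntegral_mono' hKc.measurableSet fun x hx => ?_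
  rw [← ENNReal.mul_rpow_of_nonneg _ _ hp]
  refine ENNReal.rpow_le_rpow ?_ hp
  have hx0 : 0 < ‖x‖ := norm_pos_iff.2 (hK hx)
  calc H x = H x * (ENNReal.ofReal (‖x‖ ^ (-β)) * ENNReal.ofReal (‖x‖ ^ β)) := by
        rw [← ENNReal.ofReal_mul (by positivity), ← Real.rpow_add hx0]
        simp
    _ ≤ H x * (ENNReal.ofReal B * ENNReal.ofReal (‖x‖ ^ β)) :=
        mul_le_mul' le_rfl (mul_le_mul' (ENNReal.ofReal_le_ofReal
          ((le_abs_self _).trans (hB x hx))) le_rfl)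
    _ = _ := by ring

/-- A matrix-valued function with weakly measurable rows agrees a.e. with a measurable one. -/
theorem exists_measurable_jacobi {U : Set (En n)} {φ : En n → En n}
    {D : En n → Matrix (Fin n) (Fin n) ℝ} (hD : IsWeakJacobiOn U φ D) :
    ∃ M : En n → Matrix (Fin n) (Fin n) ℝ, (∀ i, Measurable fun x => rowVec (M x) i) ∧
      D =ᵐ[volume.restrict U] M ∧ IsWeakJacobiOn U φ M := by
  have hm : ∀ i, AEStronglyMeasurable (fun x => rowVec (D x) i) (volume.restrict U) := fun i =>
    (hD i).2.1.aestronglyMeasurable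
  refine ⟨fun x i j => (hm i).mk _ x j, fun i => (hm i).stronglyMeasurable_mk.measurable, ?_,
    fun i => (hD i).congr (hm i).ae_eq_mk⟩
  filter_upwards [ae_all_iff.2 fun i => (hm i).ae_eq_mk] with x hx
  ext i j
  rw [← hx i]
  rfl

end PowerWeight

section OriginPreimage

variable {n : ℕ} {Ω Ω' : Set (En n)} {φ ψ : En n → En n}

theorem inter_preimage_compl_zero (hφ : IsHomeoOn Ω Ω' φ ψ) :
    Ω' ∩ ψ ⁻¹' {0}ᶜ = Ω' \ {φ 0} ∨ Ω' ∩ ψ ⁻¹' {0}ᶜ = Ω' := by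
  obtain ⟨-, -, -, hψm, hl, hr⟩ := hφ
  by_cases h0 : (0 : En n) ∈ Ω
  · left
    ext y
    refine and_congr_right fun hy => not_congr ⟨fun h => ?_, fun h => ?_⟩
    · rw [mem_singleton_iff] at h ⊢
      rw [← hr y hy, h]
    · rw [mem_singleton_iff.1 h, mem_singleton_iff, hl 0 h0]
  · right
    refine inter_eq_left.2 fun y hy h => h0 ?_
    rw [← mem_singleton_iff.1 h]
    exact hψm hy

theorem inter_preimage_compl_zero_ae_eq (hn : 1 ≤ n) (hφ : IsHomeoOn Ω Ω' φ ψ) :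
    (Ω' ∩ ψ ⁻¹' {0}ᶜ : Set (En n)) =ᵐ[volume] Ω' := by
  have : Nonempty (Fin n) := ⟨⟨0, hn⟩⟩
  rcases inter_preimage_compl_zero hφ with h | h
  · rw [h]
    exact sdiff_null_ae_eq_self (measure_singleton _)
  · rw [h]
    exact ae_eq_refl _

/-- Weak gradients extend across the preimage of the origin. -/
theorem isWeakGradOn_of_inter_preimage_compl_zero (hn : 2 ≤ n) (hΩ' : IsOpen Ω')
    (hφ : IsHomeoOn Ω Ω' φ ψ) {F : En n → ℝ} {g : En n → En n} (hF : ContinuousOn F Ω')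
    (hg : ∀ K ⊆ Ω', IsCompact K → ∫⁻ y in K ∩ (Ω' ∩ ψ ⁻¹' {0}ᶜ), ‖g y‖ₑ ≠ ⊤)
    (h : IsWeakGradOn (Ω' ∩ ψ ⁻¹' {0}ᶜ) F g) : IsWeakGradOn Ω' F g := by
  have hae := inter_preimage_compl_zero_ae_eq (by omega) hφ
  have hgl : LocallyIntegrableOn g Ω' := by
    rw [locallyIntegrableOn_iff hΩ'.isLocallyClosed]
    intro K hK hKc
    have hK' : (K ∩ (Ω' ∩ ψ ⁻¹' {0}ᶜ) : Set (En n)) =ᵐ[volume] K := by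
      have := (ae_eq_refl K).inter hae
      rwa [inter_eq_self_of_subset_left hK] at this
    refine IntegrableOn.congr_set_ae ⟨?_, ?_⟩ hK'.symm
    · exact h.2.1.aestronglyMeasurable.mono_set inter_subset_right
    · exact (hg K hK hKc).lt_top
  rcases inter_preimage_compl_zero hφ with h' | h'
  · rw [h'] at h
    exact isWeakGradOn_of_diff_singleton hn hΩ' hF hgl h
  · rwa [h'] at h

end OriginPreimage

section InverseRegularity

variable {m : ℕ} {q α p : ℝ} {Ω Ω' : Set (En (m + 1))} {φ ψ : En (m + 1) → En (m + 1)}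
  {M : En (m + 1) → Matrix (Fin (m + 1)) (Fin (m + 1)) ℝ}

/-- Away from the origin a homeomorphism of finite weighted energy is a Sobolev homeomorphism. -/
theorem sobolevHomeo_inter_compl_zero (hΩ : IsOpen Ω) (hΩ' : IsOpen Ω')
    (hφ : IsHomeoOn Ω Ω' φ ψ) (hq : 0 ≤ q) (hM : IsWeakJacobiOn Ω φ M)
    (hMm : ∀ i, Measurable fun x => rowVec (M x) i)
    (hE : ∫⁻ x in Ω, (ENNReal.ofReal (opNorm (M x)) * ENNReal.ofReal (‖x‖ ^ α)) ^ q ≠ ⊤) :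
    SobolevHomeo q (Ω ∩ {0}ᶜ) (Ω' ∩ ψ ⁻¹' {0}ᶜ) φ ψ M where
  isOpen := hΩ.inter isOpen_compl_singleton
  isOpen' := hφ.2.1.isOpen_inter_preimage hΩ' isOpen_compl_singleton
  homeo := by
    obtain ⟨h1, h2, h3, h4, h5, h6⟩ := hφ
    refine ⟨h1.mono inter_subset_left, h2.mono inter_subset_left, fun x hx => ⟨h3 hx.1, ?_⟩,
      fun y hy => ⟨h4 hy.1, hy.2⟩, fun x hx => h5 x hx.1, fun y hy => h6 y hy.1⟩
    rw [mem_preimage, h5 x hx.1]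
    exact hx.2
  jacobi := fun i => (hM i).mono inter_subset_left
  meas := hMm
  loc := fun K hK hKc => setLIntegral_rpow_ne_top_of_norm_rpow (fun x hx => (hK hx).2) hKc hq α
    (ne_top_of_le_ne_top hE (lintegral_mono_set fun x hx => (hK hx).1))

/-- Regularity of the inverse: Sobolev regularity together with the composition estimate. -/
theorem inverse_regularity (hm : 1 ≤ m) (hΩ : IsOpen Ω) (hΩ' : IsOpen Ω')
    (hφ : IsHomeoOn Ω Ω' φ ψ) (hq : (m : ℝ) < q) (hp : p.HolderConjugate (q / m))
    (hα : p * (α * m) < m + 1) (hM : IsWeakJacobiOn Ω φ M)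
    (hMm : ∀ i, Measurable fun x => rowVec (M x) i)
    (hE : ∫⁻ x in Ω, (ENNReal.ofReal (opNorm (M x)) * ENNReal.ofReal (‖x‖ ^ α)) ^ q ≠ ⊤)
    (hFD : ∀ᵐ x, x ∈ Ω → (M x).det = 0 → M x = 0) :
    (∃ Dψ, IsWeakJacobiOn Ω' ψ Dψ) ∧
      BddCompOp Ω' Ω ψ p (fun x => ‖x‖ ^ (-(α * m))) 1 (fun _ => 1) := by
  have hmR : (0 : ℝ) < m := by exact_mod_cast hm
  have hqm : 0 ≤ m / q := div_nonneg hmR.le (hmR.trans hq).le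
  have hp0 : 0 ≤ 1 / p := (one_div_pos.2 hp.pos).le
  have h := sobolevHomeo_inter_compl_zero hΩ hΩ' hφ (hmR.trans hq).le hM hMm hE
  set U := Ω ∩ {0}ᶜ with hU
  set U' := Ω' ∩ ψ ⁻¹' {0}ᶜ with hU'
  have hU0 : U ⊆ {0}ᶜ := inter_subset_right
  have hUm : MeasurableSet U := h.isOpen.measurableSet
  have hG := h.measurable_ofReal_opNorm
  set E := ∫⁻ x in Ω, (ENNReal.ofReal (opNorm (M x)) * ENNReal.ofReal (‖x‖ ^ α)) ^ q with hEdef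
  have hEm : E ^ (m / q) ≠ ⊤ := ENNReal.rpow_ne_top_of_nonneg hqm hE
  have hHolder : ∀ S ⊆ U, MeasurableSet S → ∀ H : En (m + 1) → ℝ≥0∞, Measurable H →
      ∫⁻ x in S, ENNReal.ofReal (opNorm (M x)) ^ (m : ℝ) * H x
        ≤ E ^ (m / q) * (∫⁻ x in S, (H x * ENNReal.ofReal (‖x‖ ^ (-(α * m)))) ^ p) ^ (1 / p) :=
    fun S hS hSm H hH => (setLIntegral_rpow_mul_le_norm_rpow hSm (hS.trans hU0) hmR hp α hG hH).trans
      (mul_le_mul' (ENNReal.rpow_le_rpow (lintegral_mono_set fun x hx => (hS hx).1) hqm) le_rfl)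
  -- an admissible weight for the construction of the inverse
  have hW : ∫⁻ x in U, ENNReal.ofReal (opNorm (M x)) ^ (m : ℝ)
      * ENNReal.ofReal (‖x‖ ^ (α * m) * (1 + ‖x‖) ^ (-((m : ℝ) + 2))) ≠ ⊤ := by
    refine ne_top_of_le_ne_top (ENNReal.mul_ne_top hEm (ENNReal.rpow_ne_top_of_nonneg hp0 ?_))
      (hHolder U Subset.rfl hUm _ (by fun_prop))
    have hfin : ∫⁻ x : En (m + 1), ENNReal.ofReal ((1 + ‖x‖) ^ (-((m : ℝ) + 2))) < ⊤ :=
      finite_integral_one_add_norm (by rw [finrank_euclideanSpace_fin]; push_cast; linarith)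
    refine ne_top_of_le_ne_top hfin.ne
      (le_trans (setLIntegral_mono' hUm fun x hx => ?_) (setLIntegral_le_lintegral U _))
    have hx0 : 0 < ‖x‖ := norm_pos_iff.2 (hU0 hx)
    have h1 : (1 + ‖x‖) ^ (-((m : ℝ) + 2)) ≤ 1 :=
      Real.rpow_le_one_of_one_le_of_nonpos (by linarith) (by linarith)
    have h2 : ‖x‖ ^ (α * m) * (1 + ‖x‖) ^ (-((m : ℝ) + 2)) * ‖x‖ ^ (-(α * m))
        = (1 + ‖x‖) ^ (-((m : ℝ) + 2)) := by
      rw [mul_right_comm, ← Real.rpow_add hx0]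
      simp
    rw [← ENNReal.ofReal_mul (by positivity), h2]
    calc ENNReal.ofReal ((1 + ‖x‖) ^ (-((m : ℝ) + 2))) ^ p
        ≤ ENNReal.ofReal ((1 + ‖x‖) ^ (-((m : ℝ) + 2))) ^ (1 : ℝ) :=
          ENNReal.rpow_le_rpow_of_exponent_ge (by simpa using h1) hp.lt.le
      _ = _ := ENNReal.rpow_one _
  obtain ⟨ρ, C, D, hρm, hρ0, hC, hD, hDρ, hρ⟩ := h.exists_jacobi_inverse hm hq
    (by filter_upwards [hFD] with x hx hxU using hx hxU.1)
    (W := fun x => ‖x‖ ^ (α * m) * (1 + ‖x‖) ^ (-((m : ℝ) + 2)))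
    (((continuousOn_norm_rpow _).mono hU0).mul (Continuous.continuousOn
      ((continuous_const.add continuous_norm).rpow_const fun x =>
        Or.inl (add_pos_of_pos_of_nonneg one_pos (norm_nonneg x)).ne')))
    (fun x hx => by
      have hx0 : 0 < ‖x‖ := norm_pos_iff.2 (hU0 hx)
      positivity) (by fun_prop) hW
  refine ⟨⟨D, fun i => isWeakGradOn_of_inter_preimage_compl_zero (by omega) hΩ' hφ ?_ ?_ (hD i)⟩,
    ENNReal.ofReal ((m + 1) * (m + 1) * C) * E ^ (m / q),
    ENNReal.mul_ne_top ENNReal.ofReal_ne_top hEm, ?_⟩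
  · exact (EuclideanSpace.proj (𝕜 := ℝ) i).continuous.comp_continuousOn hφ.2.1
  · intro K hK hKc
    have hLc : IsCompact (ψ '' K) := hKc.image_of_continuousOn (hφ.2.1.mono hK)
    have hLm : MeasurableSet (ψ '' K) := hLc.measurableSet
    have hKU : MeasurableSet (K ∩ U') := hKc.measurableSet.inter h.isOpen'.measurableSet
    have hfin : ∫⁻ y in K ∩ U', ENNReal.ofReal (ρ y) ≠ ⊤ := by
      have h1 : ∫⁻ y in K ∩ U', ENNReal.ofReal (ρ y)
          ≤ ∫⁻ y in U', (ψ '' K).indicator 1 (ψ y) * ENNReal.ofReal (ρ y) := by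
        refine le_trans (setLIntegral_mono' hKU fun y hy => ?_)
          (lintegral_mono_set inter_subset_right)
        rw [indicator_of_mem (mem_image_of_mem ψ hy.1), Pi.one_apply, one_mul]
      refine ne_top_of_le_ne_top ?_
        (h1.trans (hρ _ (measurable_one.indicator hLm)))
      have h2 : ∫⁻ x in U, ENNReal.ofReal (opNorm (M x)) ^ (m : ℝ) * (ψ '' K).indicator 1 x
          = ∫⁻ x in U ∩ ψ '' K, ENNReal.ofReal (opNorm (M x)) ^ (m : ℝ) * 1 := by
        rw [inter_comm, ← Measure.restrict_restrict hLm, ← lintegral_indicator hLm]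
        refine lintegral_congr fun x => ?_
        by_cases hx : x ∈ ψ '' K <;> simp [hx]
      rw [h2]
      refine ne_top_of_le_ne_top (ENNReal.mul_ne_top hEm (ENNReal.rpow_ne_top_of_nonneg hp0 ?_))
        (hHolder _ inter_subset_left (hUm.inter hLm) _ measurable_const)
      have hloc := (locallyIntegrable_norm_rpow (n := m + 1) (by omega) (β := -(p * (α * m)))
        (by push_cast; linarith)).integrableOn_isCompact hLc
      have hfin2 : ∫⁻ x in ψ '' K, ‖‖x‖ ^ (-(p * (α * m)))‖ₑ ≠ ⊤ := hloc.2.ne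
      refine ne_top_of_le_ne_top hfin2 (le_trans (lintegral_mono fun x => ?_)
        (lintegral_mono_set inter_subset_right))
      rw [one_mul, ENNReal.ofReal_rpow_of_nonneg (by positivity) hp.pos.le,
        ← Real.rpow_mul (norm_nonneg _), Real.enorm_eq_ofReal (by positivity)]
      exact ENNReal.ofReal_le_ofReal (le_of_eq (by congr 1; ring))
    refine ne_top_of_le_ne_top (ENNReal.mul_ne_top
      (ENNReal.ofReal_ne_top (r := (m + 1) * C)) hfin) ?_
    rw [← lintegral_const_mul' _ _ ENNReal.ofReal_ne_top]
    refine lintegral_mono_ae ((ae_restrict_iff' hKU).2 ?_)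
    filter_upwards [hDρ] with y hy hyK
    rw [← ofReal_norm, ← ENNReal.ofReal_mul (by positivity)]
    refine ENNReal.ofReal_le_ofReal ((norm_le_sum_norm_apply _).trans ?_)
    calc _ ≤ ∑ _j : Fin (m + 1), C * ρ y := Finset.sum_le_sum fun j _ => hy hyK.2 i j
      _ = _ := by
        simp
        ring
  · intro f gf hf hgf hfin
    set g₀ := hgf.2.1.aestronglyMeasurable.mk gf with hg₀
    have hg₀m : Measurable g₀ := hgf.2.1.aestronglyMeasurable.stronglyMeasurable_mk.measurable
    have hg₀ae : gf =ᵐ[volume.restrict Ω] g₀ := hgf.2.1.aestronglyMeasurable.ae_eq_mk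
    have hN : gradNormLp Ω (fun x => ‖x‖ ^ (-(α * m))) p gf
        = (∫⁻ x in Ω, (‖g₀ x‖ₑ * ENNReal.ofReal (‖x‖ ^ (-(α * m)))) ^ p) ^ (1 / p) := by
      unfold gradNormLp
      congr 1
      refine lintegral_congr_ae ?_
      filter_upwards [hg₀ae] with x hx
      rw [hx, ENNReal.ofReal_mul (norm_nonneg _), ofReal_norm]
    have hgint : ∫⁻ x in Ω, (‖g₀ x‖ₑ * ENNReal.ofReal (‖x‖ ^ (-(α * m)))) ^ p ≠ ⊤ := fun htop => by
      rw [hN, htop, ENNReal.top_rpow_of_pos (one_div_pos.2 hp.pos)] at hfin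
      exact hfin rfl
    obtain ⟨hgrad, hbd⟩ := h.isWeakGradOn_comp_inverse hm hp hC hD hDρ hρ
      (hf.mono inter_subset_left) ((hgf.congr hg₀ae).mono inter_subset_left) hg₀m
      fun K hK hKc => setLIntegral_rpow_ne_top_of_norm_rpow (fun x hx => hU0 (hK hx)) hKc
        hp.pos.le (-(α * m))
        (ne_top_of_le_ne_top hgint (lintegral_mono_set fun x hx => (hK hx).1))
    have hnorm : ∫⁻ y in U', ‖∑ j, g₀ (ψ y) j • rowVec (D y) j‖ₑ
        ≤ ENNReal.ofReal ((m + 1) * (m + 1) * C) * E ^ (m / q)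
          * gradNormLp Ω (fun x => ‖x‖ ^ (-(α * m))) p gf := by
      calc ∫⁻ y in U', ‖∑ j, g₀ (ψ y) j • rowVec (D y) j‖ₑ
          ≤ ∫⁻ y in U', ENNReal.ofReal ((m + 1) * (m + 1) * C)
              * (‖g₀ (ψ y)‖ₑ * ENNReal.ofReal (ρ y)) :=
            lintegral_mono_ae ((ae_restrict_iff' h.isOpen'.measurableSet).2 hbd)
        _ = ENNReal.ofReal ((m + 1) * (m + 1) * C)
              * ∫⁻ y in U', ‖g₀ (ψ y)‖ₑ * ENNReal.ofReal (ρ y) :=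
            lintegral_const_mul' _ _ ENNReal.ofReal_ne_top
        _ ≤ _ := by
            rw [mul_assoc (ENNReal.ofReal _), hN]
            refine mul_le_mul' le_rfl ((hρ _ hg₀m.enorm).trans
              ((hHolder U Subset.rfl hUm _ hg₀m.enorm).trans (mul_le_mul' le_rfl
                (ENNReal.rpow_le_rpow (lintegral_mono_set inter_subset_left) hp0))))
    refine ⟨_, isWeakGradOn_of_inter_preimage_compl_zero (by omega) hΩ' hφ
      (hf.comp hφ.2.1 hφ.2.2.2.1) (fun K _ _ => ?_) hgrad, le_trans (le_of_eq ?_) hnorm⟩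
    · exact ne_top_of_le_ne_top (ENNReal.mul_ne_top (ENNReal.mul_ne_top ENNReal.ofReal_ne_top hEm)
        hfin) ((lintegral_mono_set inter_subset_right).trans hnorm)
    · unfold gradNormLp
      rw [setLIntegral_congr (inter_preimage_compl_zero_ae_eq (by omega) hφ)]
      simp only [mul_one, ENNReal.rpow_one, one_div, inv_one, ofReal_norm]

end InverseRegularity

section MuckenhouptPower

variable {n : ℕ}

theorem setLIntegral_ball_zero_norm_rpow {t : ℝ} (ht : 0 < t) (β : ℝ) :
    ∫⁻ y in ball (0 : En n) t, ENNReal.ofReal (‖y‖ ^ β)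
      = ENNReal.ofReal (t ^ n) * (ENNReal.ofReal (t ^ β)
        * ∫⁻ y in ball (0 : En n) 1, ENNReal.ofReal (‖y‖ ^ β)) := by
  have h := lintegral_comp_smul_add volume
    ((ball (0 : En n) t).indicator fun y => ENNReal.ofReal (‖y‖ ^ β)) ht.ne' 0
  have h1 : ∀ y : En n, (ball (0 : En n) t).indicator (fun y => ENNReal.ofReal (‖y‖ ^ β)) (t • y + 0)
      = (ball (0 : En n) 1).indicator
        (fun y => ENNReal.ofReal (t ^ β) * ENNReal.ofReal (‖y‖ ^ β)) y := by
    intro y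
    have hiff : t • y + 0 ∈ ball (0 : En n) t ↔ y ∈ ball (0 : En n) 1 := by
      rw [add_zero, mem_ball_zero_iff, mem_ball_zero_iff, norm_smul, Real.norm_of_nonneg ht.le]
      exact mul_lt_iff_lt_one_right ht
    by_cases hy : y ∈ ball (0 : En n) 1
    · rw [indicator_of_mem (hiff.2 hy), indicator_of_mem hy, add_zero, norm_smul,
        Real.norm_of_nonneg ht.le, Real.mul_rpow ht.le (norm_nonneg _),
        ENNReal.ofReal_mul (by positivity)]
    · rw [indicator_of_notMem (mt hiff.1 hy), indicator_of_notMem hy]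
  simp only [h1] at h
  rw [lintegral_indicator measurableSet_ball, lintegral_indicator measurableSet_ball,
    lintegral_const_mul' _ _ ENNReal.ofReal_ne_top, finrank_euclideanSpace_fin] at h
  rw [h, ← mul_assoc, ← ENNReal.ofReal_mul (by positivity), abs_of_pos (by positivity),
    mul_inv_cancel₀ (by positivity), ENNReal.ofReal_one, one_mul]

/-- Averages of a power weight over a ball `ball x r` are controlled by `max ‖x‖ (2 * r) ^ β`. -/
theorem exists_average_norm_rpow_le (hn : 1 ≤ n) {β : ℝ} (hβ : -(n : ℝ) < β) :
    ∃ C : ℝ≥0∞, C ≠ ⊤ ∧ ∀ (x : En n) (r : ℝ), 0 < r →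
      (volume (ball x r))⁻¹ * ∫⁻ y in ball x r, ENNReal.ofReal (‖y‖ ^ β)
        ≤ C * ENNReal.ofReal (max ‖x‖ (2 * r) ^ β) := by
  set V := volume (ball (0 : En n) 1) with hV
  set I := ∫⁻ y in ball (0 : En n) 1, ENNReal.ofReal (‖y‖ ^ β) with hI
  have hV0 : V ≠ 0 := (measure_ball_pos volume _ one_pos).ne'
  have hItop : I ≠ ⊤ := by
    have hloc := (locallyIntegrable_norm_rpow hn hβ).integrableOn_isCompact
      (isCompact_closedBall (0 : En n) 1)
    have hfin : ∫⁻ y in closedBall (0 : En n) 1, ‖‖y‖ ^ β‖ₑ ≠ ⊤ := hloc.2.ne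
    refine ne_top_of_le_ne_top hfin (le_trans (lintegral_mono fun y => ?_)
      (lintegral_mono_set ball_subset_closedBall))
    rw [Real.enorm_eq_ofReal (by positivity)]
  refine ⟨ENNReal.ofReal (4 ^ n) * ENNReal.ofReal (2 ^ β) * (V⁻¹ * I) + ENNReal.ofReal (2 ^ |β|),
    ENNReal.add_ne_top.2 ⟨ENNReal.mul_ne_top (ENNReal.mul_ne_top ENNReal.ofReal_ne_top
      ENNReal.ofReal_ne_top) (ENNReal.mul_ne_top (ENNReal.inv_ne_top.2 hV0) hItop),
      ENNReal.ofReal_ne_top⟩, fun x r hr => ?_⟩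
  rw [add_mul]
  rcases le_total ‖x‖ (2 * r) with hx | hx
  · refine le_add_right ?_
    rw [max_eq_right hx]
    have hsub : ball x r ⊆ ball (0 : En n) (4 * r) := fun y hy => by
      rw [mem_ball_zero_iff]
      have h1 := norm_le_norm_add_norm_sub x y
      rw [mem_ball, dist_eq_norm, norm_sub_rev] at hy
      linarith
    have hvol : volume (ball x r) = ENNReal.ofReal (r ^ n) * V := by
      rw [Measure.addHaar_ball_of_pos _ _ hr, finrank_euclideanSpace_fin]
    calc (volume (ball x r))⁻¹ * ∫⁻ y in ball x r, ENNReal.ofReal (‖y‖ ^ β)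
        ≤ (ENNReal.ofReal (r ^ n) * V)⁻¹ * (ENNReal.ofReal ((4 * r) ^ n)
            * (ENNReal.ofReal ((4 * r) ^ β) * I)) := by
          rw [hvol, ← setLIntegral_ball_zero_norm_rpow (by positivity)]
          exact mul_le_mul' le_rfl (lintegral_mono_set hsub)
      _ = ((ENNReal.ofReal (r ^ n))⁻¹ * ENNReal.ofReal (r ^ n)) * (ENNReal.ofReal (4 ^ n)
            * ENNReal.ofReal (2 ^ β) * (V⁻¹ * I) * ENNReal.ofReal ((2 * r) ^ β)) := by
          rw [ENNReal.mul_inv (Or.inr measure_ball_lt_top.ne) (Or.inr hV0), mul_pow,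
            show 4 * r = 2 * (2 * r) by ring, Real.mul_rpow zero_le_two (by positivity),
            ENNReal.ofReal_mul (by positivity), ENNReal.ofReal_mul (by positivity)]
          ring
      _ = _ := by
          rw [ENNReal.inv_mul_cancel (by simpa using pow_pos hr n) ENNReal.ofReal_ne_top, one_mul]
  · refine le_add_left ?_
    rw [max_eq_left hx]
    have hx0 : 0 < ‖x‖ := by linarith
    have hb : ∀ y ∈ ball x r, ENNReal.ofReal (‖y‖ ^ β)
        ≤ ENNReal.ofReal (2 ^ |β|) * ENNReal.ofReal (‖x‖ ^ β) := by
      intro y hy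
      rw [mem_ball, dist_eq_norm] at hy
      have h1 := norm_le_norm_add_norm_sub x y
      have h2 := norm_le_norm_add_norm_sub y x
      rw [norm_sub_rev] at hy
      rw [← ENNReal.ofReal_mul (by positivity)]
      refine ENNReal.ofReal_le_ofReal ?_
      rcases le_total 0 β with h | h
      · rw [abs_of_nonneg h, ← Real.mul_rpow zero_le_two hx0.le]
        exact Real.rpow_le_rpow (norm_nonneg _) (by linarith [norm_sub_rev x y]) h
      · rw [abs_of_nonpos h, Real.rpow_neg zero_le_two, ← Real.inv_rpow zero_le_two,
          ← Real.mul_rpow (by norm_num) hx0.le]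
        exact Real.rpow_le_rpow_of_nonpos (by positivity) (by linarith [norm_sub_rev x y]) h
    calc (volume (ball x r))⁻¹ * ∫⁻ y in ball x r, ENNReal.ofReal (‖y‖ ^ β)
        ≤ (volume (ball x r))⁻¹ * ((ENNReal.ofReal (2 ^ |β|) * ENNReal.ofReal (‖x‖ ^ β))
            * volume (ball x r)) := by
          rw [← setLIntegral_const]
          exact mul_le_mul' le_rfl (setLIntegral_mono' measurableSet_ball hb)
      _ = _ := by
          rw [mul_comm _ (volume (ball x r)), ← mul_assoc,
            ENNReal.inv_mul_cancel (measure_ball_pos volume _ hr).ne' measure_ball_lt_top.ne,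
            one_mul]

/-- Power weights of exponent between `-n` and `n (p - 1)` are Muckenhoupt weights. -/
theorem isMuckenhoupt_norm_rpow (hn : 1 ≤ n) {p β : ℝ} (hp : 1 < p) (hβ : -(n : ℝ) < β)
    (hβ' : β < n * (p - 1)) : IsMuckenhoupt n p fun x => ‖x‖ ^ β := by
  have hp1 : 0 < p - 1 := by linarith
  have hp0 : 0 ≤ 1 / p := by positivity
  have hp0' : 0 ≤ 1 - 1 / p := by
    rw [sub_nonneg, div_le_one (by linarith)]
    exact hp.le
  obtain ⟨A, hA, hA'⟩ := exists_average_norm_rpow_le hn hβ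
  obtain ⟨B, hB, hB'⟩ := exists_average_norm_rpow_le hn (β := β * (-(1 / (p - 1)))) (by
    rw [mul_neg, neg_lt_neg_iff, mul_one_div, div_lt_iff₀ hp1]
    exact hβ')
  refine ⟨A ^ (1 / p) * B ^ (1 - 1 / p), ENNReal.mul_ne_top (ENNReal.rpow_ne_top_of_nonneg hp0 hA)
    (ENNReal.rpow_ne_top_of_nonneg hp0' hB), fun x r hr => ?_⟩
  have hs : 0 < max ‖x‖ (2 * r) := lt_max_of_lt_right (by positivity)
  simp only [← Real.rpow_mul (norm_nonneg _)]
  refine (mul_le_mul' (ENNReal.rpow_le_rpow (hA' x r hr) hp0)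
    (ENNReal.rpow_le_rpow (hB' x r hr) hp0')).trans (le_of_eq ?_)
  rw [ENNReal.mul_rpow_of_nonneg _ _ hp0, ENNReal.mul_rpow_of_nonneg _ _ hp0', mul_mul_mul_comm,
    ENNReal.ofReal_rpow_of_nonneg (by positivity) hp0,
    ENNReal.ofReal_rpow_of_nonneg (by positivity) hp0', ← Real.rpow_mul hs.le,
    ← Real.rpow_mul hs.le, ← ENNReal.ofReal_mul (by positivity), ← Real.rpow_add hs]
  have : β * (1 / p) + β * -(1 / (p - 1)) * (1 - 1 / p) = 0 := by
    field_simp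
    ring
  rw [this, Real.rpow_zero, ENNReal.ofReal_one, mul_one]

end MuckenhouptPower

/-- Regularity of the inverse of a Sobolev homeomorphism with power
weight `w(x) = |x|^α`, `−n/q < α < n/(q̃(n−1))`, `q̃ = q/(q−n+1)`: the inverse belongs to
`W¹_{1,loc}(Ω̃;Ω)` and generates a bounded composition operator
`(φ⁻¹)* : L¹_{q̃}(Ω,|x|^{α(1−n)}) → L¹_1(Ω̃)`; moreover `|x|^{q̃α(1−n)} ∈ A_{q̃}`. -/
theorem inverse_regularity_power_weight
    (n : ℕ) (hn : 2 ≤ n) (Ω Ω' : Set (En n))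
    (hΩ : IsDomainSet Ω) (hΩ' : IsDomainSet Ω')
    (q : ℝ) (hq : (n : ℝ) - 1 < q)
    (qt : ℝ) (hqt : qt = q / (q - n + 1))
    (α : ℝ) (hα₁ : -(n : ℝ) / q < α) (hα₂ : α < (n : ℝ) / (qt * (n - 1)))
    (φ ψ : En n → En n) (hφ : IsHomeoOn Ω Ω' φ ψ)
    (Dφ : En n → Matrix (Fin n) (Fin n) ℝ)
    (hSob : MapInL1q Ω (fun x => ‖x‖ ^ α) q φ Dφ)
    (hN : LuzinN Ω φ) (hFD : HasFiniteDistortionOn Ω Dφ) :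
    (∃ Dψ, IsWeakJacobiOn Ω' ψ Dψ) ∧
      BddCompOp Ω' Ω ψ qt (fun x => ‖x‖ ^ (α * (1 - (n : ℝ)))) 1 (fun _ => 1) ∧
      IsMuckenhoupt n qt (fun x => ‖x‖ ^ (qt * α * (1 - (n : ℝ)))) := by
  obtain ⟨m, rfl⟩ : ∃ m, n = m + 1 := ⟨n - 1, by omega⟩
  have hm : 1 ≤ m := by omega
  have hmR : (0 : ℝ) < m := by exact_mod_cast hm
  push_cast at hq hqt hα₁ hα₂ ⊢
  have hqm : (m : ℝ) < q := by linarith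
  have hq0 : 0 < q := hmR.trans hqm
  have hd : 0 < q - m := by linarith
  rw [show q - ((m : ℝ) + 1) + 1 = q - m by ring] at hqt
  rw [show (m : ℝ) + 1 - 1 = m by ring] at hα₂
  have hqt0 : 0 < qt := hqt ▸ div_pos hq0 hd
  have hqt1 : 1 < qt := by
    rw [hqt, one_lt_div hd]
    linarith
  have hconj : qt.HolderConjugate (q / m) := by
    rw [Real.holderConjugate_iff]
    refine ⟨hqt1, ?_⟩
    rw [hqt]
    field_simp
    ring
  have hα : qt * (α * m) < m + 1 := by
    rw [lt_div_iff₀ (by positivity)] at hα₂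
    linarith
  obtain ⟨M, hMm, hae, hM⟩ := exists_measurable_jacobi hSob.1
  have hE : ∫⁻ x in Ω, (ENNReal.ofReal (opNorm (M x)) * ENNReal.ofReal (‖x‖ ^ α)) ^ q ≠ ⊤ := by
    convert hSob.2 using 1
    refine lintegral_congr_ae ?_
    filter_upwards [hae] with x hx
    rw [hx, ENNReal.ofReal_mul (opNorm_nonneg _)]
  have hFD' : ∀ᵐ x, x ∈ Ω → (M x).det = 0 → M x = 0 := by
    rw [← ae_restrict_iff' hΩ.1.measurableSet]
    filter_upwards [hFD, hae] with x h1 h2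
    rwa [← h2]
  obtain ⟨h1, h2⟩ := inverse_regularity hm hΩ.1 hΩ'.1 hφ hqm hconj hα hM hMm hE hFD'
  refine ⟨h1, ?_, isMuckenhoupt_norm_rpow (by omega) hqt1 ?_ ?_⟩
  · rwa [show α * (1 - ((m : ℝ) + 1)) = -(α * m) by ring]
  · push_cast
    linarith
  · rw [div_lt_iff₀ hq0] at hα₁
    have h3 : qt - 1 = m / (q - m) := by
      rw [hqt]
      field_simp
      ring
    push_cast
    rw [h3, hqt, mul_div_assoc', lt_div_iff₀ hd]
    rw [show q / (q - m) * α * (1 - ((m : ℝ) + 1)) * (q - m) = (-(α * q)) * m by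
      field_simp
      ring]
    nlinarith
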